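/- arXiv:0906.2915 — 2 statements merged into one kernel-verified Lean document; each statement's English description precedes it below -/
import Mathlib

section
/- Let T be a homeomorphism of a compact metric space X, μ a T-invariant Borel probability measure on X, 𝔛 a Banach space, and 𝒜 : X × ℕ → B(𝔛) a continuous linear cocycle over T such that 𝒜(x,n) is an injective operator for every (x,n) ∈ X × ℕ. Then for μ-almost-every x ∈ X the limits λ(x) := lim_{n→∞} (1/n) log ‖𝒜(x,n)‖ and χ(x) := lim_{n→∞} (1/n) log ‖𝒜(x,n)‖_χ exist in ℝ ∪ {−∞}, and if moreover χ(x) < λ(x) then limsup_{n→∞} (1/n) log ρ(𝒜(x,n)) = λ(x). -/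
open Filter Topology MeasureTheory

noncomputable section

variable {𝕏 : Type*} [NormedAddCommGroup 𝕏] [NormedSpace ℝ 𝕏] [CompleteSpace 𝕏]

/-- The spectral radius `ρ(A) = lim_k ‖A^k‖^{1/k}` (Gelfand limit). -/
def specRad {R : Type*} [NormedRing R] (A : R) : ℝ :=
  Filter.atTop.limsup fun k : ℕ => ‖A ^ k‖ ^ (1 / (k : ℝ))

/-- The set `𝖠ⁿ` of all products of `n` elements of `A`. -/
def prods {R : Type*} [NormedRing R] (A : Set R) (n : ℕ) : Set R :=
  {P | ∃ f : Fin n → R, (∀ i, f i ∈ A) ∧ P = (List.ofFn f).prod}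

/-- The Hausdorff measure of noncompactness `‖L‖_χ` of a bounded operator: the infimum of all
`ε > 0` such that the image of the unit ball under `L` admits a finite `ε`-net. -/
def hmnc (L : 𝕏 →L[ℝ] 𝕏) : ℝ :=
  sInf {ε : ℝ | 0 < ε ∧ ∃ S : Finset 𝕏,
    L '' Metric.closedBall 0 1 ⊆ ⋃ y ∈ S, Metric.ball y ε}

/-- `‖L‖_f`: the distance from `L` to the finite-rank operators. -/
def fdist (L : 𝕏 →L[ℝ] 𝕏) : ℝ :=
  sInf {c : ℝ | ∃ K : 𝕏 →L[ℝ] 𝕏,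
    FiniteDimensional ℝ (LinearMap.range (K : 𝕏 →ₗ[ℝ] 𝕏)) ∧ c = ‖L - K‖}

/-- Logarithm with the convention `log 0 = -∞`. -/
def elog (x : ℝ) : EReal := if x = 0 then ⊥ else ((Real.log x : ℝ) : EReal)

section Kingman

section BirkhoffIndicator

variable {X : Type*} {T : X → X}

theorem birkhoffSum_indicator_nonneg (E : Set X) (n : ℕ) (x : X) :
    0 ≤ birkhoffSum T (E.indicator (1 : X → ℝ)) n x :=
  Finset.sum_nonneg fun _ _ => Set.indicator_nonneg (fun _ _ => zero_le_one) _

theorem birkhoffSum_indicator_le (E : Set X) (n : ℕ) (x : X) :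
    birkhoffSum T (E.indicator (1 : X → ℝ)) n x ≤ n := by
  calc birkhoffSum T (E.indicator (1 : X → ℝ)) n x ≤ ∑ _k ∈ Finset.range n, (1 : ℝ) :=
        Finset.sum_le_sum fun _ _ => Set.indicator_le_self' (fun _ _ => zero_le_one) _
    _ = n := by simp

end BirkhoffIndicator

variable {X : Type*} [MeasurableSpace X] {μ : Measure X} {T : X → X}

/-- A measurable subadditive process over `T` with values in `[-K n, 0]`. -/
structure IsNonposSubadditive (T : X → X) (f : ℕ → X → ℝ) (K : ℝ) : Prop where
  meas : ∀ n, Measurable (f n)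
  nonpos : ∀ n x, f n x ≤ 0
  lower : ∀ n x, -K * n ≤ f n x
  sub : ∀ m n x, f (m + n) x ≤ f m x + f n (T^[m] x)

/-- The lower growth rate of a process. -/
def lowRate (f : ℕ → X → ℝ) (x : X) : ℝ := liminf (fun n : ℕ => f n x / n) atTop

/-- The upper growth rate of a process. -/
def upRate (f : ℕ → X → ℝ) (x : X) : ℝ := limsup (fun n : ℕ => f n x / n) atTop

theorem measurable_birkhoffSum_indicator (hT : Measurable T) {E : Set X} (hE : MeasurableSet E)
    (n : ℕ) : Measurable (birkhoffSum T (E.indicator (1 : X → ℝ)) n) := by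
  unfold birkhoffSum
  exact Finset.measurable_sum _ fun k _ => (measurable_one.indicator hE).comp (hT.iterate k)

theorem integral_birkhoffSum_indicator [IsProbabilityMeasure μ] (hT : MeasurePreserving T μ μ)
    {E : Set X} (hE : MeasurableSet E) (n : ℕ) :
    ∫ x, birkhoffSum T (E.indicator (1 : X → ℝ)) n x ∂μ = n * μ.real E := by
  unfold birkhoffSum
  have h1 : ∀ k, ∫ x, E.indicator (1 : X → ℝ) (T^[k] x) ∂μ = μ.real E := fun k => by
    have hm := hT.iterate k
    rw [← integral_indicator_one hE]
    conv_rhs => rw [← hm.map_eq]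
    rw [integral_map hm.aemeasurable
      (measurable_one.indicator hE).aestronglyMeasurable]
  rw [integral_finsetSum]
  · simp [h1]
  · intro k _
    have hm := hT.iterate k
    exact hm.integrable_comp_of_integrable ((integrable_const (1 : ℝ)).indicator hE)

namespace IsNonposSubadditive

variable {f : ℕ → X → ℝ} {K : ℝ}

theorem le_of_visits (hf : IsNonposSubadditive T f K) {g ε : ℝ} (hg : g ≤ 0) (hε : 0 ≤ ε)
    {E : Set X} {L : ℕ} (n : ℕ) (x : X)
    (hx : ∀ k, T^[k] x ∉ E → ∃ j, 1 ≤ j ∧ j ≤ L ∧ f j (T^[k] x) ≤ j * (g + ε)) :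
    f n x ≤ n * ε + g * (n - L - birkhoffSum T (E.indicator 1) n x) := by
  induction n using Nat.strong_induction_on generalizing x with
  | _ n ih =>
  have hnn := birkhoffSum_indicator_nonneg (T := T) E
  rcases le_or_gt n L with hn | hn
  · have h1 : (n : ℝ) ≤ L := by exact_mod_cast hn
    have h2 := mul_nonneg_of_nonpos_of_nonpos hg
      (by linarith [hnn n x] : (n : ℝ) - L - birkhoffSum T (E.indicator 1) n x ≤ 0)
    have h3 := hf.nonpos n x
    have h4 : 0 ≤ n * ε := by positivity
    linarith
  · have shift : ∀ j k, T^[k] (T^[j] x) = T^[k + j] x := fun j k =>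
      (Function.iterate_add_apply T k j x).symm
    by_cases hE : x ∈ E
    · obtain ⟨m, rfl⟩ : ∃ m, n = 1 + m := ⟨n - 1, by omega⟩
      have h1 := ih m (by omega) (T^[1] x) fun k hk => by
        rw [shift] at hk ⊢; exact hx _ hk
      have h2 := hf.sub 1 m x
      have h3 := hf.nonpos 1 x
      rw [birkhoffSum_add, birkhoffSum_one, Set.indicator_of_mem hE]
      push_cast
      simp only [Pi.one_apply]
      nlinarith
    · obtain ⟨j, hj1, hjL, hj⟩ := hx 0 hE
      obtain ⟨m, rfl⟩ : ∃ m, n = j + m := ⟨n - j, by omega⟩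
      have h1 := ih m (by omega) (T^[j] x) fun k hk => by
        rw [shift] at hk ⊢; exact hx _ hk
      have h2 := hf.sub j m x
      rw [birkhoffSum_add]
      have h4 := mul_nonneg_of_nonpos_of_nonpos hg (neg_nonpos.2 (hnn j x))
      push_cast
      simp only [Function.iterate_zero, id_eq] at hj
      nlinarith

theorem div_mem (hf : IsNonposSubadditive T f K) (hK : 0 ≤ K) (n : ℕ) (x : X) :
    f n x / n ∈ Set.Icc (-K) 0 := by
  rcases Nat.eq_zero_or_pos n with rfl | hn
  · simpa using hK
  · have : (0 : ℝ) < n := by exact_mod_cast hn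
    exact ⟨(le_div_iff₀ this).2 (hf.lower n x),
      div_nonpos_of_nonpos_of_nonneg (hf.nonpos n x) this.le⟩

theorem isBoundedUnder_le (hf : IsNonposSubadditive T f K) (hK : 0 ≤ K) (x : X) :
    IsBoundedUnder (· ≤ ·) atTop fun n : ℕ => f n x / n :=
  isBoundedUnder_of ⟨0, fun n => (hf.div_mem hK n x).2⟩

theorem isBoundedUnder_ge (hf : IsNonposSubadditive T f K) (hK : 0 ≤ K) (x : X) :
    IsBoundedUnder (· ≥ ·) atTop fun n : ℕ => f n x / n :=
  isBoundedUnder_of ⟨-K, fun n => (hf.div_mem hK n x).1⟩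

theorem lowRate_le_upRate (hf : IsNonposSubadditive T f K) (hK : 0 ≤ K) (x : X) :
    lowRate f x ≤ upRate f x :=
  liminf_le_limsup (hf.isBoundedUnder_le hK x) (hf.isBoundedUnder_ge hK x)

theorem neg_le_lowRate (hf : IsNonposSubadditive T f K) (hK : 0 ≤ K) (x : X) :
    -K ≤ lowRate f x :=
  le_liminf_of_le (hf.isBoundedUnder_le hK x).isCoboundedUnder_ge
    (Eventually.of_forall fun n => (hf.div_mem hK n x).1)

theorem upRate_nonpos (hf : IsNonposSubadditive T f K) (hK : 0 ≤ K) (x : X) :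
    upRate f x ≤ 0 :=
  limsup_le_of_le (hf.isBoundedUnder_ge hK x).isCoboundedUnder_le
    (Eventually.of_forall fun n => (hf.div_mem hK n x).2)

theorem lowRate_nonpos (hf : IsNonposSubadditive T f K) (hK : 0 ≤ K) (x : X) :
    lowRate f x ≤ 0 := (hf.lowRate_le_upRate hK x).trans (hf.upRate_nonpos hK x)

theorem measurable_lowRate (hf : IsNonposSubadditive T f K) : Measurable (lowRate f) :=
  Measurable.liminf fun n => (hf.meas n).div_const _

theorem measurable_upRate (hf : IsNonposSubadditive T f K) : Measurable (upRate f) :=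
  Measurable.limsup fun n => (hf.meas n).div_const _

theorem integrable_of_mem_Icc [IsFiniteMeasure μ] {h : X → ℝ} (hm : Measurable h) {a b : ℝ}
    (hb : ∀ x, h x ∈ Set.Icc a b) : Integrable h μ :=
  Integrable.of_mem_Icc a b hm.aemeasurable (Eventually.of_forall hb)

theorem integrable_lowRate [IsFiniteMeasure μ] (hf : IsNonposSubadditive T f K) (hK : 0 ≤ K) :
    Integrable (lowRate f) μ :=
  integrable_of_mem_Icc hf.measurable_lowRate
    fun x => ⟨hf.neg_le_lowRate hK x, hf.lowRate_nonpos hK x⟩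

theorem integrable_upRate [IsFiniteMeasure μ] (hf : IsNonposSubadditive T f K) (hK : 0 ≤ K) :
    Integrable (upRate f) μ :=
  integrable_of_mem_Icc hf.measurable_upRate
    fun x => ⟨(hf.neg_le_lowRate hK x).trans (hf.lowRate_le_upRate hK x), hf.upRate_nonpos hK x⟩

theorem lowRate_le_comp (hf : IsNonposSubadditive T f K) (hK : 0 ≤ K) (x : X) :
    lowRate f x ≤ lowRate f (T x) := by
  refine le_of_forall_lt fun c hc => ?_
  obtain ⟨c₁, hc1, hc1'⟩ := exists_between hc
  obtain ⟨c₂, hc2, hc2'⟩ := exists_between hc1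
  refine hc2.trans_le (le_liminf_of_le (hf.isBoundedUnder_le hK _).isCoboundedUnder_ge ?_)
  have h1 : ∀ᶠ n : ℕ in atTop, c₁ < f (n + 1) x / ((n + 1 : ℕ) : ℝ) :=
    (tendsto_add_atTop_nat 1).eventually
      (eventually_lt_of_lt_liminf hc1' (hf.isBoundedUnder_ge hK x))
  have h2 : ∀ᶠ n : ℕ in atTop, K * (n : ℝ)⁻¹ < c₁ - c₂ := by
    have : Tendsto (fun n : ℕ => K * (n : ℝ)⁻¹) atTop (𝓝 (K * 0)) :=
      tendsto_inv_atTop_nhds_zero_nat.const_mul K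
    rw [mul_zero] at this
    exact this.eventually (gt_mem_nhds (by linarith))
  filter_upwards [h1, h2, eventually_gt_atTop 0] with n h1 h2 hn
  have hn' : (0 : ℝ) < n := by exact_mod_cast hn
  have h3 := hf.sub 1 n x
  rw [add_comm 1 n] at h3
  have h4 := hf.nonpos 1 x
  have h5 := hf.lower n (T x)
  simp only [Function.iterate_one] at h3
  rw [lt_div_iff₀ (by positivity)] at h1
  rw [← div_eq_mul_inv, div_lt_iff₀ hn'] at h2
  rw [le_div_iff₀ hn']
  push_cast at h1
  rcases le_or_gt c₁ (-K) with hK' | hK'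
  · nlinarith
  · nlinarith

theorem lowRate_comp_ae [IsProbabilityMeasure μ] (hT : MeasurePreserving T μ μ)
    (hf : IsNonposSubadditive T f K) (hK : 0 ≤ K) :
    ∀ᵐ x ∂μ, lowRate f (T x) = lowRate f x := by
  have hi := hf.integrable_lowRate (μ := μ) hK
  have hi' : Integrable (fun x => lowRate f (T x)) μ := hT.integrable_comp_of_integrable hi
  have h0 : ∫ x, (lowRate f (T x) - lowRate f x) ∂μ = 0 := by
    rw [integral_sub hi' hi, sub_eq_zero]
    conv_rhs => rw [← hT.map_eq]
    rw [integral_map hT.aemeasurable hf.measurable_lowRate.aestronglyMeasurable]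
  rw [integral_eq_zero_iff_of_nonneg (fun x => sub_nonneg.2 (hf.lowRate_le_comp hK x))
    (hi'.sub hi)] at h0
  filter_upwards [h0] with x hx
  exact sub_eq_zero.1 hx

theorem lowRate_iterate_ae [IsProbabilityMeasure μ] (hT : MeasurePreserving T μ μ)
    (hf : IsNonposSubadditive T f K) (hK : 0 ≤ K) :
    ∀ᵐ x ∂μ, ∀ k, lowRate f (T^[k] x) = lowRate f x := by
  have h : ∀ᵐ x ∂μ, ∀ k, lowRate f (T (T^[k] x)) = lowRate f (T^[k] x) :=
    ae_all_iff.2 fun k => (hT.iterate k).quasiMeasurePreserving.ae (hf.lowRate_comp_ae hT hK)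
  filter_upwards [h] with x hx k
  induction k with
  | zero => rfl
  | succ k ih => rw [Function.iterate_succ_apply', hx, ih]

/-- Points at which no time in `[1, L]` realises the lower growth rate up to `ε`. -/
def exceptional (f : ℕ → X → ℝ) (ε : ℝ) (L : ℕ) : Set X :=
  {x | ∀ j, 1 ≤ j → j ≤ L → j * (lowRate f x + ε) < f j x}

theorem measurableSet_exceptional (hf : IsNonposSubadditive T f K) (ε : ℝ) (L : ℕ) :
    MeasurableSet (exceptional f ε L) := by
  have : exceptional f ε L =
      ⋂ j : ℕ, ⋂ (_ : 1 ≤ j), ⋂ (_ : j ≤ L), {x | j * (lowRate f x + ε) < f j x} := by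
    ext x; simp [exceptional]
  rw [this]
  exact .iInter fun j => .iInter fun _ => .iInter fun _ =>
    measurableSet_lt ((hf.measurable_lowRate.add_const _).const_mul _) (hf.meas j)

theorem tendsto_exceptional [IsProbabilityMeasure μ] (hf : IsNonposSubadditive T f K)
    (hK : 0 ≤ K) {ε : ℝ} (hε : 0 < ε) :
    Tendsto (fun L => μ.real (exceptional f ε L)) atTop (𝓝 0) := by
  have hempty : ⋂ L, exceptional f ε L = ∅ := by
    refine Set.eq_empty_of_forall_notMem fun x hx => ?_
    rw [Set.mem_iInter] at hx
    have h1 : ∃ᶠ n : ℕ in atTop, f n x / n < lowRate f x + ε :=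
      frequently_lt_of_liminf_lt (hf.isBoundedUnder_le hK x).isCoboundedUnder_ge
        (lt_add_of_pos_right (lowRate f x) hε)
    obtain ⟨n, hn, hn1⟩ := (h1.and_eventually (eventually_ge_atTop 1)).exists
    have h2 := hx n n hn1 le_rfl
    have h3 : (0 : ℝ) < n := by exact_mod_cast hn1
    rw [div_lt_iff₀ h3] at hn
    linarith
  have h := tendsto_measure_iInter_atTop (μ := μ) (s := exceptional f ε)
    (fun L => (hf.measurableSet_exceptional ε L).nullMeasurableSet)
    (fun a b hab x hx j hj1 hj => hx j hj1 (hj.trans hab)) ⟨0, measure_ne_top _ _⟩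
  rw [hempty, measure_empty] at h
  simpa [Measure.real, Function.comp_def] using (ENNReal.tendsto_toReal ENNReal.zero_ne_top).comp h

theorem le_of_exceptional [IsProbabilityMeasure μ] (hT : MeasurePreserving T μ μ)
    (hf : IsNonposSubadditive T f K) (hK : 0 ≤ K) {ε : ℝ} (hε : 0 ≤ ε) (L : ℕ) :
    ∀ᵐ x ∂μ, ∀ n, f n x ≤ n * ε + lowRate f x *
      (n - L - birkhoffSum T ((exceptional f ε L).indicator 1) n x) := by
  filter_upwards [hf.lowRate_iterate_ae hT hK] with x hx n
  refine hf.le_of_visits (hf.lowRate_nonpos hK x) hε n x fun k hk => ?_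
  simp only [exceptional, Set.mem_ofPred_eq, not_forall, not_lt] at hk
  obtain ⟨j, h1, h2, h3⟩ := hk
  exact ⟨j, h1, h2, by rwa [hx] at h3⟩

/-- The integral of the time averages does not exceed that of the lower growth rate. -/
theorem le_integral_lowRate [IsProbabilityMeasure μ] (hT : MeasurePreserving T μ μ)
    (hf : IsNonposSubadditive T f K) (hK : 0 ≤ K) {c : ℝ} (hc : ∀ n : ℕ, n * c ≤ ∫ x, f n x ∂μ) :
    c ≤ ∫ x, lowRate f x ∂μ := by
  refine le_of_forall_pos_le_add fun ε hε => ?_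
  have hg := hf.integrable_lowRate (μ := μ) hK
  set I := ∫ x, lowRate f x ∂μ with hI
  have key : ∀ L : ℕ, c ≤ I + ε + K * μ.real (exceptional f ε L) := fun L => by
    set b := birkhoffSum T ((exceptional f ε L).indicator (1 : X → ℝ)) with hb
    have hE := hf.measurableSet_exceptional ε L
    have hbi : ∀ n, Integrable (b n) μ := fun n =>
      integrable_of_mem_Icc (measurable_birkhoffSum_indicator hT.measurable hE n)
        fun x => ⟨birkhoffSum_indicator_nonneg _ n x, birkhoffSum_indicator_le _ n x⟩
    have h1 : ∀ n : ℕ, n * c ≤ n * ε + (n * I - L * I) + K * (n * μ.real (exceptional f ε L)) := by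
      intro n
      have hfi : Integrable (f n) μ :=
        integrable_of_mem_Icc (hf.meas n) fun x => ⟨hf.lower n x, hf.nonpos n x⟩
      have hri :
          Integrable (fun x => (n * ε + (n * lowRate f x - L * lowRate f x)) + K * b n x) μ :=
        ((integrable_const (n * ε : ℝ)).add ((hg.const_mul _).sub (hg.const_mul _))).add
          ((hbi n).const_mul _)
      have h2 : ∫ x, f n x ∂μ ≤
          ∫ x, ((n * ε + (n * lowRate f x - L * lowRate f x)) + K * b n x) ∂μ := by
        refine integral_mono_ae hfi hri ?_
        filter_upwards [hf.le_of_exceptional hT hK hε.le L] with x hx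
        refine (hx n).trans ?_
        have h3 := birkhoffSum_indicator_nonneg (T := T) (exceptional f ε L) n x
        have h4 := hf.neg_le_lowRate hK x
        simp only [hb]
        nlinarith
      rw [integral_add, integral_add, integral_sub, integral_const_mul, integral_const_mul,
        integral_const_mul, integral_const_mul, hb, integral_birkhoffSum_indicator hT hE] at h2
      · have := hc n
        simp only [integral_const, probReal_univ, one_smul] at h2
        linarith
      · exact hg.const_mul _
      · exact hg.const_mul _
      · exact integrable_const _
      · exact (hg.const_mul _).sub (hg.const_mul _)
      · exact (integrable_const _).add ((hg.const_mul _).sub (hg.const_mul _))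
      · exact (hbi n).const_mul _
    have h2 : Tendsto (fun n : ℕ => ε + (I - L * I * (n : ℝ)⁻¹) +
        K * μ.real (exceptional f ε L)) atTop
        (𝓝 (ε + (I - L * I * 0) + K * μ.real (exceptional f ε L))) :=
      ((tendsto_const_nhds.sub (tendsto_inv_atTop_nhds_zero_nat.const_mul _)).const_add
        _).add_const _
    have h3 : c ≤ ε + (I - L * I * 0) + K * μ.real (exceptional f ε L) := by
      refine ge_of_tendsto h2 ?_
      filter_upwards [eventually_gt_atTop 0] with n hn
      have hn' : (0 : ℝ) < n := by exact_mod_cast hn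
      have h4 := h1 n
      refine le_of_mul_le_mul_left ?_ hn'
      calc (n : ℝ) * c ≤ _ := h4
        _ = _ := by field_simp
    linarith
  have h5 : Tendsto (fun L => I + ε + K * μ.real (exceptional f ε L)) atTop
      (𝓝 (I + ε + K * 0)) := ((hf.tendsto_exceptional hK hε).const_mul K).const_add _
  have := ge_of_tendsto' h5 key
  linarith

end IsNonposSubadditive

theorem isNonposSubadditive_neg_birkhoffSum (hT : Measurable T) {E : Set X}
    (hE : MeasurableSet E) :
    IsNonposSubadditive T (fun n x => -birkhoffSum T (E.indicator (1 : X → ℝ)) n x) 1 where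
  meas n := (measurable_birkhoffSum_indicator hT hE n).neg
  nonpos n x := neg_nonpos.2 (birkhoffSum_indicator_nonneg _ n x)
  lower n x := by have := birkhoffSum_indicator_le (T := T) E n x; linarith
  sub m n x := by rw [birkhoffSum_add]; linarith

/-- The lower growth rate of minus the number of visits to a set, on average. -/
theorem neg_measure_le_integral_lowRate [IsProbabilityMeasure μ] (hT : MeasurePreserving T μ μ)
    {E : Set X} (hE : MeasurableSet E) :
    -μ.real E ≤ ∫ x, lowRate (fun n x => -birkhoffSum T (E.indicator (1 : X → ℝ)) n x) x ∂μ := by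
  refine (isNonposSubadditive_neg_birkhoffSum hT.measurable hE).le_integral_lowRate hT zero_le_one
    fun n => ?_
  rw [integral_neg, integral_birkhoffSum_indicator hT hE]
  linarith

namespace IsNonposSubadditive

variable {f : ℕ → X → ℝ} {K : ℝ}

theorem upRate_le_of_exceptional (hT : Measurable T) (hf : IsNonposSubadditive T f K)
    (hK : 0 ≤ K) {ε : ℝ} {L : ℕ} {x : X} (hx : ∀ n, f n x ≤ n * ε + lowRate f x *
      (n - L - birkhoffSum T ((exceptional f ε L).indicator 1) n x)) :
    upRate f x ≤ lowRate f x + ε - K * lowRate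
      (fun n x => -birkhoffSum T ((exceptional f ε L).indicator (1 : X → ℝ)) n x) x := by
  have hE := hf.measurableSet_exceptional ε L
  set b := fun (n : ℕ) x => -birkhoffSum T ((exceptional f ε L).indicator (1 : X → ℝ)) n x with hb
  have hbs := isNonposSubadditive_neg_birkhoffSum hT hE
  refine le_of_forall_pos_le_add fun δ hδ => ?_
  obtain ⟨η, hη, hKη⟩ : ∃ η > 0, K * η ≤ δ / 2 :=
    ⟨δ / 2 / (K + 1), by positivity, by
      rw [← mul_div_assoc, div_le_iff₀ (by linarith)]; nlinarith⟩
  refine limsup_le_of_le (hf.isBoundedUnder_ge hK x).isCoboundedUnder_le ?_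
  have h1 : ∀ᶠ n : ℕ in atTop, lowRate b x - η < b n x / n :=
    eventually_lt_of_lt_liminf (sub_lt_self _ hη) (hbs.isBoundedUnder_ge zero_le_one x)
  have h2 : ∀ᶠ n : ℕ in atTop, (K * L) * (n : ℝ)⁻¹ < δ / 2 := by
    have : Tendsto (fun n : ℕ => (K * L) * (n : ℝ)⁻¹) atTop (𝓝 ((K * L) * 0)) :=
      tendsto_inv_atTop_nhds_zero_nat.const_mul _
    rw [mul_zero] at this
    exact this.eventually (gt_mem_nhds (by linarith))
  filter_upwards [h1, h2, eventually_gt_atTop 0] with n h1 h2 hn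
  have hn' : (0 : ℝ) < n := by exact_mod_cast hn
  have h3 := hx n
  have h4 := hf.neg_le_lowRate hK x
  have h5 := birkhoffSum_indicator_nonneg (T := T) (exceptional f ε L) n x
  have hL : (0 : ℝ) ≤ L := Nat.cast_nonneg _
  rw [lt_div_iff₀ hn'] at h1
  rw [← div_eq_mul_inv, div_lt_iff₀ hn'] at h2
  rw [div_le_iff₀ hn']
  set B := birkhoffSum T ((exceptional f ε L).indicator (1 : X → ℝ)) n x with hB
  have hbB : b n x = -B := rfl
  have h6 : -lowRate f x * B ≤ K * B := mul_le_mul_of_nonneg_right (by linarith) h5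
  have h7 : -lowRate f x * L ≤ K * L := mul_le_mul_of_nonneg_right (by linarith) hL
  have h8 : K * B ≤ K * ((η - lowRate b x) * n) :=
    mul_le_mul_of_nonneg_left (by rw [hbB] at h1; linarith) hK
  have h9 : K * η * n ≤ δ / 2 * n := mul_le_mul_of_nonneg_right hKη hn'.le
  nlinarith

/-- Kingman's theorem for bounded processes: the growth rate exists almost everywhere. -/
theorem upRate_eq_lowRate_ae [IsProbabilityMeasure μ] (hT : MeasurePreserving T μ μ)
    (hf : IsNonposSubadditive T f K) (hK : 0 ≤ K) :
    ∀ᵐ x ∂μ, upRate f x = lowRate f x := by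
  have hi := hf.integrable_lowRate (μ := μ) hK
  have hi' := hf.integrable_upRate (μ := μ) hK
  have key : ∫ x, upRate f x ∂μ ≤ ∫ x, lowRate f x ∂μ := by
    refine le_of_forall_pos_le_add fun ε hε => ?_
    have h1 : ∀ L : ℕ, ∫ x, upRate f x ∂μ ≤
        ∫ x, lowRate f x ∂μ + ε + K * μ.real (exceptional f ε L) := fun L => by
      have hE := hf.measurableSet_exceptional ε L
      have hbs := isNonposSubadditive_neg_birkhoffSum hT.measurable hE
      have hbi := (hbs.integrable_lowRate (μ := μ) zero_le_one)
      have h2 := neg_measure_le_integral_lowRate hT hE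
      have h3 : ∫ x, upRate f x ∂μ ≤ ∫ x, (lowRate f x + ε - K * lowRate
          (fun n x => -birkhoffSum T ((exceptional f ε L).indicator (1 : X → ℝ)) n x) x) ∂μ := by
        refine integral_mono_ae hi' ((hi.add (integrable_const ε)).sub (hbi.const_mul K)) ?_
        filter_upwards [hf.le_of_exceptional hT hK hε.le L] with x hx
        exact hf.upRate_le_of_exceptional hT.measurable hK hx
      rw [integral_sub (f := fun x => lowRate f x + ε) (hi.add (integrable_const ε))
          (hbi.const_mul K),
        integral_add (f := fun x => lowRate f x) (g := fun _ => ε) hi (integrable_const ε),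
        integral_const_mul] at h3
      simp only [integral_const, probReal_univ, one_smul] at h3
      nlinarith
    have h5 : Tendsto (fun L => ∫ x, lowRate f x ∂μ + ε + K * μ.real (exceptional f ε L)) atTop
        (𝓝 (∫ x, lowRate f x ∂μ + ε + K * 0)) :=
      ((hf.tendsto_exceptional hK hε).const_mul K).const_add _
    have := ge_of_tendsto' h5 h1
    linarith
  have h0 : ∫ x, (upRate f x - lowRate f x) ∂μ = 0 := by
    refine le_antisymm ?_ (integral_nonneg fun x => sub_nonneg.2 (hf.lowRate_le_upRate hK x))
    rw [integral_sub hi' hi]; linarith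
  rw [integral_eq_zero_iff_of_nonneg (fun x => sub_nonneg.2 (hf.lowRate_le_upRate hK x))
    (hi'.sub hi)] at h0
  filter_upwards [h0] with x hx
  exact sub_eq_zero.1 hx

theorem tendsto_ae [IsProbabilityMeasure μ] (hT : MeasurePreserving T μ μ)
    (hf : IsNonposSubadditive T f K) (hK : 0 ≤ K) :
    ∀ᵐ x ∂μ, Tendsto (fun n : ℕ => f n x / n) atTop (𝓝 (lowRate f x)) := by
  filter_upwards [hf.upRate_eq_lowRate_ae hT hK] with x hx
  exact tendsto_of_liminf_eq_limsup rfl hx (hf.isBoundedUnder_le hK x) (hf.isBoundedUnder_ge hK x)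

theorem tendsto_integral_abs_sub [IsProbabilityMeasure μ] (hT : MeasurePreserving T μ μ)
    (hf : IsNonposSubadditive T f K) (hK : 0 ≤ K) :
    Tendsto (fun n : ℕ => ∫ x, |f n x / n - lowRate f x| ∂μ) atTop (𝓝 0) := by
  have h := tendsto_integral_of_dominated_convergence (μ := μ)
    (F := fun (n : ℕ) x => |f n x / n - lowRate f x|) (f := fun _ => (0 : ℝ)) (fun _ => K)
    (fun n => (((hf.meas n).div_const _).sub hf.measurable_lowRate).abs.aestronglyMeasurable)
    (integrable_const K) (fun n => Eventually.of_forall fun x => ?_) ?_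
  · simpa using h
  · have h1 := hf.div_mem hK n x
    have h2 := hf.neg_le_lowRate hK x
    have h3 := hf.lowRate_nonpos hK x
    rw [Real.norm_eq_abs, abs_abs, abs_le]
    exact ⟨by linarith [h1.1], by linarith [h1.2]⟩
  · filter_upwards [hf.tendsto_ae hT hK] with x hx
    have := (hx.sub_const (lowRate f x)).abs
    simpa using this

end IsNonposSubadditive

end Kingman

section Rates

variable {X : Type*} [MeasurableSpace X] {μ : Measure X} {T S : X → X}

namespace IsNonposSubadditive

variable {f : ℕ → X → ℝ} {K : ℝ}

/-- The time reversal of a subadditive process, a process over the inverse map. -/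
theorem reverse (hf : IsNonposSubadditive T f K) (hS : Measurable S)
    (hTS : Function.LeftInverse T S) :
    IsNonposSubadditive S (fun n x => f n (S^[n] x)) K where
  meas n := (hf.meas n).comp (hS.iterate n)
  nonpos n x := hf.nonpos n _
  lower n x := hf.lower n _
  sub m n x := by
    have h1 := hf.sub n m (S^[n + m] x)
    have h2 : T^[n] (S^[n + m] x) = S^[m] x := by
      rw [Function.iterate_add_apply]
      exact hTS.iterate n _
    rw [h2, Function.iterate_add_apply] at h1
    rw [Nat.add_comm m n, Function.iterate_add_apply]
    linarith

theorem tendsto_integral_abs_sub_comp [IsProbabilityMeasure μ] (hT : MeasurePreserving T μ μ)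
    (hS : MeasurePreserving S μ μ) (hTS : Function.LeftInverse T S)
    (hf : IsNonposSubadditive T f K) (hK : 0 ≤ K) (i : ℕ → ℕ) {j : ℕ → ℕ}
    (hj : Tendsto j atTop atTop) :
    Tendsto (fun n : ℕ => ∫ x, |f (j n) (S^[i n] x) / (j n : ℕ) - lowRate f x| ∂μ) atTop
      (𝓝 0) := by
  refine ((hf.tendsto_integral_abs_sub hT hK).comp hj).congr fun n => ?_
  have h1 : ∀ᵐ x ∂μ, lowRate f (S^[i n] x) = lowRate f x := by
    filter_upwards [(hS.iterate (i n)).quasiMeasurePreserving.ae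
      (hf.lowRate_iterate_ae hT hK)] with x hx
    have := hx (i n)
    rw [hTS.iterate (i n) x] at this
    exact this.symm
  have h2 : Measurable fun x => |f (j n) x / (j n : ℕ) - lowRate f x| :=
    (((hf.meas _).div_const _).sub hf.measurable_lowRate).abs
  have h3 := integral_map (hS.iterate (i n)).aemeasurable (μ := μ) h2.aestronglyMeasurable
  rw [(hS.iterate (i n)).map_eq] at h3
  rw [Function.comp_apply, h3]
  refine integral_congr_ae ?_
  filter_upwards [h1] with x hx
  rw [hx]

theorem lowRate_reverse_ae [IsProbabilityMeasure μ] (hT : MeasurePreserving T μ μ)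
    (hS : MeasurePreserving S μ μ) (hTS : Function.LeftInverse T S)
    (hf : IsNonposSubadditive T f K) (hK : 0 ≤ K) :
    ∀ᵐ x ∂μ, lowRate (fun n x => f n (S^[n] x)) x = lowRate f x := by
  have hr := hf.reverse hS.measurable hTS
  have hi := hr.integrable_lowRate (μ := μ) hK
  have hi' := hf.integrable_lowRate (μ := μ) hK
  have hdist : ∀ {a b : X → ℝ}, Measurable a → Measurable b → (∀ x, a x ∈ Set.Icc (-K) 0) →
      (∀ x, b x ∈ Set.Icc (-K) 0) → Integrable (fun x => |a x - b x|) μ := by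
    intro a b ha hb h1 h2
    refine integrable_of_mem_Icc (ha.sub hb).abs (a := 0) (b := K) fun x => ⟨abs_nonneg _, ?_⟩
    rw [abs_le]
    constructor <;> linarith [(h1 x).1, (h1 x).2, (h2 x).1, (h2 x).2]
  have hl : ∀ x, lowRate f x ∈ Set.Icc (-K) 0 := fun x =>
    ⟨hf.neg_le_lowRate hK x, hf.lowRate_nonpos hK x⟩
  have hl' : ∀ x, lowRate (fun n x => f n (S^[n] x)) x ∈ Set.Icc (-K) 0 := fun x =>
    ⟨hr.neg_le_lowRate hK x, hr.lowRate_nonpos hK x⟩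
  have h0 : ∫ x, |lowRate (fun n x => f n (S^[n] x)) x - lowRate f x| ∂μ ≤ 0 := by
    have h1 := hf.tendsto_integral_abs_sub_comp hT hS hTS hK id tendsto_id
    have h2 := hr.tendsto_integral_abs_sub hS hK
    have h3 := h2.add h1
    rw [add_zero] at h3
    refine ge_of_tendsto' h3 fun n => ?_
    have m1 : Measurable fun x => f n (S^[n] x) / (n : ℝ) :=
      ((hf.meas n).comp (hS.iterate n).measurable).div_const (n : ℝ)
    simp only [id]
    rw [← integral_add (hdist m1 hr.measurable_lowRate (fun x => hf.div_mem hK n _) hl')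
      (hdist m1 hf.measurable_lowRate (fun x => hf.div_mem hK n _) hl)]
    refine integral_mono (hdist hr.measurable_lowRate hf.measurable_lowRate hl' hl)
      ((hdist m1 hr.measurable_lowRate (fun x => hf.div_mem hK n _) hl').add
        (hdist m1 hf.measurable_lowRate (fun x => hf.div_mem hK n _) hl)) fun x => ?_
    have := abs_sub_le (lowRate (fun n x => f n (S^[n] x)) x) (f n (S^[n] x) / n) (lowRate f x)
    rw [abs_sub_comm _ (f n (S^[n] x) / n)] at this
    exact this
  have h1 := le_antisymm h0 (integral_nonneg fun x => abs_nonneg _)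
  rw [integral_eq_zero_iff_of_nonneg (fun x => abs_nonneg _)
    (hdist hr.measurable_lowRate hf.measurable_lowRate hl' hl)] at h1
  filter_upwards [h1] with x hx
  exact sub_eq_zero.1 (abs_eq_zero.1 hx)

/-- Along orbit segments centred at `x`, the growth rate is attained infinitely often. -/
theorem frequently_centred_ae [IsProbabilityMeasure μ] (hT : MeasurePreserving T μ μ)
    (hS : MeasurePreserving S μ μ) (hTS : Function.LeftInverse T S)
    (hf : IsNonposSubadditive T f K) (hK : 0 ≤ K) :
    ∀ᵐ x ∂μ, ∀ c < lowRate f x, ∃ᶠ m : ℕ in atTop, c < f (2 * m) (S^[m] x) / (2 * m : ℕ) := by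
  have hj : Tendsto (fun m : ℕ => 2 * m) atTop atTop :=
    tendsto_atTop_mono (fun m => show m ≤ 2 * m by omega) tendsto_id
  have h1 := hf.tendsto_integral_abs_sub_comp hT hS hTS hK id hj
  have hm : ∀ m : ℕ, Measurable fun x => f (2 * m) (S^[m] x) / (2 * m : ℕ) := fun m =>
    ((hf.meas _).comp (hS.iterate m).measurable).div_const _
  have hM : TendstoInMeasure μ (fun m x => f (2 * m) (S^[m] x) / (2 * m : ℕ)) atTop
      (lowRate f) := by
    refine tendstoInMeasure_of_tendsto_eLpNorm one_ne_zero
      (fun m => (hm m).aestronglyMeasurable) hf.measurable_lowRate.aestronglyMeasurable ?_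
    have h2 := ENNReal.tendsto_ofReal h1
    rw [ENNReal.ofReal_zero] at h2
    refine h2.congr fun m => ?_
    rw [eLpNorm_one_eq_lintegral_enorm]
    have hi : Integrable ((fun x => f (2 * m) (S^[m] x) / (2 * m : ℕ)) - lowRate f) μ :=
      (integrable_of_mem_Icc (hm m) fun x => hf.div_mem hK _ _).sub (hf.integrable_lowRate hK)
    rw [← ofReal_integral_norm_eq_lintegral_enorm hi]
    rfl
  obtain ⟨ns, hns, h⟩ := hM.exists_seq_tendsto_ae
  filter_upwards [h] with x hx c hc
  exact hns.tendsto_atTop.frequently (hx.eventually_const_lt hc).frequently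

end IsNonposSubadditive

theorem elog_mul_inv_max {n : ℕ} (hn : n ≠ 0) {t : ℝ} (ht : 0 ≤ t) (L : ℕ) :
    ((Real.log (max t (Real.exp (-(L * n)))) / n : ℝ) : EReal) =
      max ((((n : ℝ)⁻¹ : ℝ) : EReal) * elog t) ((-L : ℝ) : EReal) := by
  have hn' : (0 : ℝ) < n := by positivity
  rcases ht.eq_or_lt with rfl | ht
  · rw [elog, if_pos rfl, EReal.coe_mul_bot_of_pos (inv_pos.2 hn'), max_eq_right bot_le,
      max_eq_right (Real.exp_pos _).le, Real.log_exp]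
    congr 1
    field_simp
  · rw [elog, if_neg ht.ne', ← EReal.coe_mul, ← EReal.coe_strictMono.monotone.map_max]
    congr 1
    rcases le_total t (Real.exp (-(L * n))) with h | h
    · have h2 := Real.log_le_log ht h
      rw [Real.log_exp] at h2
      rw [max_eq_right h, Real.log_exp, max_eq_right]
      · field_simp
      · rw [inv_mul_le_iff₀ hn']; linarith
    · have h2 := Real.log_le_log (Real.exp_pos _) h
      rw [Real.log_exp] at h2
      rw [max_eq_left h, max_eq_left]
      · field_simp
      · rw [le_inv_mul_iff₀ hn']; linarith

theorem exists_tendsto_of_forall_max {u : ℕ → EReal} {r : ℕ → ℝ}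
    (h : ∀ L : ℕ, Tendsto (fun n => max (u n) ((-L : ℝ) : EReal)) atTop (𝓝 (r L : EReal))) :
    ∃ l, Tendsto u atTop (𝓝 l) := by
  refine tendsto_of_no_upcrossings dense_univ fun a _ b _ hab hcon => ?_
  obtain ⟨p, hap, hpb⟩ := EReal.exists_rat_btwn_of_lt hab
  obtain ⟨q, hpq, hqb⟩ := EReal.exists_rat_btwn_of_lt hpb
  obtain ⟨L, hL⟩ := exists_nat_ge (-(p : ℝ))
  have hLp : ((-L : ℝ) : EReal) ≤ ((p : ℝ) : EReal) := EReal.coe_le_coe_iff.2 (by linarith)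
  have h1 : (r L : EReal) ≤ ((p : ℝ) : EReal) := by
    refine le_of_tendsto_of_frequently (h L) (hcon.1.mono fun n hn => ?_)
    exact max_le (hn.trans hap).le hLp
  have h2 : ((q : ℝ) : EReal) ≤ (r L : EReal) := by
    refine ge_of_tendsto_of_frequently (h L) (hcon.2.mono fun n hn => ?_)
    exact (hqb.trans hn).le.trans (le_max_left _ _)
  exact absurd (h2.trans h1) (not_le.2 hpq)

theorem eq_of_forall_max_eq {a b : EReal}
    (h : ∀ L : ℕ, max a ((-L : ℝ) : EReal) = max b ((-L : ℝ) : EReal)) : a = b := by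
  have key : ∀ {a b : EReal}, (∀ L : ℕ, max a ((-L : ℝ) : EReal) = max b ((-L : ℝ) : EReal)) →
      ¬ a < b := by
    intro a b h hab
    obtain ⟨p, hap, hpb⟩ := EReal.exists_rat_btwn_of_lt hab
    obtain ⟨L, hL⟩ := exists_nat_ge (-(p : ℝ))
    have hLp : ((-L : ℝ) : EReal) ≤ ((p : ℝ) : EReal) := EReal.coe_le_coe_iff.2 (by linarith)
    have h1 : max b ((-L : ℝ) : EReal) ≤ ((p : ℝ) : EReal) := h L ▸ max_le hap.le hLp
    exact absurd ((le_max_left _ _).trans h1) (not_le.2 hpb)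
  exact le_antisymm (not_lt.1 (key fun L => (h L).symm)) (not_lt.1 (key h))

/-- A measurable nonnegative submultiplicative process over `T`. -/
structure IsSubmul (T : X → X) (a : ℕ → X → ℝ) (M : ℝ) : Prop where
  meas : ∀ n, Measurable (a n)
  nonneg : ∀ n x, 0 ≤ a n x
  le_pow : ∀ n x, a n x ≤ M ^ n
  mul : ∀ m n x, a (m + n) x ≤ a m x * a n (T^[m] x)

/-- The exponential growth rate of a process. -/
def expRate (a : ℕ → X → ℝ) (x : X) : EReal :=
  limsup (fun n : ℕ => (((n : ℝ)⁻¹ : ℝ) : EReal) * elog (a n x)) atTop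

theorem measurable_elog : Measurable elog :=
  Measurable.ite (measurableSet_singleton 0) measurable_const
    (measurable_coe_real_ereal.comp Real.measurable_log)

namespace IsSubmul

variable {a : ℕ → X → ℝ} {M : ℝ}

/-- The logarithm of a process, truncated from below at rate `-L` and normalised. -/
def truncLog (a : ℕ → X → ℝ) (M : ℝ) (L : ℕ) (n : ℕ) (x : X) : ℝ :=
  Real.log (max (a n x) (Real.exp (-(L * n)))) - n * Real.log M

theorem measurable_expRate (ha : IsSubmul T a M) : Measurable (expRate a) := by
  refine Measurable.limsup fun n => ?_
  exact (measurable_const).mul (measurable_elog.comp (ha.meas n))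

theorem isNonposSubadditive (ha : IsSubmul T a M) (hM : 1 ≤ M) (L : ℕ) :
    IsNonposSubadditive T (truncLog a M L) (L + Real.log M) := by
  have hM0 : 0 < M := by linarith
  have hpos : ∀ n x, 0 < max (a n x) (Real.exp (-(L * n))) := fun n x =>
    lt_max_of_lt_right (Real.exp_pos _)
  refine ⟨fun n => ?_, fun n x => ?_, fun n x => ?_, fun m n x => ?_⟩
  · exact (Real.measurable_log.comp ((ha.meas n).max measurable_const)).sub_const _
  · have h1 : max (a n x) (Real.exp (-(L * n))) ≤ M ^ n := by
      refine max_le (ha.le_pow n x) ((Real.exp_le_one_iff.2 ?_).trans (one_le_pow₀ hM))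
      have : (0 : ℝ) ≤ L * n := by positivity
      linarith
    have h2 := Real.log_le_log (hpos n x) h1
    rw [Real.log_pow] at h2
    simp only [truncLog]
    linarith
  · have h2 := Real.log_le_log (Real.exp_pos _) (le_max_right (a n x) (Real.exp (-(L * n))))
    rw [Real.log_exp] at h2
    simp only [truncLog]
    linarith
  · have h1 : max (a (m + n) x) (Real.exp (-(L * (m + n : ℕ)))) ≤
        max (a m x) (Real.exp (-(L * m))) * max (a n (T^[m] x)) (Real.exp (-(L * n))) := by
      refine max_le ((ha.mul m n x).trans ?_) ?_
      · exact mul_le_mul (le_max_left _ _) (le_max_left _ _) (ha.nonneg _ _) (hpos _ _).le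
      · rw [Nat.cast_add, mul_add, neg_add, Real.exp_add]
        exact mul_le_mul (le_max_right _ _) (le_max_right _ _) (Real.exp_pos _).le (hpos _ _).le
    have h2 := Real.log_le_log (hpos _ _) h1
    rw [Real.log_mul (hpos _ _).ne' (hpos _ _).ne'] at h2
    simp only [truncLog]
    push_cast at h2 ⊢
    linarith

theorem reverse (ha : IsSubmul T a M) (hS : Measurable S) (hTS : Function.LeftInverse T S) :
    IsSubmul S (fun n x => a n (S^[n] x)) M where
  meas n := (ha.meas n).comp (hS.iterate n)
  nonneg n x := ha.nonneg n _
  le_pow n x := ha.le_pow n _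
  mul m n x := by
    have h1 := ha.mul n m (S^[n + m] x)
    have h2 : T^[n] (S^[n + m] x) = S^[m] x := by
      rw [Function.iterate_add_apply]
      exact hTS.iterate n _
    rw [h2, Function.iterate_add_apply] at h1
    rw [Nat.add_comm m n, Function.iterate_add_apply]
    linarith

theorem trunc_nonneg (hM : 1 ≤ M) (L : ℕ) : 0 ≤ L + Real.log M :=
  add_nonneg L.cast_nonneg (Real.log_nonneg hM)

/-- If all truncated rates converge, then so do the rates, to a limit determined by those of the
truncations. -/
theorem tendsto_of_truncLog (ha : IsSubmul T a M) {x : X} {r : ℕ → ℝ}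
    (h : ∀ L : ℕ, Tendsto (fun n : ℕ => truncLog a M L n x / n) atTop (𝓝 (r L))) :
    Tendsto (fun n : ℕ => (((n : ℝ)⁻¹ : ℝ) : EReal) * elog (a n x)) atTop (𝓝 (expRate a x)) ∧
      ∀ L : ℕ, ((r L + Real.log M : ℝ) : EReal) = max (expRate a x) ((-L : ℝ) : EReal) := by
  have h1 : ∀ L : ℕ, Tendsto (fun n : ℕ => max ((((n : ℝ)⁻¹ : ℝ) : EReal) * elog (a n x))
      ((-L : ℝ) : EReal)) atTop (𝓝 ((r L + Real.log M : ℝ) : EReal)) := fun L => by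
    have h2 := EReal.tendsto_coe.2 ((h L).add_const (Real.log M))
    refine h2.congr' ?_
    filter_upwards [eventually_ne_atTop 0] with n hn
    rw [← elog_mul_inv_max hn (ha.nonneg n x)]
    congr 1
    have : (n : ℝ) ≠ 0 := by exact_mod_cast hn
    rw [truncLog]
    field_simp
    ring
  obtain ⟨l, hl⟩ := exists_tendsto_of_forall_max h1
  have hl' : expRate a x = l := hl.limsup_eq
  rw [hl']
  exact ⟨hl, fun L => tendsto_nhds_unique (h1 L) (hl.max tendsto_const_nhds)⟩

theorem expRate_ne_top (ha : IsSubmul T a M) (hM : 1 ≤ M) (x : X) : expRate a x ≠ ⊤ := by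
  have h : expRate a x ≤ ((Real.log M : ℝ) : EReal) := by
    refine limsup_le_of_le (by isBoundedDefault) ?_
    filter_upwards [eventually_ne_atTop 0] with n hn
    have h1 := (ha.isNonposSubadditive hM 0).nonpos n x
    have h2 := elog_mul_inv_max hn (ha.nonneg n x) 0
    refine (le_max_left _ ((-(0 : ℕ) : ℝ) : EReal)).trans ?_
    rw [← h2]
    refine EReal.coe_le_coe_iff.2 ?_
    rw [truncLog] at h1
    rw [div_le_iff₀ (by positivity)]
    linarith
  exact ne_top_of_le_ne_top (EReal.coe_ne_top _) h

theorem tendsto_ae [IsProbabilityMeasure μ] (hT : MeasurePreserving T μ μ)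
    (ha : IsSubmul T a M) (hM : 1 ≤ M) :
    ∀ᵐ x ∂μ, Tendsto (fun n : ℕ => (((n : ℝ)⁻¹ : ℝ) : EReal) * elog (a n x)) atTop
        (𝓝 (expRate a x)) ∧ ∀ L : ℕ, ((lowRate (truncLog a M L) x + Real.log M : ℝ) : EReal) =
          max (expRate a x) ((-L : ℝ) : EReal) := by
  have h := ae_all_iff.2 fun L => (ha.isNonposSubadditive hM L).tendsto_ae hT (trunc_nonneg hM L)
  filter_upwards [h] with x hx
  exact ha.tendsto_of_truncLog hx

theorem expRate_comp_ae [IsProbabilityMeasure μ] (hT : MeasurePreserving T μ μ)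
    (ha : IsSubmul T a M) (hM : 1 ≤ M) : ∀ᵐ x ∂μ, expRate a (T x) = expRate a x := by
  have h := ae_all_iff.2 fun L =>
    (ha.isNonposSubadditive hM L).lowRate_comp_ae hT (trunc_nonneg hM L)
  filter_upwards [h, ha.tendsto_ae hT hM, hT.quasiMeasurePreserving.ae (ha.tendsto_ae hT hM)]
    with x hx h1 h2
  refine eq_of_forall_max_eq fun L => ?_
  rw [← h1.2, ← h2.2, hx]

theorem tendsto_reverse_ae [IsProbabilityMeasure μ] (hT : MeasurePreserving T μ μ)
    (hS : MeasurePreserving S μ μ) (hTS : Function.LeftInverse T S)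
    (ha : IsSubmul T a M) (hM : 1 ≤ M) :
    ∀ᵐ x ∂μ, Tendsto (fun n : ℕ => (((n : ℝ)⁻¹ : ℝ) : EReal) * elog (a n (S^[n] x))) atTop
        (𝓝 (expRate a x)) := by
  have hr := ha.reverse hS.measurable hTS
  have h := ae_all_iff.2 fun L =>
    (ha.isNonposSubadditive hM L).lowRate_reverse_ae hT hS hTS (trunc_nonneg hM L)
  filter_upwards [h, ha.tendsto_ae hT hM, hr.tendsto_ae hS hM] with x hx h1 h2
  have h3 : expRate (fun n x => a n (S^[n] x)) x = expRate a x := by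
    refine eq_of_forall_max_eq fun L => ?_
    rw [← h1.2, ← h2.2]
    exact congrArg (fun t : ℝ => ((t + Real.log M : ℝ) : EReal)) (hx L)
  exact h3 ▸ h2.1

theorem frequently_centred_ae [IsProbabilityMeasure μ] (hT : MeasurePreserving T μ μ)
    (hS : MeasurePreserving S μ μ) (hTS : Function.LeftInverse T S)
    (ha : IsSubmul T a M) (hM : 1 ≤ M) :
    ∀ᵐ x ∂μ, ∀ c : ℝ, (c : EReal) < expRate a x →
      ∃ᶠ m : ℕ in atTop, Real.exp (c * (2 * m : ℕ)) ≤ a (2 * m) (S^[m] x) := by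
  have h := ae_all_iff.2 fun L =>
    (ha.isNonposSubadditive hM L).frequently_centred_ae hT hS hTS (trunc_nonneg hM L)
  filter_upwards [h, ha.tendsto_ae hT hM] with x hx h1 c hc
  obtain ⟨L, hL⟩ := exists_nat_gt (-c)
  have h2 : c < lowRate (truncLog a M L) x + Real.log M := by
    have := h1.2 L
    rw [← EReal.coe_lt_coe_iff, this]
    exact lt_max_of_lt_left hc
  refine ((hx L (c - Real.log M) (by linarith)).and_eventually
    (eventually_gt_atTop 0)).mono fun m ⟨hm, hm0⟩ => ?_
  have hm' : (0 : ℝ) < (2 * m : ℕ) := by positivity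
  rw [lt_div_iff₀ hm', truncLog] at hm
  have h3 : c * (2 * m : ℕ) <
      Real.log (max (a (2 * m) (S^[m] x)) (Real.exp (-(L * (2 * m : ℕ))))) := by linarith
  rw [Real.lt_log_iff_exp_lt (lt_max_of_lt_right (Real.exp_pos _))] at h3
  rcases lt_max_iff.1 h3 with h4 | h4
  · exact h4.le
  · rw [Real.exp_lt_exp] at h4
    nlinarith

end IsSubmul

theorem eventually_exp_le {b : ℕ → ℝ} (hb : ∀ n, 0 ≤ b n) {l : EReal}
    (h : Tendsto (fun n : ℕ => (((n : ℝ)⁻¹ : ℝ) : EReal) * elog (b n)) atTop (𝓝 l)) {c : ℝ}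
    (hc : (c : EReal) < l) : ∀ᶠ n : ℕ in atTop, Real.exp (c * n) ≤ b n := by
  filter_upwards [h.eventually_const_lt hc, eventually_gt_atTop 0] with n hn hn0
  have hn' : (0 : ℝ) < n := by exact_mod_cast hn0
  rcases (hb n).eq_or_lt with h0 | h0
  · rw [← h0, elog, if_pos rfl, EReal.coe_mul_bot_of_pos (inv_pos.2 hn')] at hn
    exact absurd hn not_lt_bot
  · rw [elog, if_neg h0.ne', ← EReal.coe_mul, EReal.coe_lt_coe_iff, lt_inv_mul_iff₀ hn'] at hn
    rw [← Real.le_log_iff_exp_le h0]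
    linarith

theorem eventually_le_exp {b : ℕ → ℝ} (hb : ∀ n, 0 ≤ b n) {l : EReal}
    (h : Tendsto (fun n : ℕ => (((n : ℝ)⁻¹ : ℝ) : EReal) * elog (b n)) atTop (𝓝 l)) {c : ℝ}
    (hc : l < (c : EReal)) : ∀ᶠ n : ℕ in atTop, b n ≤ Real.exp (c * n) := by
  filter_upwards [h.eventually_lt_const hc, eventually_gt_atTop 0] with n hn hn0
  have hn' : (0 : ℝ) < n := by exact_mod_cast hn0
  rcases (hb n).eq_or_lt with h0 | h0
  · rw [← h0]; exact (Real.exp_pos _).le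
  · rw [elog, if_neg h0.ne', ← EReal.coe_mul, EReal.coe_lt_coe_iff, inv_mul_lt_iff₀ hn'] at hn
    rw [← Real.log_le_iff_le_exp h0]
    linarith

end Rates

section Noncompactness

/-- The image of the unit ball under `L` is covered by at most `N` balls of radius `r`. -/
def HasNet (L : 𝕏 →L[ℝ] 𝕏) (N : ℕ) (r : ℝ) : Prop :=
  ∃ S : Finset 𝕏, S.card ≤ N ∧ L '' Metric.closedBall 0 1 ⊆ ⋃ y ∈ S, Metric.ball y r

omit [CompleteSpace 𝕏]

theorem HasNet.mono {L : 𝕏 →L[ℝ] 𝕏} {N N' : ℕ} {r r' : ℝ} (h : HasNet L N r) (hN : N ≤ N')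
    (hr : r ≤ r') : HasNet L N' r' := by
  obtain ⟨S, hc, hS⟩ := h
  exact ⟨S, hc.trans hN, hS.trans (Set.iUnion₂_mono fun y _ => Metric.ball_subset_ball hr)⟩

theorem hasNet_of_norm_lt {L : 𝕏 →L[ℝ] 𝕏} {r : ℝ} (h : ‖L‖ < r) : HasNet L 1 r := by
  refine ⟨{0}, by simp, ?_⟩
  rintro _ ⟨w, hw, rfl⟩
  rw [mem_closedBall_zero_iff] at hw
  simp only [Finset.mem_singleton, Set.iUnion_iUnion_eq_left, mem_ball_zero_iff]
  exact (L.le_of_opNorm_le_of_le le_rfl hw).trans_lt (by simpa using h)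

theorem HasNet.mul {A B : 𝕏 →L[ℝ] 𝕏} {N M : ℕ} {r s : ℝ} (hA : HasNet A N r)
    (hB : HasNet B M s) (hs0 : 0 < s) : HasNet (A * B) (N * M) (r * s) := by
  classical
  obtain ⟨S, hc, hS⟩ := hA
  obtain ⟨R, hc', hR⟩ := hB
  refine ⟨(S ×ˢ R).image fun p => A p.2 + s • p.1, ?_, ?_⟩
  · refine Finset.card_image_le.trans ?_
    rw [Finset.card_product]
    exact Nat.mul_le_mul hc hc'
  rintro _ ⟨w, hw, rfl⟩
  obtain ⟨y, hy, hyw⟩ := Set.mem_iUnion₂.1 (hR ⟨w, hw, rfl⟩)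
  have h1 : s⁻¹ • (B w - y) ∈ Metric.closedBall (0 : 𝕏) 1 := by
    rw [mem_closedBall_zero_iff, norm_smul, norm_inv, Real.norm_of_nonneg hs0.le,
      inv_mul_le_iff₀ hs0, mul_one, ← dist_eq_norm]
    exact (Metric.mem_ball.1 hyw).le
  obtain ⟨z, hz, hzw⟩ := Set.mem_iUnion₂.1 (hS ⟨_, h1, rfl⟩)
  refine Set.mem_iUnion₂.2 ⟨A y + s • z, Finset.mem_image.2
    ⟨(z, y), Finset.mem_product.2 ⟨hz, hy⟩, rfl⟩, ?_⟩
  rw [Metric.mem_ball, dist_eq_norm] at hzw ⊢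
  have h2 : (A * B) w - (A y + s • z) = s • (A (s⁻¹ • (B w - y)) - z) := by
    rw [mul_apply_eq_comp, map_smul, smul_sub, smul_inv_smul₀ hs0.ne', map_sub]
    abel
  rw [h2, norm_smul, Real.norm_of_nonneg hs0.le, mul_comm r]
  exact mul_lt_mul_of_pos_left hzw hs0

theorem HasNet.add {L M : 𝕏 →L[ℝ] 𝕏} {N : ℕ} {r : ℝ} (h : HasNet M N r) :
    HasNet L N (r + ‖L - M‖) := by
  obtain ⟨S, hc, hS⟩ := h
  refine ⟨S, hc, ?_⟩
  rintro _ ⟨w, hw, rfl⟩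
  obtain ⟨y, hy, hyw⟩ := Set.mem_iUnion₂.1 (hS ⟨w, hw, rfl⟩)
  refine Set.mem_iUnion₂.2 ⟨y, hy, ?_⟩
  rw [mem_closedBall_zero_iff] at hw
  rw [Metric.mem_ball] at hyw ⊢
  have h1 : dist (L w) (M w) ≤ ‖L - M‖ := by
    rw [dist_eq_norm, ← sub_apply]
    simpa using (L - M).le_of_opNorm_le_of_le le_rfl hw
  linarith [dist_triangle (L w) (M w) y]

theorem hmnc_nonneg (L : 𝕏 →L[ℝ] 𝕏) : 0 ≤ hmnc L :=
  Real.sInf_nonneg fun _ h => h.1.le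

theorem HasNet.hmnc_le {L : 𝕏 →L[ℝ] 𝕏} {N : ℕ} {r : ℝ} (h : HasNet L N r) (hr : 0 < r) :
    hmnc L ≤ r := by
  obtain ⟨S, -, hS⟩ := h
  exact csInf_le ⟨0, fun _ h => h.1.le⟩ ⟨hr, S, hS⟩

theorem exists_hasNet {L : 𝕏 →L[ℝ] 𝕏} {r : ℝ} (h : hmnc L < r) : ∃ N, HasNet L N r := by
  obtain ⟨S₀, -, hS₀⟩ := hasNet_of_norm_lt (show ‖L‖ < ‖L‖ + 1 by linarith)
  obtain ⟨ε, ⟨-, S, hS⟩, hr⟩ := exists_lt_of_csInf_lt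
    (s := {ε : ℝ | 0 < ε ∧ ∃ S : Finset 𝕏, L '' Metric.closedBall 0 1 ⊆ ⋃ y ∈ S, Metric.ball y ε})
    ⟨‖L‖ + 1, by positivity, S₀, hS₀⟩ h
  exact ⟨S.card, S, le_rfl, hS.trans (Set.iUnion₂_mono fun y _ => Metric.ball_subset_ball hr.le)⟩

theorem hmnc_le_norm (L : 𝕏 →L[ℝ] 𝕏) : hmnc L ≤ ‖L‖ :=
  le_of_forall_gt_imp_ge_of_dense fun _ h =>
    (hasNet_of_norm_lt h).hmnc_le ((norm_nonneg L).trans_lt h)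

theorem hmnc_mul_le (A B : 𝕏 →L[ℝ] 𝕏) : hmnc (A * B) ≤ hmnc A * hmnc B := by
  have key : ∀ ε > 0, hmnc (A * B) ≤ (hmnc A + ε) * (hmnc B + ε) := by
    intro ε hε
    have hA := hmnc_nonneg A
    have hB := hmnc_nonneg B
    obtain ⟨N, hN⟩ := exists_hasNet (show hmnc A < hmnc A + ε by linarith)
    obtain ⟨M, hM⟩ := exists_hasNet (show hmnc B < hmnc B + ε by linarith)
    exact (hN.mul hM (by positivity)).hmnc_le (by positivity)
  have h1 : Tendsto (fun ε : ℝ => (hmnc A + ε) * (hmnc B + ε)) (𝓝[>] 0)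
      (𝓝 ((hmnc A + 0) * (hmnc B + 0))) :=
    tendsto_nhdsWithin_of_tendsto_nhds
      (Continuous.tendsto (by fun_prop : Continuous fun ε : ℝ => (hmnc A + ε) * (hmnc B + ε)) 0)
  rw [add_zero, add_zero] at h1
  exact ge_of_tendsto h1 (eventually_mem_nhdsWithin.mono fun ε hε => key ε hε)

theorem hmnc_le_add (L M : 𝕏 →L[ℝ] 𝕏) : hmnc L ≤ hmnc M + ‖L - M‖ := by
  refine le_of_forall_pos_le_add fun ε hε => ?_
  obtain ⟨N, hN⟩ := exists_hasNet (show hmnc M < hmnc M + ε by linarith)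
  have h1 := hmnc_nonneg M
  have h2 := (hN.add (L := L)).hmnc_le (by positivity)
  linarith

theorem continuous_hmnc : Continuous (hmnc : (𝕏 →L[ℝ] 𝕏) → ℝ) := by
  refine LipschitzWith.continuous (K := 1) (LipschitzWith.of_le_add fun L M => ?_)
  rw [dist_eq_norm]
  exact hmnc_le_add L M

end Noncompactness

section Volume

omit [CompleteSpace 𝕏]

/-- The largest `k`-dimensional volume distortion of a bounded operator: the norm of the operator
it induces on alternating `k`-forms. -/
def vol (k : ℕ) (A : 𝕏 →L[ℝ] 𝕏) : ℝ :=
  ‖(ContinuousAlternatingMap.compContinuousLinearMapCLM A :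
    (𝕏 [⋀^Fin k]→L[ℝ] ℝ) →L[ℝ] (𝕏 [⋀^Fin k]→L[ℝ] ℝ))‖

theorem vol_nonneg (k : ℕ) (A : 𝕏 →L[ℝ] 𝕏) : 0 ≤ vol k A := by
  rw [vol]
  exact ContinuousLinearMap.opNorm_nonneg _

theorem continuous_vol (k : ℕ) : Continuous (vol k : (𝕏 →L[ℝ] 𝕏) → ℝ) := by
  have h := ContinuousAlternatingMap.continuous_compContinuousLinearMapCLM
    (𝕜 := ℝ) (E := 𝕏) (F := 𝕏) (G := ℝ) (ι := Fin k)
  exact h.norm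

theorem vol_mul_le (k : ℕ) (A B : 𝕏 →L[ℝ] 𝕏) : vol k (A * B) ≤ vol k A * vol k B := by
  have h : (ContinuousAlternatingMap.compContinuousLinearMapCLM (A * B) :
      (𝕏 [⋀^Fin k]→L[ℝ] ℝ) →L[ℝ] (𝕏 [⋀^Fin k]→L[ℝ] ℝ)) =
      (ContinuousAlternatingMap.compContinuousLinearMapCLM B).comp
        (ContinuousAlternatingMap.compContinuousLinearMapCLM A) := rfl
  rw [vol, h, mul_comm (vol k A)]
  exact ContinuousLinearMap.opNorm_comp_le _ _

theorem vol_le_norm_pow (k : ℕ) (A : 𝕏 →L[ℝ] 𝕏) : vol k A ≤ ‖A‖ ^ k := by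
  refine ContinuousLinearMap.opNorm_le_bound _ (by positivity) fun ω => ?_
  have := ContinuousAlternatingMap.norm_compContinuousLinearMap_le ω A
  rw [Fintype.card_fin, mul_comm] at this
  exact this

theorem abs_apply_le_vol {k : ℕ} (A : 𝕏 →L[ℝ] 𝕏) (ω : 𝕏 [⋀^Fin k]→L[ℝ] ℝ) {v : Fin k → 𝕏}
    (hv : ∀ i, ‖v i‖ ≤ 1) : |ω fun i => A (v i)| ≤ vol k A * ‖ω‖ := by
  have h1 := (ContinuousAlternatingMap.compContinuousLinearMapCLM A ω).le_opNorm v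
  have h2 := (ContinuousAlternatingMap.compContinuousLinearMapCLM A :
    (𝕏 [⋀^Fin k]→L[ℝ] ℝ) →L[ℝ] (𝕏 [⋀^Fin k]→L[ℝ] ℝ)).le_opNorm ω
  have h3 : ∏ i, ‖v i‖ ≤ 1 := Finset.prod_le_one (fun i _ => norm_nonneg _) fun i _ => hv i
  have h4 : (0 : ℝ) ≤ ‖ContinuousAlternatingMap.compContinuousLinearMapCLM A ω‖ := norm_nonneg _
  refine (h1.trans (mul_le_of_le_one_right h4 h3)).trans h2

theorem vol_le_of_forall {k : ℕ} {A : 𝕏 →L[ℝ] 𝕏} {C : ℝ} (hC : 0 ≤ C)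
    (h : ∀ (ω : 𝕏 [⋀^Fin k]→L[ℝ] ℝ) (v : Fin k → 𝕏), (∀ i, ‖v i‖ ≤ 1) →
      |ω fun i => A (v i)| ≤ C * ‖ω‖) : vol k A ≤ C := by
  refine ContinuousLinearMap.opNorm_le_bound _ hC fun ω =>
    ContinuousAlternatingMap.opNorm_le_bound _ (by positivity) fun v => ?_
  have h1 : (ContinuousAlternatingMap.compContinuousLinearMapCLM A ω) v =
      (∏ i, ‖v i‖) * ω fun i => A (‖v i‖⁻¹ • v i) := by
    rw [← smul_eq_mul, ← ContinuousAlternatingMap.map_smul_univ]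
    refine congrArg ω (funext fun i => ?_)
    rcases eq_or_ne (v i) 0 with h0 | h0
    · simp [h0]
    · rw [map_smul, smul_inv_smul₀ (norm_ne_zero_iff.2 h0)]
      rfl
  have h2 := h ω (fun i => ‖v i‖⁻¹ • v i) fun i => by
    rw [norm_smul, norm_inv, norm_norm]
    exact inv_mul_le_one
  have h3 : 0 ≤ ∏ i, ‖v i‖ := Finset.prod_nonneg fun i _ => norm_nonneg _
  rw [h1, Real.norm_eq_abs, abs_mul, abs_of_nonneg h3, mul_comm]
  exact mul_le_mul_of_nonneg_right h2 h3

theorem map_sub_of_mem_span {k : ℕ} (ω : 𝕏 [⋀^Fin k]→L[ℝ] ℝ) (u w : Fin k → 𝕏)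
    (hw : ∀ i, w i ∈ Submodule.span ℝ (u '' Set.Iio i)) : ω (fun i => u i - w i) = ω u := by
  have h : ∀ r : ℕ, ω (fun i => if r ≤ i then u i - w i else u i) =
      ω (fun i => u i - w i) := by
    intro r
    induction r with
    | zero => simp
    | succ r ih =>
      rw [← ih]
      rcases lt_or_ge r k with hr | hr
      · set j : Fin k := ⟨r, hr⟩ with hj
        set V : Fin k → 𝕏 := fun i => if r + 1 ≤ (i : ℕ) then u i - w i else u i with hV
        have h1 : (fun i : Fin k => if r ≤ (i : ℕ) then u i - w i else u i) =
            Function.update V j (u j - w j) := by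
          funext i
          rcases eq_or_ne i j with rfl | hij
          · simp [hj]
          · have : (i : ℕ) ≠ r := fun h => hij (Fin.ext h)
            rw [Function.update_of_ne hij]
            simp only [hV]
            by_cases h2 : r ≤ (i : ℕ)
            · rw [if_pos h2, if_pos (by omega)]
            · rw [if_neg h2, if_neg (by omega)]
        have h2 : Function.update V j (u j) = V := by
          rw [Function.update_eq_self_iff]
          simp [hV, hj]
        have h3 : ω (Function.update V j (w j)) = 0 := by
          have h4 : Submodule.span ℝ (u '' Set.Iio j) ≤
              LinearMap.ker (ω.toAlternatingMap.toMultilinearMap.toLinearMap V j) := by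
            rw [Submodule.span_le]
            rintro _ ⟨i, hi, rfl⟩
            rw [SetLike.mem_coe, LinearMap.mem_ker]
            have hi' : V i = u i := by
              simp only [hV]
              rw [if_neg]
              have : (i : ℕ) < r := hi
              omega
            rw [← hi']
            exact ω.toAlternatingMap.map_update_self V (ne_of_gt hi)
          exact LinearMap.mem_ker.1 (h4 (hw j))
        rw [h1, ContinuousAlternatingMap.map_update_sub, h2, h3, sub_zero]
      · congr 1
        funext i
        rw [if_neg (by omega), if_neg (by omega)]
  rw [← h k]
  congr 1
  funext i
  rw [if_neg (by omega)]

/-- Functionals triangular with respect to a family of vectors control the value of every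
alternating form on it. -/
theorem exists_triangular {k : ℕ} (u : Fin k → 𝕏) :
    ∃ φ : Fin k → StrongDual ℝ 𝕏, (∀ i, ‖φ i‖ ≤ 1) ∧ (∀ i j, j < i → φ i (u j) = 0) ∧
      (∀ i, 0 ≤ φ i (u i)) ∧
      ∀ ω : 𝕏 [⋀^Fin k]→L[ℝ] ℝ, |ω u| ≤ ‖ω‖ * ∏ i, φ i (u i) := by
  set W : Fin k → Submodule ℝ 𝕏 := fun i => Submodule.span ℝ (u '' Set.Iio i) with hW
  have hφ : ∀ i, ∃ g : StrongDual ℝ 𝕏, ‖g‖ ≤ 1 ∧ (∀ j, j < i → g (u j) = 0) ∧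
      g (u i) = ‖(W i).mkQ (u i)‖ := by
    intro i
    obtain ⟨g, hg, hgu⟩ := exists_dual_vector'' ℝ ((W i).mkQ (u i))
    refine ⟨g.comp (W i).mkQL, ?_, fun j hj => ?_, hgu⟩
    · refine ContinuousLinearMap.opNorm_le_bound _ zero_le_one fun x => ?_
      refine (g.le_of_opNorm_le hg _).trans ?_
      exact mul_le_mul_of_nonneg_left (Submodule.Quotient.norm_mk_le (W i) x) zero_le_one
    · have : (W i).mkQL (u j) = 0 :=
        (Submodule.Quotient.mk_eq_zero _).2 (Submodule.subset_span ⟨j, hj, rfl⟩)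
      rw [ContinuousLinearMap.comp_apply, this, map_zero]
  choose φ h1 h2 h3 using hφ
  refine ⟨φ, h1, h2, fun i => (h3 i) ▸ norm_nonneg _, fun ω => ?_⟩
  have h4 : ∀ ε > 0, |ω u| ≤ ‖ω‖ * ∏ i, (φ i (u i) + ε) := by
    intro ε hε
    have h5 : ∀ i, ∃ w ∈ W i, ‖u i - w‖ < φ i (u i) + ε := by
      intro i
      obtain ⟨m, hm, hm'⟩ := Submodule.Quotient.norm_mk_lt ((W i).mkQ (u i)) hε
      refine ⟨u i - m, ?_, ?_⟩
      · rw [← Submodule.Quotient.mk_eq_zero, Submodule.Quotient.mk_sub, hm]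
        exact sub_self _
      · rw [sub_sub_cancel, h3]
        exact hm'
    choose w hw hw' using h5
    rw [← map_sub_of_mem_span ω u w hw]
    refine (ω.le_opNorm _).trans (mul_le_mul_of_nonneg_left ?_ (norm_nonneg _))
    exact Finset.prod_le_prod (fun i _ => norm_nonneg _) fun i _ => (hw' i).le
  have h6 : Tendsto (fun ε : ℝ => ‖ω‖ * ∏ i, (φ i (u i) + ε)) (𝓝[>] 0)
      (𝓝 (‖ω‖ * ∏ i, (φ i (u i) + 0))) :=
    tendsto_nhdsWithin_of_tendsto_nhds
      (Continuous.tendsto (by fun_prop : Continuous fun ε : ℝ => ‖ω‖ * ∏ i, (φ i (u i) + ε)) 0)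
  simp only [add_zero] at h6
  exact ge_of_tendsto h6 (eventually_mem_nhdsWithin.mono fun ε hε => h4 ε hε)

end Volume

section Determinants

theorem abs_det_le_factorial {k : ℕ} (B : Matrix (Fin k) (Fin k) ℝ) (b : Fin k → ℝ)
    (h : ∀ i j, |B i j| ≤ b j) : |B.det| ≤ k.factorial * ∏ j, b j := by
  rw [Matrix.det_apply]
  refine (Finset.abs_sum_le_sum_abs _ _).trans ?_
  calc ∑ σ : Equiv.Perm (Fin k), |Equiv.Perm.sign σ • ∏ i, B (σ i) i|
      ≤ ∑ _σ : Equiv.Perm (Fin k), ∏ j, b j := by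
        refine Finset.sum_le_sum fun σ _ => ?_
        have h1 : |Equiv.Perm.sign σ • ∏ i, B (σ i) i| = ∏ i, |B (σ i) i| := by
          rcases Int.units_eq_one_or (Equiv.Perm.sign σ) with h | h <;>
            simp [h, Finset.abs_prod]
        rw [h1]
        exact Finset.prod_le_prod (fun _ _ => abs_nonneg _) fun i _ => h _ _
    _ = k.factorial * ∏ j, b j := by
        rw [Finset.sum_const, Finset.card_univ, Fintype.card_perm, Fintype.card_fin, nsmul_eq_mul]

omit [CompleteSpace 𝕏]

/-- The alternating form `x ↦ det (φ i (x j))`. -/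
def detForm {k : ℕ} (φ : Fin k → StrongDual ℝ 𝕏) (hφ : ∀ i, ‖φ i‖ ≤ 1) : 𝕏 [⋀^Fin k]→L[ℝ] ℝ :=
  AlternatingMap.mkContinuous
    (Matrix.detRowAlternating.compLinearMap (LinearMap.pi fun i => (φ i : 𝕏 →ₗ[ℝ] ℝ)))
    k.factorial fun x => by
      change |Matrix.det (Matrix.of fun i j => φ j (x i))| ≤ _
      rw [← Matrix.det_transpose]
      refine abs_det_le_factorial _ _ fun i j => ?_
      simpa using (φ i).le_of_opNorm_le (hφ i) (x j)

theorem detForm_apply {k : ℕ} (φ : Fin k → StrongDual ℝ 𝕏) (hφ : ∀ i, ‖φ i‖ ≤ 1) (x : Fin k → 𝕏) :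
    detForm φ hφ x = Matrix.det (Matrix.of fun i j => φ i (x j)) := by
  rw [← Matrix.det_transpose]
  rfl

theorem norm_detForm_le {k : ℕ} (φ : Fin k → StrongDual ℝ 𝕏) (hφ : ∀ i, ‖φ i‖ ≤ 1) :
    ‖detForm φ hφ‖ ≤ k.factorial :=
  AlternatingMap.mkContinuous_norm_le _ (by positivity) _

theorem abs_det_le_vol {k : ℕ} (A : 𝕏 →L[ℝ] 𝕏) {φ : Fin k → StrongDual ℝ 𝕏} {v : Fin k → 𝕏}
    (hφ : ∀ i, ‖φ i‖ ≤ 1) (hv : ∀ i, ‖v i‖ ≤ 1) :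
    |Matrix.det (Matrix.of fun i j => φ i (A (v j)))| ≤ k.factorial * vol k A := by
  rw [← detForm_apply φ hφ fun j => A (v j), mul_comm]
  exact (abs_apply_le_vol A _ hv).trans
    (mul_le_mul_of_nonneg_left (norm_detForm_le φ hφ) (vol_nonneg _ _))

theorem det_of_triangular {k : ℕ} {φ : Fin k → StrongDual ℝ 𝕏} {u : Fin k → 𝕏}
    (h : ∀ i j, j < i → φ i (u j) = 0) :
    Matrix.det (Matrix.of fun i j => φ i (u j)) = ∏ i, φ i (u i) :=
  Matrix.det_of_isUpperTriangular fun i j hij => h i j hij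

theorem exists_le_det {k : ℕ} {A : 𝕏 →L[ℝ] 𝕏} (h : 0 < vol k A) :
    ∃ (φ : Fin k → StrongDual ℝ 𝕏) (v : Fin k → 𝕏), (∀ i, ‖φ i‖ ≤ 1) ∧ (∀ i, ‖v i‖ ≤ 1) ∧
      vol k A / 2 ≤ Matrix.det (Matrix.of fun i j => φ i (A (v j))) := by
  by_contra! hcon
  have h1 : vol k A ≤ vol k A / 2 := by
    refine vol_le_of_forall (by positivity) fun ω v hv => ?_
    obtain ⟨φ, h2, h3, h4, h5⟩ := exists_triangular fun i => A (v i)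
    refine (h5 ω).trans ?_
    have h6 := hcon φ v h2 hv
    rw [det_of_triangular h3] at h6
    rw [mul_comm]
    exact mul_le_mul_of_nonneg_right h6.le (norm_nonneg _)
  linarith

theorem norm_le_vol_one (A : 𝕏 →L[ℝ] 𝕏) : ‖A‖ ≤ vol 1 A := by
  refine A.opNorm_le_of_unit_norm (vol_nonneg _ _) fun x hx => ?_
  obtain ⟨φ, h1, h2⟩ := exists_dual_vector'' ℝ (A x)
  have h := abs_det_le_vol (k := 1) A (φ := fun _ => φ) (v := fun _ => x) (fun _ => h1)
    fun _ => hx.le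
  rw [Matrix.det_fin_one] at h
  simpa [h2] using h

/-- Operators with few-element nets distort volumes little. -/
theorem HasNet.vol_le {A : 𝕏 →L[ℝ] 𝕏} {N : ℕ} {R : ℝ} (h : HasNet A N R) (hR : 0 < R) (k : ℕ) :
    vol k A ≤ (2 * k * R) ^ k * N := by
  obtain ⟨S, hc, hS⟩ := h
  refine vol_le_of_forall (by positivity) fun ω v hv => ?_
  obtain ⟨φ, h2, h3, h4, h5⟩ := exists_triangular fun i => A (v i)
  refine (h5 ω).trans ?_
  rw [mul_comm]
  refine mul_le_mul_of_nonneg_right ?_ (norm_nonneg _)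
  set s : Fin k → ℝ := fun i => φ i (A (v i)) with hs
  by_cases hs0 : ∃ i, s i = 0
  · obtain ⟨i, hi⟩ := hs0
    rw [Finset.prod_eq_zero (Finset.mem_univ i) hi]
    positivity
  push Not at hs0
  have hs1 : ∀ i, 0 < s i := fun i => (h4 i).lt_of_ne' (hs0 i)
  set m : Fin k → ℕ := fun i => ⌊s i / (2 * k * R)⌋₊ + 1 with hm
  have hk : ∀ _ : Fin k, (0 : ℝ) < k := fun i => by
    exact_mod_cast i.pos
  set w : (∀ i, Fin (m i)) → 𝕏 := fun n => ∑ i, ((n i : ℕ) * (2 * R / s i)) • v i with hw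
  have hw1 : ∀ n, ‖w n‖ ≤ 1 := by
    intro n
    have h6 : ∀ i, ‖((n i : ℕ) * (2 * R / s i)) • v i‖ ≤ 1 / k := by
      intro i
      have hk' := hk i
      have h7 : ((n i : ℕ) : ℝ) ≤ s i / (2 * k * R) := by
        have h8 : ((n i : ℕ) : ℝ) ≤ (⌊s i / (2 * k * R)⌋₊ : ℝ) := by
          exact_mod_cast Nat.lt_succ_iff.1 (n i).2
        exact h8.trans (Nat.floor_le (by have := hs1 i; positivity))
      have hsi := hs1 i
      rw [norm_smul, Real.norm_of_nonneg (by positivity)]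
      refine (mul_le_of_le_one_right (by positivity) (hv i)).trans ?_
      calc ((n i : ℕ) : ℝ) * (2 * R / s i) ≤ s i / (2 * k * R) * (2 * R / s i) :=
            mul_le_mul_of_nonneg_right h7 (by positivity)
        _ = 1 / k := by field_simp
    refine (norm_sum_le _ _).trans ((Finset.sum_le_sum fun i _ => h6 i).trans ?_)
    rw [Finset.sum_const, Finset.card_univ, Fintype.card_fin, nsmul_eq_mul]
    rw [mul_one_div]
    exact div_self_le_one _
  have hy : ∀ n, ∃ y ∈ S, dist (A (w n)) y < R := fun n => by
    have := hS ⟨w n, mem_closedBall_zero_iff.2 (hw1 n), rfl⟩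
    simpa using this
  choose y hyS hy using hy
  have hinj : Function.Injective y := by
    intro n n' hnn
    by_contra hne
    obtain ⟨i, hi, hmax⟩ : ∃ i, n i ≠ n' i ∧ ∀ j, i < j → n j = n' j := by
      have hne' : (Finset.univ.filter fun i => n i ≠ n' i).Nonempty := by
        obtain ⟨i, hi⟩ := Function.ne_iff.1 hne
        exact ⟨i, by simpa using hi⟩
      refine ⟨(Finset.univ.filter fun i => n i ≠ n' i).max' hne', ?_, fun j hj => ?_⟩
      · simpa using Finset.max'_mem _ hne'
      · by_contra hcon
        exact absurd (Finset.le_max' _ j (by simpa using hcon)) (not_le.2 hj)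
    have h6 : φ i (A (w n)) - φ i (A (w n')) = (((n i : ℕ) : ℝ) - (n' i : ℕ)) * (2 * R) := by
      simp only [hw, map_sum, map_smul, smul_eq_mul]
      rw [← Finset.sum_sub_distrib, Finset.sum_eq_single i]
      · have := hs0 i
        change _ * _ * s i - _ * _ * s i = _
        field_simp
      · intro j _ hj
        rcases lt_or_gt_of_ne hj with h | h
        · rw [h3 i j h]; ring
        · rw [hmax j h]; ring
      · simp
    have h7 : (1 : ℝ) ≤ |((n i : ℕ) : ℝ) - (n' i : ℕ)| := by
      have h8 : ((n i : ℕ) : ℤ) - (n' i : ℕ) ≠ 0 := by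
        intro h
        exact hi (Fin.ext (by omega))
      exact_mod_cast Int.one_le_abs h8
    have h8 : |φ i (A (w n)) - φ i (A (w n'))| ≤ dist (A (w n)) (A (w n')) := by
      rw [← map_sub, dist_eq_norm]
      simpa using (φ i).le_of_opNorm_le (h2 i) (A (w n) - A (w n'))
    have h9 := dist_triangle_right (A (w n)) (A (w n')) (y n)
    have h10 := hy n'
    rw [← hnn] at h10
    rw [h6, abs_mul, abs_of_pos (by positivity : (0 : ℝ) < 2 * R)] at h8
    nlinarith [hy n]
  have hcard : ∏ i, m i ≤ N := by
    have h6 := Finset.card_le_card_of_injOn (s := Finset.univ) (t := S) y (fun n _ => hyS n)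
      hinj.injOn
    rw [Finset.card_univ, Fintype.card_pi] at h6
    simp only [Fintype.card_fin] at h6
    exact h6.trans hc
  calc ∏ i, s i ≤ ∏ i, (2 * k * R) * (m i : ℝ) := by
        refine Finset.prod_le_prod (fun i _ => (hs1 i).le) fun i _ => ?_
        have hk' := hk i
        rw [← div_le_iff₀' (by positivity), hm]
        push_cast
        exact (Nat.lt_floor_add_one _).le
    _ = (2 * k * R) ^ k * ((∏ i, m i : ℕ) : ℝ) := by
        rw [Finset.prod_mul_distrib, Finset.prod_const, Finset.card_univ, Fintype.card_fin]
        push_cast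
        rfl
    _ ≤ (2 * k * R) ^ k * N := by
        refine mul_le_mul_of_nonneg_left ?_ (by positivity)
        exact_mod_cast hcard

end Determinants

section Splitting

omit [CompleteSpace 𝕏]

/-- `P` and `Q` are projections of norm at most `κ` and rank `d`, intertwined by `A`, such that `A`
expands the range of `P` by at least `s` and has norm at most `τ` off it. -/
structure IsSplitting (A P Q : 𝕏 →L[ℝ] 𝕏) (d : ℕ) (κ τ s : ℝ) : Prop where
  idemP : ∀ w, P (P w) = P w
  idemQ : ∀ w, Q (Q w) = Q w
  comm : ∀ w, Q (A w) = A (P w)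
  normP : ∀ w, ‖P w‖ ≤ κ * ‖w‖
  normQ : ∀ w, ‖Q w‖ ≤ κ * ‖w‖
  finite : FiniteDimensional ℝ (LinearMap.range (P : 𝕏 →ₗ[ℝ] 𝕏))
  rank : Module.finrank ℝ (LinearMap.range (P : 𝕏 →ₗ[ℝ] 𝕏)) = d
  rangeQ : ∀ w, ∃ p, Q w = A (P p)
  tail : ∀ w, ‖A (w - P w)‖ ≤ τ * ‖w‖
  lower : ∀ w, s * ‖P w‖ ≤ ‖A (P w)‖

/-- A constant depending only on the rank of a splitting. -/
def splitConst (d : ℕ) : ℝ := 2 * (d + 1) * (d + 1).factorial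

theorem exists_isSplitting {d : ℕ} (hd : d ≠ 0) {A : 𝕏 →L[ℝ] 𝕏} (hA : 0 < vol d A) :
    ∃ P Q, IsSplitting A P Q d (splitConst d) (splitConst d * (vol (d + 1) A / vol d A))
      (vol d A / (splitConst d * ‖A‖ ^ (d - 1))) := by
  obtain ⟨φ, v, hφ, hv, hdet⟩ := exists_le_det hA
  set D := vol d A with hD
  set G : Matrix (Fin d) (Fin d) ℝ := Matrix.of fun i j => φ i (A (v j)) with hG
  have hdet0 : 0 < G.det := by linarith
  have hunit : IsUnit G.det := hdet0.ne'.isUnit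
  have hfac : ((d.factorial : ℕ) : ℝ) ≤ (d + 1).factorial := by
    exact_mod_cast Nat.factorial_le (Nat.le_succ d)
  have hfac0 : (0 : ℝ) < (d.factorial : ℕ) := by exact_mod_cast d.factorial_pos
  set β : Fin d → StrongDual ℝ 𝕏 := fun j => ∑ k, G⁻¹ j k • φ k with hβ
  have hβa : ∀ j z, β j z = (G⁻¹.mulVec fun k => φ k z) j := by
    intro j z
    simp [hβ, Matrix.mulVec, dotProduct]
  have hβv : ∀ j l, β j (A (v l)) = if j = l then 1 else 0 := by
    intro j l
    rw [hβa, ← Matrix.one_apply, ← Matrix.nonsing_inv_mul G hunit]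
    rfl
  have hcram : ∀ j z, G.det * β j z = (G.updateCol j fun k => φ k z).det := by
    intro j z
    rw [hβa, ← Matrix.cramer_apply, ← Matrix.det_smul_inv_mulVec_eq_cramer _ _ hunit]
    rfl
  have b1 : ∀ j w, |β j (A w)| ≤ 2 * d.factorial * ‖w‖ := by
    intro j w
    rcases eq_or_ne w 0 with rfl | hw
    · simp
    have h1 : |β j (A (‖w‖⁻¹ • w))| ≤ 2 * d.factorial := by
      have h2 : (G.updateCol j fun k => φ k (A (‖w‖⁻¹ • w))) =
          Matrix.of fun i l => φ i (A (Function.update v j (‖w‖⁻¹ • w) l)) := by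
        ext i l
        rcases eq_or_ne l j with rfl | hl
        · simp
        · simp [hl, hG]
      have h3 := abs_det_le_vol A hφ (v := Function.update v j (‖w‖⁻¹ • w)) fun i => by
        rcases eq_or_ne i j with rfl | hl
        · rw [Function.update_self, norm_smul, norm_inv, norm_norm]
          exact inv_mul_le_one
        · rw [Function.update_of_ne hl]; exact hv i
      rw [← h2, ← hcram, abs_mul, abs_of_pos hdet0] at h3
      by_contra! hcon
      have h4 : D / 2 * (2 * d.factorial) < G.det * |β j (A (‖w‖⁻¹ • w))| :=
        mul_lt_mul' hdet hcon (by positivity) hdet0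
      linarith
    rw [map_smul, map_smul, smul_eq_mul, abs_mul, abs_inv, abs_norm,
      inv_mul_le_iff₀ (norm_pos_iff.2 hw)] at h1
    linarith
  have b2 : ∀ (ψ : StrongDual ℝ 𝕏) (z : 𝕏), ‖ψ‖ ≤ 1 →
      |∑ j, ψ (A (v j)) * β j z| ≤ 2 * d * d.factorial * ‖z‖ := by
    intro ψ z hψ
    set c : Fin d → ℝ := Matrix.vecMul (fun j => ψ (A (v j))) G⁻¹ with hc
    have h1 : ∑ j, ψ (A (v j)) * β j z = ∑ i, c i * φ i z := by
      have := Matrix.dotProduct_mulVec (fun j => ψ (A (v j))) G⁻¹ (fun k => φ k z)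
      simp only [dotProduct, ← hβa] at this
      exact this
    have h2 : ∀ i, |c i| ≤ 2 * d.factorial := by
      intro i
      have h3 : G.det * c i = (G.updateRow i fun j => ψ (A (v j))).det := by
        rw [← Matrix.det_transpose (G.updateRow _ _), ← Matrix.updateCol_transpose,
          ← Matrix.cramer_apply, ← Matrix.det_smul_inv_vecMul_eq_cramer_transpose _ _ hunit]
        rfl
      have h4 : (G.updateRow i fun j => ψ (A (v j))) =
          Matrix.of fun l j => (Function.update φ i ψ l) (A (v j)) := by
        ext l j
        rcases eq_or_ne l i with rfl | hl
        · simp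
        · simp [hl, hG]
      have h5 := abs_det_le_vol A (φ := Function.update φ i ψ) (fun l => by
        rcases eq_or_ne l i with rfl | hl
        · rwa [Function.update_self]
        · rw [Function.update_of_ne hl]; exact hφ l) hv
      rw [← h4, ← h3, abs_mul, abs_of_pos hdet0] at h5
      by_contra! hcon
      have h6 : D / 2 * (2 * d.factorial) < G.det * |c i| :=
        mul_lt_mul' hdet hcon (by positivity) hdet0
      linarith
    rw [h1]
    refine (Finset.abs_sum_le_sum_abs _ _).trans ?_
    calc ∑ i, |c i * φ i z| ≤ ∑ _i : Fin d, 2 * d.factorial * ‖z‖ := by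
          refine Finset.sum_le_sum fun i _ => ?_
          rw [abs_mul]
          refine mul_le_mul (h2 i) ?_ (abs_nonneg _) (by positivity)
          simpa using (φ i).le_of_opNorm_le (hφ i) z
      _ = _ := by
          rw [Finset.sum_const, Finset.card_univ, Fintype.card_fin, nsmul_eq_mul]
          ring
  have b3 : ∀ (ψ : StrongDual ℝ 𝕏) (w : 𝕏), ‖ψ‖ ≤ 1 → ‖w‖ ≤ 1 →
      |ψ (A w) - ∑ j, ψ (A (v j)) * β j (A w)| ≤ 2 * (d + 1).factorial * (vol (d + 1) A / D) := by
    intro ψ w hψ hw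
    set φ' : Fin d ⊕ Fin 1 → StrongDual ℝ 𝕏 := Sum.elim φ fun _ => ψ with hφ'
    set v' : Fin d ⊕ Fin 1 → 𝕏 := Sum.elim v fun _ => w with hv'
    let := Matrix.invertibleOfIsUnitDet G hunit
    have h1 : (Matrix.of fun i j => φ' i (A (v' j))) = Matrix.fromBlocks G
        (Matrix.of fun i _ => φ i (A w)) (Matrix.of fun _ j => ψ (A (v j)))
        (Matrix.of fun _ _ => ψ (A w)) := by
      ext i j
      rcases i with i | i <;> rcases j with j | j <;> rfl
    have h2 : (Matrix.of fun i j => φ' i (A (v' j))).det =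
        G.det * (ψ (A w) - ∑ j, ψ (A (v j)) * β j (A w)) := by
      rw [h1, Matrix.det_fromBlocks₁₁, Matrix.det_fin_one, Matrix.mul_assoc,
        Matrix.invOf_eq_nonsing_inv]
      simp only [Matrix.sub_apply, Matrix.mul_apply, Matrix.of_apply, hβa, Matrix.mulVec,
        dotProduct]
    have h3 := abs_det_le_vol A (φ := φ' ∘ finSumFinEquiv.symm) (v := v' ∘ finSumFinEquiv.symm)
      (fun i => by
        simp only [Function.comp_apply]
        generalize finSumFinEquiv.symm i = j
        rcases j with j | j
        · exact hφ j
        · exact hψ)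
      (fun i => by
        simp only [Function.comp_apply]
        generalize finSumFinEquiv.symm i = j
        rcases j with j | j
        · exact hv j
        · exact hw)
    have h4 : (Matrix.of fun i j => (φ' ∘ finSumFinEquiv.symm) i
        (A ((v' ∘ finSumFinEquiv.symm) j))) = (Matrix.of fun i j => φ' i (A (v' j))).submatrix
          finSumFinEquiv.symm finSumFinEquiv.symm := rfl
    rw [h4, Matrix.det_submatrix_equiv_self, h2, abs_mul, abs_of_pos hdet0] at h3
    by_contra! hcon
    have hv0 := vol_nonneg (d + 1) A
    have h6 : D / 2 * (2 * (d + 1).factorial * (vol (d + 1) A / D)) <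
        G.det * |ψ (A w) - ∑ j, ψ (A (v j)) * β j (A w)| :=
      mul_lt_mul' hdet hcon (by positivity) hdet0
    have h7 : D / 2 * (2 * (d + 1).factorial * (vol (d + 1) A / D)) =
        (d + 1).factorial * vol (d + 1) A := by field_simp
    linarith
  have b4 : ∀ j w, |β j w| ≤ 2 * d.factorial * ‖A‖ ^ (d - 1) / D * ‖w‖ := by
    intro j w
    have h1 := abs_det_le_factorial (G.updateCol j fun k => φ k w)
      (Function.update (fun _ => ‖A‖) j ‖w‖) fun i l => by
        rcases eq_or_ne l j with rfl | hl
        · simpa using (φ i).le_of_opNorm_le (hφ i) w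
        · rw [Matrix.updateCol_ne hl, Function.update_of_ne hl, hG, Matrix.of_apply]
          have h2 := (φ i).le_of_opNorm_le (hφ i) (A (v l))
          have h3 := A.le_of_opNorm_le_of_le le_rfl (hv l)
          rw [Real.norm_eq_abs] at h2
          linarith
    have h2 : ∏ l, Function.update (fun _ : Fin d => ‖A‖) j ‖w‖ l = ‖A‖ ^ (d - 1) * ‖w‖ := by
      rw [Finset.prod_update_of_mem (Finset.mem_univ j), Finset.prod_const, Finset.card_sdiff]
      simp [mul_comm]
    rw [← hcram, h2, abs_mul, abs_of_pos hdet0] at h1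
    by_contra! hcon
    have h6 : D / 2 * (2 * d.factorial * ‖A‖ ^ (d - 1) / D * ‖w‖) < G.det * |β j w| :=
      mul_lt_mul' hdet hcon (by positivity) hdet0
    have h7 : D / 2 * (2 * d.factorial * ‖A‖ ^ (d - 1) / D * ‖w‖) =
        d.factorial * (‖A‖ ^ (d - 1) * ‖w‖) := by field_simp
    linarith
  have hC : 2 * d * d.factorial ≤ splitConst d := by
    rw [splitConst]
    have : (0 : ℝ) ≤ d := by positivity
    nlinarith
  have hC' : 2 * ((d + 1).factorial : ℝ) ≤ splitConst d := by
    rw [splitConst]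
    have : (0 : ℝ) ≤ d := by positivity
    nlinarith
  have hC0 : 0 < splitConst d := by rw [splitConst]; positivity
  set P : 𝕏 →L[ℝ] 𝕏 := ∑ j, ((β j).comp A).smulRight (v j) with hP
  set Q : 𝕏 →L[ℝ] 𝕏 := ∑ j, (β j).smulRight (A (v j)) with hQ
  have hPa : ∀ w, P w = ∑ j, β j (A w) • v j := fun w => by simp [hP]
  have hQa : ∀ w, Q w = ∑ j, β j w • A (v j) := fun w => by simp [hQ]
  have hPv : ∀ l, P (v l) = v l := fun l => by
    rw [hPa, Finset.sum_eq_single l]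
    · simp [hβv]
    · intro j _ hj
      simp [hβv, hj]
    · simp
  have hAP : ∀ w, A (P w) = Q (A w) := fun w => by simp [hPa, hQa, map_sum]
  have hβP : ∀ j w, β j (A (P w)) = β j (A w) := fun j w => by
    rw [hPa, map_sum, map_sum, Finset.sum_eq_single j]
    · simp [hβv]
    · intro l _ hl
      simp [hβv, hl.symm]
    · simp
  have hβQ : ∀ j w, β j (Q w) = β j w := fun j w => by
    rw [hQa, map_sum, Finset.sum_eq_single j]
    · simp [hβv]
    · intro l _ hl
      simp [hβv, hl.symm]
    · simp
  have hrange : LinearMap.range (P : 𝕏 →ₗ[ℝ] 𝕏) = Submodule.span ℝ (Set.range v) := by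
    apply le_antisymm
    · rintro _ ⟨w, rfl⟩
      rw [ContinuousLinearMap.coe_coe, hPa]
      exact Submodule.sum_mem _ fun j _ =>
        Submodule.smul_mem _ _ (Submodule.subset_span ⟨j, rfl⟩)
    · rw [Submodule.span_le]
      rintro _ ⟨l, rfl⟩
      exact ⟨v l, hPv l⟩
  have hli : LinearIndependent ℝ v := by
    rw [Fintype.linearIndependent_iff]
    intro g hg j
    have := congrArg (fun w => β j (A w)) hg
    simp only [map_sum, map_smul, hβv, map_zero, smul_eq_mul] at this
    simpa using this
  refine ⟨P, Q, ⟨fun w => ?_, fun w => ?_, fun w => (hAP w).symm, fun w => ?_, fun w => ?_, ?_, ?_,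
    fun w => ?_, fun w => ?_, fun w => ?_⟩⟩
  · rw [hPa, hPa w]
    exact Finset.sum_congr rfl fun j _ => by rw [← hPa, hβP]
  · rw [hQa, hQa w]
    exact Finset.sum_congr rfl fun j _ => by rw [← hQa, hβQ]
  · rw [hPa]
    refine (norm_sum_le _ _).trans ?_
    calc ∑ j, ‖β j (A w) • v j‖ ≤ ∑ _j : Fin d, 2 * d.factorial * ‖w‖ := by
          refine Finset.sum_le_sum fun j _ => ?_
          rw [norm_smul]
          exact (mul_le_of_le_one_right (norm_nonneg _) (hv j)).trans (b1 j w)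
      _ = 2 * d * d.factorial * ‖w‖ := by
          rw [Finset.sum_const, Finset.card_univ, Fintype.card_fin, nsmul_eq_mul]
          ring
      _ ≤ _ := mul_le_mul_of_nonneg_right hC (norm_nonneg _)
  · obtain ⟨ψ, hψ, hψw⟩ := exists_dual_vector'' ℝ (Q w)
    have h1 := b2 ψ w hψ
    have h2 : ∑ j, ψ (A (v j)) * β j w = ‖Q w‖ := by
      rw [RCLike.ofReal_real_eq_id, id] at hψw
      rw [← hψw, hQa, map_sum]
      exact Finset.sum_congr rfl fun j _ => by rw [map_smul, smul_eq_mul, mul_comm]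
    rw [h2, abs_norm] at h1
    exact h1.trans (mul_le_mul_of_nonneg_right hC (norm_nonneg _))
  · rw [hrange]
    exact FiniteDimensional.span_of_finite ℝ (Set.finite_range v)
  · rw [hrange, finrank_span_eq_card hli, Fintype.card_fin]
  · refine ⟨∑ j, β j w • v j, ?_⟩
    rw [map_sum, map_sum, hQa]
    exact Finset.sum_congr rfl fun j _ => by rw [map_smul, map_smul, hPv]
  · rcases eq_or_ne w 0 with rfl | hw
    · simp
    have hw0 := norm_pos_iff.2 hw
    set w' := ‖w‖⁻¹ • w with hw'
    have hw1 : ‖w'‖ ≤ 1 := by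
      rw [hw', norm_smul, norm_inv, norm_norm]
      exact inv_mul_le_one
    have h0 : w = ‖w‖ • w' := by rw [hw', smul_inv_smul₀ hw0.ne']
    clear_value w'
    obtain ⟨ψ, hψ, hψw⟩ := exists_dual_vector'' ℝ (A (w' - P w'))
    have h1 := b3 ψ w' hψ hw1
    have h2 : ψ (A w') - ∑ j, ψ (A (v j)) * β j (A w') = ‖A (w' - P w')‖ := by
      rw [RCLike.ofReal_real_eq_id, id] at hψw
      rw [← hψw, map_sub, map_sub, hPa, map_sum, map_sum]
      congr 1
      exact Finset.sum_congr rfl fun j _ => by rw [map_smul, map_smul, smul_eq_mul, mul_comm]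
    rw [h2, abs_norm] at h1
    have h3 : A (w - P w) = ‖w‖ • A (w' - P w') := by
      conv_lhs => rw [h0]
      rw [map_smul, ← smul_sub, map_smul]
    rw [h3, norm_smul, norm_norm, mul_comm]
    refine mul_le_mul_of_nonneg_right (h1.trans ?_) hw0.le
    exact mul_le_mul_of_nonneg_right hC' (div_nonneg (vol_nonneg _ _) hA.le)
  · have hA0 : 0 < ‖A‖ := by
      have h1 := vol_le_norm_pow d A
      refine (norm_nonneg A).lt_of_ne' fun h => ?_
      rw [h, zero_pow hd] at h1
      exact absurd hA (not_lt.2 h1)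
    rw [div_mul_eq_mul_div, div_le_iff₀ (by positivity), mul_comm, ← le_div_iff₀ hA]
    have h1 : P w = ∑ j, β j (A (P w)) • v j :=
      (hPa w).trans (Finset.sum_congr rfl fun j _ => by rw [hβP])
    calc ‖P w‖ ≤ ∑ j, ‖β j (A (P w)) • v j‖ := by
          conv_lhs => rw [h1]
          exact norm_sum_le _ _
      _ ≤ ∑ _j : Fin d, 2 * d.factorial * ‖A‖ ^ (d - 1) / D * ‖A (P w)‖ := by
          refine Finset.sum_le_sum fun j _ => ?_
          rw [norm_smul]
          exact (mul_le_of_le_one_right (norm_nonneg _) (hv j)).trans (b4 j _)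
      _ = 2 * d * d.factorial * (‖A (P w)‖ * ‖A‖ ^ (d - 1) / D) := by
          rw [Finset.sum_const, Finset.card_univ, Fintype.card_fin, nsmul_eq_mul]
          ring
      _ ≤ splitConst d * (‖A (P w)‖ * ‖A‖ ^ (d - 1) / D) :=
          mul_le_mul_of_nonneg_right hC (by positivity)
      _ = _ := by ring

end Splitting

section SpecRad

variable {R : Type*} [NormedRing R]

theorem rpow_norm_pow_le (A : R) {k : ℕ} (hk : k ≠ 0) : ‖A ^ k‖ ^ (1 / (k : ℝ)) ≤ ‖A‖ := by
  calc ‖A ^ k‖ ^ (1 / (k : ℝ)) ≤ (‖A‖ ^ k) ^ (1 / (k : ℝ)) :=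
        Real.rpow_le_rpow (norm_nonneg _) (norm_pow_le' A (Nat.pos_of_ne_zero hk)) (by positivity)
    _ = ‖A‖ := by
        rw [one_div, Real.pow_rpow_inv_natCast (norm_nonneg _) hk]

theorem specRad_le_norm (A : R) : specRad A ≤ ‖A‖ := by
  refine limsup_le_of_le ?_ ?_
  · exact isCoboundedUnder_le_of_le _ (x := 0) fun k => Real.rpow_nonneg (norm_nonneg _) _
  · filter_upwards [eventually_ne_atTop 0] with k hk using rpow_norm_pow_le A hk

theorem specRad_nonneg (A : R) : 0 ≤ specRad A := by
  refine le_limsup_of_frequently_le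
    (Frequently.of_forall fun k => Real.rpow_nonneg (norm_nonneg _) _) ?_
  refine ⟨‖A‖, eventually_map.2 ?_⟩
  filter_upwards [eventually_ne_atTop 0] with k hk using rpow_norm_pow_le A hk

theorem le_specRad {A : R} {c K : ℝ} (hc : 0 < c) (hK : 0 < K)
    (h : ∀ k : ℕ, c ^ k ≤ K * ‖A ^ k‖) : c ≤ specRad A := by
  have h1 : Tendsto (fun k : ℕ => c * K⁻¹ ^ (1 / (k : ℝ))) atTop (𝓝 (c * K⁻¹ ^ (0 : ℝ))) := by
    refine tendsto_const_nhds.mul ?_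
    exact (Real.continuousAt_const_rpow (inv_pos.2 hK).ne').tendsto.comp
      tendsto_one_div_atTop_nhds_zero_nat
  rw [Real.rpow_zero, mul_one] at h1
  rw [← h1.limsup_eq]
  refine limsup_le_limsup ?_ ?_ ?_
  · filter_upwards [eventually_ne_atTop 0] with k hk
    calc c * K⁻¹ ^ (1 / (k : ℝ)) = (c ^ k * K⁻¹) ^ (1 / (k : ℝ)) := by
          rw [Real.mul_rpow (by positivity) (by positivity), one_div,
            Real.pow_rpow_inv_natCast hc.le hk]
      _ ≤ ‖A ^ k‖ ^ (1 / (k : ℝ)) := by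
          refine Real.rpow_le_rpow (by positivity) ?_ (by positivity)
          rw [← div_eq_mul_inv, div_le_iff₀ hK, mul_comm]
          exact h k
  · exact h1.isBoundedUnder_ge.isCoboundedUnder_le
  · refine ⟨‖A‖, ?_⟩
    rw [eventually_map]
    filter_upwards [eventually_ne_atTop 0] with k hk using rpow_norm_pow_le A hk

end SpecRad

section Core

omit [CompleteSpace 𝕏]

namespace IsSplitting

variable {A P Q B C P' Q' S : 𝕏 →L[ℝ] 𝕏} {d : ℕ} {κ τ s τ' s' M : ℝ}

theorem exists_ne_zero (h : IsSplitting A P Q d κ τ s) (hd : d ≠ 0) : ∃ p, p ≠ 0 ∧ P p = p := by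
  have := h.finite
  have h1 : 0 < Module.finrank ℝ (LinearMap.range (P : 𝕏 →ₗ[ℝ] 𝕏)) := by
    rw [h.rank]; exact Nat.pos_of_ne_zero hd
  have := Module.finrank_pos_iff.1 h1
  obtain ⟨⟨p, w, hw⟩, hp⟩ := exists_ne (0 : LinearMap.range (P : 𝕏 →ₗ[ℝ] 𝕏))
  refine ⟨p, fun h0 => hp (Subtype.ext h0), ?_⟩
  rw [← hw]
  exact h.idemP w

/-- An operator expanding the range of its splitting modulo the kernel, with a sufficiently large
spectral gap, preserves a cone. -/
theorem le_specRad (h : IsSplitting A P Q d κ τ s) (hd : d ≠ 0) (hκ : 1 ≤ κ) (hτ : 0 ≤ τ) {l : ℝ}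
    (hl : 0 < l) (hexp : ∀ p, P p = p → l * ‖p‖ ≤ ‖P (A p)‖)
    (hgap : 8 * κ * (1 + κ) * ‖A‖ * τ ≤ l ^ 2) : l / 2 ≤ specRad A := by
  obtain ⟨p, hp0, hp⟩ := h.exists_ne_zero hd
  have hpos : 0 < ‖p‖ := norm_pos_iff.2 hp0
  have hlκ : l ≤ κ * ‖A‖ := by
    have h1 : l * ‖p‖ ≤ κ * ‖A‖ * ‖p‖ := by
      refine (hexp p hp).trans ((h.normP _).trans ?_)
      rw [mul_assoc]
      exact mul_le_mul_of_nonneg_left (A.le_opNorm p) (by linarith)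
    exact le_of_mul_le_mul_right h1 hpos
  have ha : 0 < ‖A‖ := by
    by_contra h0
    have : ‖A‖ = 0 := le_antisymm (not_lt.1 h0) (norm_nonneg A)
    rw [this, mul_zero] at hlκ
    linarith
  set K := 4 * (1 + κ) * ‖A‖ / l with hK
  have hKl : K * l = 4 * (1 + κ) * ‖A‖ := div_mul_cancel₀ _ hl.ne'
  have hK0 : 0 < K := by positivity
  have c1 : κ * τ * K ≤ l / 2 := by
    rw [hK, mul_div_assoc', div_le_iff₀ hl]
    nlinarith
  have c2 : τ * K ≤ ‖A‖ := by
    have h1 : 8 * (1 + κ) * τ ≤ l := by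
      have : (κ * ‖A‖) * (8 * (1 + κ) * τ) ≤ (κ * ‖A‖) * l := by nlinarith
      exact le_of_mul_le_mul_left this (by positivity)
    rw [hK, mul_div_assoc', div_le_iff₀ hl]
    nlinarith
  have step : ∀ w, ‖w - P w‖ ≤ K * ‖P w‖ →
      l / 2 * ‖P w‖ ≤ ‖P (A w)‖ ∧ ‖A w - P (A w)‖ ≤ K * ‖P (A w)‖ := by
    intro w hw
    have hT : ‖A (w - P w)‖ ≤ τ * (K * ‖P w‖) := by
      have := h.tail (w - P w)
      rw [map_sub P, h.idemP, sub_self, sub_zero] at this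
      exact this.trans (mul_le_mul_of_nonneg_left hw hτ)
    have hdec : A w = A (P w) + A (w - P w) := by rw [← map_add, add_sub_cancel]
    have hlow : l / 2 * ‖P w‖ ≤ ‖P (A w)‖ := by
      have h1 := hexp (P w) (h.idemP w)
      have h2 : ‖P (A (w - P w))‖ ≤ κ * τ * K * ‖P w‖ := by
        refine (h.normP _).trans ?_
        calc κ * ‖A (w - P w)‖ ≤ κ * (τ * (K * ‖P w‖)) :=
              mul_le_mul_of_nonneg_left hT (by linarith)
          _ = _ := by ring
      have h3 : ‖P (A (P w))‖ ≤ ‖P (A w)‖ + ‖P (A (w - P w))‖ := by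
        have : P (A (P w)) = P (A w) - P (A (w - P w)) := by
          rw [hdec, map_add]
          abel
        rw [this]
        exact norm_sub_le _ _
      nlinarith [mul_le_mul_of_nonneg_right c1 (norm_nonneg (P w))]
    refine ⟨hlow, ?_⟩
    have h1 : ‖A w‖ ≤ 2 * ‖A‖ * ‖P w‖ := by
      rw [hdec]
      refine (norm_add_le _ _).trans ?_
      have := A.le_opNorm (P w)
      nlinarith [mul_le_mul_of_nonneg_right c2 (norm_nonneg (P w))]
    have h2 : ‖A w - P (A w)‖ ≤ (1 + κ) * ‖A w‖ := by
      refine (norm_sub_le _ _).trans ?_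
      linarith [h.normP (A w)]
    calc ‖A w - P (A w)‖ ≤ (1 + κ) * (2 * ‖A‖ * ‖P w‖) :=
          h2.trans (mul_le_mul_of_nonneg_left h1 (by linarith))
      _ = K * (l / 2 * ‖P w‖) := by linear_combination (-(1 / 2) * ‖P w‖) * hKl
      _ ≤ _ := mul_le_mul_of_nonneg_left hlow hK0.le
  have iter : ∀ k : ℕ, (l / 2) ^ k * ‖p‖ ≤ ‖P ((A ^ k) p)‖ ∧
      ‖(A ^ k) p - P ((A ^ k) p)‖ ≤ K * ‖P ((A ^ k) p)‖ := by
    intro k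
    induction k with
    | zero =>
      simp only [pow_zero, one_mul, one_apply_eq_self, hp, le_refl, sub_self, norm_zero,
        true_and]
      positivity
    | succ k ih =>
      have h1 := step _ ih.2
      rw [pow_succ' A, mul_apply_eq_comp]
      refine ⟨le_trans ?_ h1.1, h1.2⟩
      rw [pow_succ', mul_assoc]
      exact mul_le_mul_of_nonneg_left ih.1 (by positivity)
  refine _root_.le_specRad (K := κ) (by positivity) (by positivity) fun k => ?_
  have h1 : (l / 2) ^ k * ‖p‖ ≤ κ * ‖A ^ k‖ * ‖p‖ := by
    refine (iter k).1.trans ((h.normP _).trans ?_)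
    rw [mul_assoc]
    exact mul_le_mul_of_nonneg_left ((A ^ k).le_opNorm p) (by linarith)
  exact le_of_mul_le_mul_right h1 hpos

/-- A kernel vector of one splitting nearly lies in the kernel of the next one. -/
theorem norm_map_le_of_ker (h : IsSplitting B P Q d κ τ s)
    (h' : IsSplitting (S * B) P' Q' d κ τ' s')
    (hκ : 0 ≤ κ) (hs : 0 < s') (hS : ‖S‖ ≤ M) {v : 𝕏} (hv : P v = 0) :
    ‖P' v‖ ≤ κ * M * τ / s' * ‖v‖ := by
  have h1 : s' * ‖P' v‖ ≤ κ * (M * (τ * ‖v‖)) := by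
    refine (h'.lower v).trans ?_
    rw [← h'.comm, mul_apply_eq_comp]
    refine (h'.normQ _).trans (mul_le_mul_of_nonneg_left ?_ hκ)
    have h2 := h.tail v
    rw [hv, sub_zero] at h2
    exact (S.le_opNorm _).trans (mul_le_mul hS h2 (norm_nonneg _) ((norm_nonneg _).trans hS))
  rw [div_mul_eq_mul_div, le_div_iff₀ hs]
  linarith

/-- A range vector of one splitting nearly lies in the range of the previous one. -/
theorem norm_sub_le_of_range (h : IsSplitting C P Q d κ τ s)
    (h' : IsSplitting (C * S) P' Q' d κ τ' s') (hτ : 0 ≤ τ) (hs : 0 < s') (hS : ‖S‖ ≤ M) {q : 𝕏}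
    (hq : Q' q = q) : ‖q - Q q‖ ≤ M * τ / s' * ‖q‖ := by
  obtain ⟨u, hu⟩ := h'.rangeQ q
  rw [hq] at hu
  have h1 := h'.lower u
  rw [← hu] at h1
  have h2 : q = C (S (P' u)) := by rw [hu, mul_apply_eq_comp]
  have h3 : q - Q q = C (S (P' u) - P (S (P' u))) := by
    rw [map_sub, ← h.comm, ← h2]
  have h4 : ‖q - Q q‖ ≤ τ * (M * ‖P' u‖) := by
    rw [h3]
    exact (h.tail _).trans (mul_le_mul_of_nonneg_left
      ((S.le_opNorm _).trans (mul_le_mul_of_nonneg_right hS (norm_nonneg _))) hτ)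
  have hM : 0 ≤ M := (norm_nonneg S).trans hS
  rw [div_mul_eq_mul_div, le_div_iff₀ hs]
  calc ‖q - Q q‖ * s' ≤ τ * (M * ‖P' u‖) * s' := mul_le_mul_of_nonneg_right h4 hs.le
    _ = M * τ * (s' * ‖P' u‖) := by ring
    _ ≤ M * τ * ‖q‖ := mul_le_mul_of_nonneg_left h1 (by positivity)

/-- If the composition `B C` expands a subspace of dimension `d` strongly, then the range of the
splitting of `C` is transverse to the kernel of the splitting of `B`. -/
theorem le_norm_of_transverse (h : IsSplitting B P Q d κ τ s) (h' : IsSplitting C P' Q' d κ τ' s')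
    (hκ : 1 ≤ κ) (hτ : 0 ≤ τ) {b σ t : ℝ} (hB : ‖B‖ ≤ b) (hC : ‖C‖ ≤ b)
    (E : Submodule ℝ 𝕏) [FiniteDimensional ℝ E] (hE : Module.finrank ℝ E = d)
    (hexp : ∀ u ∈ E, σ * ‖u‖ ≤ ‖B (C u)‖) (ht : 0 < t) (hσ : b * t + b * τ' + κ * τ * b ≤ σ)
    {q : 𝕏} (hq : Q' q = q) : t * ‖q‖ ≤ κ * b * ‖P q‖ := by
  have hb : 0 ≤ b := (norm_nonneg B).trans hB
  have key : ∀ u ∈ E, b * t * ‖u‖ ≤ b * ‖P (C (P' u))‖ := by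
    intro u hu
    have h1 := hexp u hu
    set z := C (P' u)
    have h2 : ‖B (C u)‖ ≤ ‖B z‖ + b * (τ' * ‖u‖) := by
      have e : B (C u) = B z + B (C (u - P' u)) := by
        rw [← map_add, ← map_add, add_sub_cancel]
      rw [e]
      refine (norm_add_le _ _).trans (add_le_add_right ?_ _)
      exact (B.le_opNorm _).trans (mul_le_mul hB (h'.tail u) (norm_nonneg _) hb)
    have h3 : ‖z‖ ≤ b * (κ * ‖u‖) :=
      (C.le_opNorm _).trans (mul_le_mul hC (h'.normP u) (norm_nonneg _) hb)
    have h4 : ‖B z‖ ≤ b * ‖P z‖ + τ * ‖z‖ := by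
      have e : B z = B (P z) + B (z - P z) := by rw [← map_add, add_sub_cancel]
      rw [e]
      refine (norm_add_le _ _).trans (add_le_add ?_ (h.tail z))
      exact (B.le_opNorm _).trans (mul_le_mul_of_nonneg_right hB (norm_nonneg _))
    have h5 := mul_le_mul_of_nonneg_left h3 hτ
    nlinarith [mul_le_mul_of_nonneg_right hσ (norm_nonneg u)]
  rcases hb.eq_or_lt with hb0 | hb0
  · have : q = 0 := by
      obtain ⟨u, hu⟩ := h'.rangeQ q
      have hC0 : C = 0 := norm_le_zero_iff.1 (hC.trans hb0.ge)
      rw [← hq, hu, hC0]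
      rfl
    simp [this, ← hb0]
  have key' : ∀ u ∈ E, t * ‖u‖ ≤ ‖P (C (P' u))‖ := fun u hu =>
    le_of_mul_le_mul_left (by linarith [key u hu]) hb0
  have := h'.finite
  set f : E →ₗ[ℝ] LinearMap.range (P' : 𝕏 →ₗ[ℝ] 𝕏) :=
    (P' : 𝕏 →ₗ[ℝ] 𝕏).rangeRestrict ∘ₗ E.subtype with hf
  have hfv : ∀ u : E, ((f u : LinearMap.range (P' : 𝕏 →ₗ[ℝ] 𝕏)) : 𝕏) = P' (u : 𝕏) := fun _ => rfl
  have hinj : Function.Injective f := by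
    rw [injective_iff_map_eq_zero]
    intro u hu
    have h1 := key' u u.2
    rw [← hfv, hu, ZeroMemClass.coe_zero, map_zero, map_zero, norm_zero] at h1
    have h2 : ‖(u : 𝕏)‖ ≤ 0 := by nlinarith [norm_nonneg (u : 𝕏)]
    exact Subtype.ext (norm_le_zero_iff.1 h2)
  have hsurj : Function.Surjective f :=
    (LinearMap.injective_iff_surjective_of_finrank_eq_finrank (hE.trans h'.rank.symm)).1 hinj
  obtain ⟨p, hp⟩ := h'.rangeQ q
  rw [hq] at hp
  obtain ⟨u, hu⟩ := hsurj ⟨P' p, p, rfl⟩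
  have hu' : P' (u : 𝕏) = P' p := by rw [← hfv, hu]
  have h1 := key' u u.2
  rw [hu', ← hp] at h1
  have h2 : ‖q‖ ≤ b * (κ * ‖(u : 𝕏)‖) := by
    rw [hp, ← hu']
    exact (C.le_opNorm _).trans (mul_le_mul hC (h'.normP u) (norm_nonneg _) hb)
  nlinarith [mul_le_mul_of_nonneg_left h1 (mul_nonneg (by linarith : (0 : ℝ) ≤ κ) hb),
    mul_le_mul_of_nonneg_left h2 ht.le]

/-- If `P'` almost vanishes on the kernel of `P` then it is bounded below on the range of `P`. -/
theorem le_norm_of_near (h : IsSplitting B P Q d κ τ s) (h' : IsSplitting C P' Q' d κ τ' s')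
    (hκ : 1 ≤ κ) {η : ℝ} (hη : η ≤ 1 / 2) (hnear : ∀ w, ‖P' (w - P w)‖ ≤ η * ‖w‖) {p : 𝕏}
    (hp : P p = p) : ‖p‖ ≤ 2 * κ * ‖P' p‖ := by
  have := h.finite
  have := h'.finite
  have hlow : ∀ w, P' w = w → ‖w‖ ≤ 2 * ‖P' (P w)‖ := by
    intro w hw
    have h1 := hnear w
    rw [map_sub, hw] at h1
    have h2 : ‖w‖ ≤ ‖w - P' (P w)‖ + ‖P' (P w)‖ := by
      simpa using norm_add_le (w - P' (P w)) (P' (P w))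
    nlinarith [norm_nonneg w]
  set f : LinearMap.range (P' : 𝕏 →ₗ[ℝ] 𝕏) →ₗ[ℝ] LinearMap.range (P : 𝕏 →ₗ[ℝ] 𝕏) :=
    (P : 𝕏 →ₗ[ℝ] 𝕏).rangeRestrict ∘ₗ (LinearMap.range (P' : 𝕏 →ₗ[ℝ] 𝕏)).subtype with hf
  have hfv : ∀ u, ((f u : LinearMap.range (P : 𝕏 →ₗ[ℝ] 𝕏)) : 𝕏) = P (u : 𝕏) := fun _ => rfl
  have hmem : ∀ u : LinearMap.range (P' : 𝕏 →ₗ[ℝ] 𝕏), P' (u : 𝕏) = u := by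
    rintro ⟨_, w, rfl⟩
    exact h'.idemP w
  have hinj : Function.Injective f := by
    rw [injective_iff_map_eq_zero]
    intro u hu
    have h1 := hlow u (hmem u)
    rw [← hfv, hu, ZeroMemClass.coe_zero, map_zero, norm_zero, mul_zero] at h1
    exact Subtype.ext (norm_le_zero_iff.1 h1)
  have hsurj : Function.Surjective f :=
    (LinearMap.injective_iff_surjective_of_finrank_eq_finrank (h'.rank.trans h.rank.symm)).1 hinj
  obtain ⟨u, hu⟩ := hsurj ⟨p, p, hp⟩
  have hu' : P (u : 𝕏) = p := by rw [← hfv, hu]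
  have h1 := hlow u (hmem u)
  have h2 := h.normP u
  rw [hu'] at h1 h2
  nlinarith

end IsSplitting

section Drift

variable {P Q : ℕ → 𝕏 →L[ℝ] 𝕏} {d : ℕ} {κ M : ℝ} {τ s : ℕ → ℝ} {m : ℕ}

theorem exists_ker_near {B S : ℕ → 𝕏 →L[ℝ] 𝕏} (hBS : ∀ j, B (j + 1) = S j * B j)
    (hS : ∀ j, ‖S j‖ ≤ M) (h : ∀ j, m ≤ j → IsSplitting (B j) (P j) (Q j) d κ (τ j) (s j))
    (hκ : 0 ≤ κ) (hs : ∀ j, m ≤ j → 0 < s j) (hτ : ∀ j, m ≤ j → 0 ≤ τ j) {η : ℝ} (hη : η ≤ 1)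
    (hsum : ∀ n, 2 * ∑ j ∈ Finset.Ico m n, κ * M * τ j / s (j + 1) ≤ η) {v : 𝕏} (hv : P m v = 0)
    {n : ℕ} (hn : m ≤ n) : ∃ v', P n v' = 0 ∧
      ‖v - v'‖ ≤ 2 * (∑ j ∈ Finset.Ico m n, κ * M * τ j / s (j + 1)) * ‖v‖ := by
  induction n, hn using Nat.le_induction with
  | base => exact ⟨v, hv, by simp⟩
  | succ n hn ih =>
    obtain ⟨v', hv', h1⟩ := ih
    have h2 := (h n hn).norm_map_le_of_ker (M := M) (S := S n) (hBS n ▸ h (n + 1) (by omega)) hκ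
      (hs _ (by omega)) (hS n) hv'
    refine ⟨v' - P (n + 1) v', ?_, ?_⟩
    · rw [map_sub, (h (n + 1) (by omega)).idemP, sub_self]
    have h3 : ‖v'‖ ≤ 2 * ‖v‖ := by
      have h4 : ‖v'‖ ≤ ‖v‖ + ‖v - v'‖ := by
        simpa using norm_sub_le v (v - v')
      nlinarith [mul_le_mul_of_nonneg_right ((hsum n).trans hη) (norm_nonneg v)]
    have hM : 0 ≤ M := (norm_nonneg _).trans (hS 0)
    have hδ : 0 ≤ κ * M * τ n / s (n + 1) :=
      div_nonneg (mul_nonneg (mul_nonneg hκ hM) (hτ n hn)) (hs _ (by omega)).le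
    rw [Finset.sum_Ico_succ_top hn]
    have h5 : ‖v - (v' - P (n + 1) v')‖ ≤ ‖v - v'‖ + ‖P (n + 1) v'‖ := by
      rw [← sub_add]
      exact norm_add_le _ _
    nlinarith [mul_le_mul_of_nonneg_left h3 hδ]

theorem exists_range_near {C S : ℕ → 𝕏 →L[ℝ] 𝕏} (hCS : ∀ j, C (j + 1) = C j * S j)
    (hS : ∀ j, ‖S j‖ ≤ M) (h : ∀ j, m ≤ j → IsSplitting (C j) (P j) (Q j) d κ (τ j) (s j))
    (hs : ∀ j, m ≤ j → 0 < s j) (hτ : ∀ j, m ≤ j → 0 ≤ τ j) {η : ℝ} (hη : η ≤ 1)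
    (hsum : ∀ n, 2 * ∑ j ∈ Finset.Ico m n, M * τ j / s (j + 1) ≤ η)
    {n : ℕ} (hn : m ≤ n) {q : 𝕏} (hq : Q n q = q) : ∃ q', Q m q' = q' ∧
      ‖q - q'‖ ≤ 2 * (∑ j ∈ Finset.Ico m n, M * τ j / s (j + 1)) * ‖q‖ := by
  induction n, hn using Nat.le_induction generalizing q with
  | base => exact ⟨q, hq, by simp⟩
  | succ n hn ih =>
    have h2 := (h n hn).norm_sub_le_of_range (M := M) (S := S n) (hCS n ▸ h (n + 1) (by omega))
      (hτ n hn) (hs _ (by omega)) (hS n) hq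
    obtain ⟨q', hq', h1⟩ := ih ((h n hn).idemQ q)
    refine ⟨q', hq', ?_⟩
    have hM : 0 ≤ M := (norm_nonneg _).trans (hS 0)
    have hδ : 0 ≤ M * τ n / s (n + 1) :=
      div_nonneg (mul_nonneg hM (hτ n hn)) (hs _ (by omega)).le
    have h0 : 0 ≤ ∑ j ∈ Finset.Ico m n, M * τ j / s (j + 1) := by
      refine Finset.sum_nonneg fun j hj => ?_
      rw [Finset.mem_Ico] at hj
      exact div_nonneg (mul_nonneg hM (hτ j hj.1)) (hs _ (by omega)).le
    have h3 : ‖Q n q‖ ≤ ‖q‖ + ‖q - Q n q‖ := by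
      simpa using norm_sub_le q (q - Q n q)
    have h4 : ‖q - q'‖ ≤ ‖q - Q n q‖ + ‖Q n q - q'‖ := by
      simpa using norm_add_le (q - Q n q) (Q n q - q')
    rw [Finset.sum_Ico_succ_top hn]
    set Z := ∑ j ∈ Finset.Ico m n, M * τ j / s (j + 1)
    set δ := M * τ n / s (n + 1)
    have h5 : 2 * Z * ‖Q n q‖ ≤ 2 * Z * (‖q‖ + δ * ‖q‖) :=
      mul_le_mul_of_nonneg_left (by linarith) (by linarith)
    have h6 : 2 * Z * (δ * ‖q‖) ≤ 1 * (δ * ‖q‖) :=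
      mul_le_mul_of_nonneg_right ((hsum n).trans hη) (mul_nonneg hδ (norm_nonneg q))
    linarith

/-- Recurrence criterion: a lower bound on the spectral radius of an operator which ends two
drifting families of splittings that are transverse at an early time. -/
theorem le_specRad_of_drift {B C S S' P' Q' : ℕ → 𝕏 →L[ℝ] 𝕏} (hBS : ∀ j, B (j + 1) = S j * B j)
    (hCS : ∀ j, C (j + 1) = C j * S' j) (hS : ∀ j, ‖S j‖ ≤ M) (hS' : ∀ j, ‖S' j‖ ≤ M)
    (h : ∀ j, m ≤ j → IsSplitting (B j) (P j) (Q j) d κ (τ j) (s j))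
    (h' : ∀ j, m ≤ j → IsSplitting (C j) (P' j) (Q' j) d κ (τ j) (s j))
    (hd : d ≠ 0) (hκ : 1 ≤ κ) (hs : ∀ j, m ≤ j → 0 < s j) (hτ : ∀ j, m ≤ j → 0 ≤ τ j)
    {η b σ t : ℝ} (hsum : ∀ n, 2 * ∑ j ∈ Finset.Ico m n, κ * M * τ j / s (j + 1) ≤ η)
    (hη : 4 * κ ^ 2 * η ≤ 1) (hb : 0 < b) (hBb : ‖B m‖ ≤ b) (hCb : ‖C m‖ ≤ b)
    (E : Submodule ℝ 𝕏) [FiniteDimensional ℝ E] (hE : Module.finrank ℝ E = d)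
    (hexp : ∀ u ∈ E, σ * ‖u‖ ≤ ‖B m (C m u)‖) (ht : 0 < t)
    (hσ : b * t + b * τ m + κ * τ m * b ≤ σ) (hηt : 40 * κ ^ 4 * b * η ≤ t)
    {n : ℕ} (hn : m ≤ n) (hQ : Q n = Q' n)
    (hgap : 8 * κ * (1 + κ) * ‖B n‖ * τ n ≤ (t / (8 * κ ^ 2 * b) * s n) ^ 2) :
    t / (8 * κ ^ 2 * b) * s n / 2 ≤ specRad (B n) := by
  have hκ0 : 0 < κ := by linarith
  have hM : 0 ≤ M := (norm_nonneg _).trans (hS 0)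
  have hη0 : 0 ≤ η := by simpa using hsum m
  have hη1 : η ≤ 1 / 4 := by
    linarith [mul_le_mul_of_nonneg_right (one_le_pow₀ hκ (n := 2)) hη0]
  have hsum' : ∀ n, 2 * ∑ j ∈ Finset.Ico m n, M * τ j / s (j + 1) ≤ η := by
    refine fun n => le_trans ?_ (hsum n)
    refine mul_le_mul_of_nonneg_left (Finset.sum_le_sum fun j hj => ?_) zero_le_two
    rw [Finset.mem_Ico] at hj
    refine div_le_div_of_nonneg_right ?_ (hs _ (by omega)).le
    have := mul_nonneg hM (hτ j hj.1)
    nlinarith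
  have hnear : ∀ w, ‖P n (w - P m w)‖ ≤ κ * (1 + κ) * η * ‖w‖ := by
    intro w
    obtain ⟨v', hv', h1⟩ := exists_ker_near hBS hS h hκ0.le hs hτ (by linarith) hsum
      (v := w - P m w) (by rw [map_sub, (h m le_rfl).idemP, sub_self]) hn
    have h2 : P n (w - P m w) = P n (w - P m w - v') := by rw [map_sub (P n) _ v', hv', sub_zero]
    have h3 : ‖w - P m w‖ ≤ (1 + κ) * ‖w‖ := by
      refine (norm_sub_le _ _).trans ?_
      linarith [(h m le_rfl).normP w]
    have h4 := h1.trans (mul_le_mul_of_nonneg_right (hsum n) (norm_nonneg _))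
    rw [h2]
    calc _ ≤ κ * (η * ((1 + κ) * ‖w‖)) := ((h n hn).normP _).trans
          (mul_le_mul_of_nonneg_left (h4.trans (mul_le_mul_of_nonneg_left h3 hη0)) hκ0.le)
      _ = _ := by ring
  have hη2 : κ * (1 + κ) * η ≤ 2 * κ ^ 2 * η := mul_le_mul_of_nonneg_right (by nlinarith) hη0
  have hrange : ∀ q, Q n q = q → t / (8 * κ ^ 2 * b) * ‖q‖ ≤ ‖P n q‖ := by
    intro q hq
    obtain ⟨q', hq', h1⟩ := exists_range_near hCS hS' h' hs hτ (by linarith) hsum' hn (hQ ▸ hq)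
    have h1 := h1.trans (mul_le_mul_of_nonneg_right (hsum' n) (norm_nonneg _))
    have h2 := (h m le_rfl).le_norm_of_transverse (h' m le_rfl) hκ (hτ m le_rfl) hBb hCb E hE hexp
      ht hσ hq'
    have h3 := (h m le_rfl).le_norm_of_near (h n hn) hκ (by linarith) hnear ((h m le_rfl).idemP q')
    have h4 : ‖P n (P m q')‖ ≤ ‖P n q‖ + κ * (η * ‖q‖) + 2 * κ ^ 2 * η * ‖q'‖ := by
      have e : P n (P m q') = P n q - P n (q - q') - P n (q' - P m q') := by
        simp only [map_sub]
        abel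
      rw [e]
      have h5 := norm_sub_le (P n q - P n (q - q')) (P n (q' - P m q'))
      have h6 := norm_sub_le (P n q) (P n (q - q'))
      have h7 := ((h n hn).normP (q - q')).trans (mul_le_mul_of_nonneg_left h1 hκ0.le)
      have h8 := (hnear q').trans (mul_le_mul_of_nonneg_right hη2 (norm_nonneg q'))
      linarith
    have h5 : ‖q'‖ ≤ ‖q‖ + ‖q - q'‖ := by simpa using norm_sub_le q (q - q')
    have h6 : ‖q‖ ≤ ‖q'‖ + ‖q - q'‖ := by simpa using norm_add_le q' (q - q')
    have hq0 := norm_nonneg q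
    have h7 : ‖q'‖ ≤ 2 * ‖q‖ := by nlinarith
    have h8 : ‖q‖ / 2 ≤ ‖q'‖ := by nlinarith
    have h9 : ‖P n (P m q')‖ ≤ ‖P n q‖ + 5 * κ ^ 2 * η * ‖q‖ := by
      have a1 : κ * (η * ‖q‖) ≤ κ ^ 2 * (η * ‖q‖) :=
        mul_le_mul_of_nonneg_right (by nlinarith) (by positivity)
      have a2 : 2 * κ ^ 2 * η * ‖q'‖ ≤ 2 * κ ^ 2 * η * (2 * ‖q‖) :=
        mul_le_mul_of_nonneg_left h7 (by positivity)
      linarith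
    have h10 : t * (‖q‖ / 2) ≤ 2 * κ ^ 2 * b * (‖P n q‖ + 5 * κ ^ 2 * η * ‖q‖) := by
      calc t * (‖q‖ / 2) ≤ t * ‖q'‖ := mul_le_mul_of_nonneg_left h8 ht.le
        _ ≤ κ * b * ‖P m q'‖ := h2
        _ ≤ κ * b * (2 * κ * (‖P n q‖ + 5 * κ ^ 2 * η * ‖q‖)) :=
            mul_le_mul_of_nonneg_left (h3.trans (mul_le_mul_of_nonneg_left h9 (by positivity)))
              (by positivity)
        _ = _ := by ring
    rw [div_mul_eq_mul_div, div_le_iff₀ (by positivity)]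
    have h11 := mul_le_mul_of_nonneg_right hηt hq0
    nlinarith
  refine (h n hn).le_specRad hd hκ (hτ n hn) (by have := hs n hn; positivity) ?_ hgap
  intro p hp
  have h1 : Q n (B n p) = B n p := by rw [(h n hn).comm, hp]
  have h2 := (h n hn).lower p
  rw [hp] at h2
  rw [mul_assoc]
  exact (mul_le_mul_of_nonneg_left h2 (by positivity)).trans (hrange _ h1)

end Drift

end Core

theorem eventually_measure_diff_lt {X : Type*} [MeasurableSpace X] {μ : Measure X}
    [IsFiniteMeasure μ] {E : ℕ → Set X} {S : Set X} (hS : MeasurableSet S)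
    (hE : ∀ n, MeasurableSet (E n))
    (h : ∀ᵐ x ∂μ, x ∈ S → ∀ᶠ n in atTop, x ∈ E n) {ε : ENNReal} (hε : 0 < ε) :
    ∀ᶠ n in atTop, μ (S \ E n) < ε := by
  have h1 : Tendsto (fun n => μ (S \ E n)) atTop (𝓝 (μ ∅)) := by
    refine tendsto_measure_of_ae_tendsto_indicator_of_isFiniteMeasure atTop MeasurableSet.empty
      (fun n => hS.diff (hE n)) ?_
    filter_upwards [h] with x hx
    by_cases hxS : x ∈ S
    · filter_upwards [hx hxS] with n hn
      simp [hn]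
    · simp [hxS]
  rw [measure_empty] at h1
  exact h1.eventually_lt_const hε

theorem elog_mono {a b : ℝ} (ha : 0 ≤ a) (hab : a ≤ b) : elog a ≤ elog b := by
  rcases ha.eq_or_lt with rfl | ha
  · rw [elog, if_pos rfl]
    exact bot_le
  · rw [elog, elog, if_neg ha.ne', if_neg (ha.trans_le hab).ne', EReal.coe_le_coe_iff]
    exact Real.log_le_log ha hab

theorem expRate_mono {X : Type*} {a b : ℕ → X → ℝ} {x : X} (h : ∀ n, 0 ≤ a n x ∧ a n x ≤ b n x) :
    expRate a x ≤ expRate b x := by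
  refine limsup_le_limsup (Eventually.of_forall fun n => ?_)
  exact mul_le_mul_of_nonneg_left (elog_mono (h n).1 (h n).2)
    (EReal.coe_nonneg.2 (inv_nonneg.2 n.cast_nonneg))

section Cocycle

omit [CompleteSpace 𝕏]

variable {X : Type*} [TopologicalSpace X]

/-- A continuous linear cocycle over `T` growing at most like `M ^ n`. -/
structure IsCocycle (T : X → X) (𝒜 : X → ℕ → (𝕏 →L[ℝ] 𝕏)) (M : ℝ) : Prop where
  add : ∀ x n m, 𝒜 x (n + m) = 𝒜 (T^[m] x) n * 𝒜 x m
  cont : ∀ k, Continuous fun x => 𝒜 x k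
  norm_le : ∀ x n, ‖𝒜 x n‖ ≤ M ^ n
  one_le : 1 ≤ M

variable {T : X → X} {𝒜 : X → ℕ → (𝕏 →L[ℝ] 𝕏)} {M : ℝ}

namespace IsCocycle

theorem norm_zero_lt (h : IsCocycle T 𝒜 M) (x : X) : ‖𝒜 x 0‖ < 2 := by
  have := h.norm_le x 0
  rw [pow_zero] at this
  linarith

theorem hasNet_prod (h : IsCocycle T 𝒜 M) {n N : ℕ} (x : X) {ρ : ℕ → ℝ} (hρ : ∀ i, 0 < ρ i)
    (K : ℕ) (h1 : ∀ i < K, HasNet (𝒜 (T^[i * n] x) n) N (ρ i)) :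
    HasNet (𝒜 x (K * n)) (N ^ K) ((∏ i ∈ Finset.range K, ρ i) * 2) := by
  induction K with
  | zero => simpa using hasNet_of_norm_lt (h.norm_zero_lt x)
  | succ K ih =>
    rw [Nat.succ_mul, add_comm, h.add, pow_succ', Finset.prod_range_succ,
      mul_comm _ (ρ K), mul_assoc]
    exact (h1 K (by omega)).mul (ih fun i hi => h1 i (by omega))
      (mul_pos (Finset.prod_pos fun i _ => hρ i) two_pos)

/-- If most of an orbit admits good nets then the volume growth is small. -/
theorem vol_le_of_count (h : IsCocycle T 𝒜 M) {n N : ℕ} (x : X) (hN : 1 ≤ N) {c L : ℝ} (hcL : c ≤ L)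
    (hL : ∀ y, ‖𝒜 y n‖ < Real.exp (L * n)) (bad : Set X) (K : ℕ)
    (hgood : ∀ i < K, T^[i * n] x ∉ bad → HasNet (𝒜 (T^[i * n] x) n) N (Real.exp (c * n))) {θ : ℝ}
    (hcount : ∑ i ∈ Finset.range K, bad.indicator (fun _ => (1 : ℝ)) (T^[i * n] x) ≤ θ * K)
    (k : ℕ) : vol k (𝒜 x (K * n)) ≤
      (4 * k) ^ k * Real.exp (k * (c + (L - c) * θ) * (K * n)) * N ^ K := by
  classical
  set ρ : ℕ → ℝ := fun i =>
    Real.exp (c * n + (L - c) * n * bad.indicator (fun _ => (1 : ℝ)) (T^[i * n] x)) with hρ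
  have h1 := h.hasNet_prod (n := n) (N := N) x (ρ := ρ) (fun i => Real.exp_pos _) K fun i hi => ?_
  · have h2 : (∏ i ∈ Finset.range K, ρ i) ≤ Real.exp ((c + (L - c) * θ) * (K * n)) := by
      rw [hρ, ← Real.exp_sum, Real.exp_le_exp, Finset.sum_add_distrib, Finset.sum_const,
        Finset.card_range, nsmul_eq_mul, ← Finset.mul_sum]
      have := mul_le_mul_of_nonneg_left hcount
        (mul_nonneg (sub_nonneg.2 hcL) (Nat.cast_nonneg (α := ℝ) n))
      linarith
    have h3 := (h1.mono le_rfl (mul_le_mul_of_nonneg_right h2 zero_le_two)).vol_le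
      (by positivity) k
    refine h3.trans (le_of_eq ?_)
    push_cast
    rw [show (k : ℝ) * (c + (L - c) * θ) * (K * n) = k * ((c + (L - c) * θ) * (K * n)) by ring,
      Real.exp_nat_mul, ← mul_pow]
    congr 2
    ring
  · by_cases hb : T^[i * n] x ∈ bad
    · refine (hasNet_of_norm_lt (hL _)).mono hN ?_
      rw [hρ]
      simp only [Set.indicator_of_mem hb]
      exact Real.exp_le_exp.2 (by linarith)
    · refine (hgood i hi hb).mono le_rfl ?_
      rw [hρ]
      simp [Set.indicator_of_notMem hb]

theorem isOpen_hasNet (h : IsCocycle T 𝒜 M) (n N : ℕ) (r : ℝ) :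
    IsOpen {x | ∃ ε > 0, HasNet (𝒜 x n) N (r - ε)} := by
  rw [isOpen_iff_mem_nhds]
  rintro x ⟨ε, hε, hx⟩
  have h1 : ∀ᶠ y in 𝓝 x, ‖𝒜 y n - 𝒜 x n‖ < ε / 2 := by
    have h2 : Tendsto (fun y => ‖𝒜 y n - 𝒜 x n‖) (𝓝 x) (𝓝 ‖𝒜 x n - 𝒜 x n‖) :=
      (((h.cont n).sub continuous_const).norm).tendsto x
    rw [sub_self, norm_zero] at h2
    exact h2.eventually_lt_const (half_pos hε)
  filter_upwards [h1] with y hy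
  exact ⟨ε / 2, half_pos hε, hx.add.mono le_rfl (by linarith)⟩

variable [MeasurableSpace X] [BorelSpace X] {μ : Measure X}

theorem isSubmul_norm (h : IsCocycle T 𝒜 M) : IsSubmul T (fun n x => ‖𝒜 x n‖) M where
  meas n := (h.cont n).norm.measurable
  nonneg _ _ := norm_nonneg _
  le_pow n x := h.norm_le x n
  mul m n x := by
    rw [add_comm m n, h.add x n m, mul_comm]
    exact norm_mul_le _ _

theorem isSubmul_hmnc (h : IsCocycle T 𝒜 M) : IsSubmul T (fun n x => hmnc (𝒜 x n)) M where
  meas n := (continuous_hmnc.comp (h.cont n)).measurable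
  nonneg _ _ := hmnc_nonneg _
  le_pow n x := (hmnc_le_norm _).trans (h.norm_le x n)
  mul m n x := by
    rw [add_comm m n, h.add x n m, mul_comm]
    exact hmnc_mul_le _ _

theorem isSubmul_vol (h : IsCocycle T 𝒜 M) (k : ℕ) :
    IsSubmul T (fun n x => vol k (𝒜 x n)) (M ^ k) where
  meas n := ((continuous_vol k).comp (h.cont n)).measurable
  nonneg _ _ := vol_nonneg _ _
  le_pow n x := by
    refine (vol_le_norm_pow k _).trans ?_
    rw [← pow_mul, mul_comm k n, pow_mul]
    exact pow_le_pow_left₀ (norm_nonneg _) (h.norm_le x n) k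
  mul m n x := by
    rw [add_comm m n, h.add x n m, mul_comm]
    exact vol_mul_le _ _ _

theorem measure_eq_zero_of_vol [IsProbabilityMeasure μ] (hT : MeasurePreserving T μ μ)
    (h : IsCocycle T 𝒜 M) {S : Set X} (hS : MeasurableSet S) (hinv : ∀ᵐ x ∂μ, x ∈ S → T x ∈ S)
    {c e : ℝ} (hce : c < e) (hχ : ∀ x ∈ S, expRate (fun n x => hmnc (𝒜 x n)) x < (c : EReal))
    (hvol : ∀ x ∈ S, ∀ k : ℕ, k ≠ 0 →
      ((k * e : ℝ) : EReal) < expRate (fun n x => vol k (𝒜 x n)) x) : μ S = 0 := by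
  by_contra hμS
  have hS0 : 0 < μ.real S := ENNReal.toReal_pos hμS (measure_ne_top _ _)
  have hinv' : ∀ᵐ x ∂μ, x ∈ S → ∀ n, T^[n] x ∈ S := by
    have h1 : ∀ᵐ x ∂μ, ∀ n, T^[n] x ∈ S → T (T^[n] x) ∈ S :=
      ae_all_iff.2 fun n => (hT.iterate n).quasiMeasurePreserving.ae hinv
    filter_upwards [h1] with x hx hxS n
    induction n with
    | zero => exact hxS
    | succ n ih => rw [Function.iterate_succ_apply']; exact hx n ih
  obtain ⟨c₁, hc₁, hc₁e⟩ := exists_between hce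
  set δ := e - c₁ with hδ
  have hδ0 : 0 < δ := sub_pos.2 hc₁e
  set L := max (Real.log (2 * M)) c₁ with hL
  have hM := h.one_le
  have hcL : c₁ ≤ L := le_max_right _ _
  have hLn : ∀ n : ℕ, n ≠ 0 → ∀ y, ‖𝒜 y n‖ < Real.exp (L * n) := by
    intro n hn y
    calc ‖𝒜 y n‖ ≤ M ^ n := h.norm_le y n
      _ < (2 * M) ^ n := pow_lt_pow_left₀ (by linarith) (by linarith) hn
      _ = Real.exp (Real.log (2 * M) * n) := by
          rw [mul_comm (Real.log _), Real.exp_nat_mul, Real.exp_log (by linarith)]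
      _ ≤ _ := Real.exp_le_exp.2 (mul_le_mul_of_nonneg_right (le_max_left _ _) n.cast_nonneg)
  obtain ⟨θ, hθ0, hθ⟩ : ∃ θ > 0, (L - c₁) * θ ≤ δ / 4 := by
    refine ⟨δ / 4 / (L - c₁ + 1), div_pos (by linarith) (by linarith), ?_⟩
    rw [mul_div_assoc', div_le_iff₀ (by linarith)]
    nlinarith
  have hζ : 0 < ENNReal.ofReal (θ * μ.real S / 4) := ENNReal.ofReal_pos.2 (by positivity)
  -- choose the block length
  have hmeas : ∀ n, MeasurableSet {x | hmnc (𝒜 x n) < Real.exp (c₁ * n)} := fun n =>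
    measurableSet_lt (h.isSubmul_hmnc.meas n) measurable_const
  obtain ⟨n, hn, hn0⟩ := ((eventually_measure_diff_lt hS hmeas (μ := μ) (by
    filter_upwards [h.isSubmul_hmnc.tendsto_ae hT hM] with x hx hxS
    filter_upwards [eventually_le_exp (fun n => hmnc_nonneg _) hx.1 (hχ x hxS),
      eventually_ne_atTop 0] with n hn hn0
    refine hn.trans_lt (Real.exp_lt_exp.2 (mul_lt_mul_of_pos_right hc₁ ?_))
    exact_mod_cast Nat.pos_of_ne_zero hn0) hζ).and (eventually_ne_atTop 0)).exists
  have hn1 : (1 : ℝ) ≤ n := by exact_mod_cast Nat.one_le_iff_ne_zero.2 hn0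
  obtain ⟨N, hN, hN0⟩ := ((eventually_measure_diff_lt (hS.inter (hmeas n)) (μ := μ)
    (fun N => (h.isOpen_hasNet n N (Real.exp (c₁ * n))).measurableSet) (by
    refine Eventually.of_forall fun x hx => ?_
    obtain ⟨r, hr, hr'⟩ := exists_between (show hmnc (𝒜 x n) < Real.exp (c₁ * n) from hx.2)
    obtain ⟨N₀, hN₀⟩ := exists_hasNet hr
    filter_upwards [eventually_ge_atTop N₀] with N hN
    exact ⟨Real.exp (c₁ * n) - r, sub_pos.2 hr', hN₀.mono hN (by linarith)⟩) hζ).and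
    (eventually_ge_atTop 1)).exists
  set O := {x | ∃ ε > 0, HasNet (𝒜 x n) N (Real.exp (c₁ * n) - ε)} with hO
  have hOm : MeasurableSet O := (h.isOpen_hasNet n N (Real.exp (c₁ * n))).measurableSet
  set bad := S \ O with hbad
  have hbadm : MeasurableSet bad := hS.diff hOm
  have hbadμ : μ.real bad < θ * μ.real S / 2 := by
    have h1 : bad ⊆ (S \ {x | hmnc (𝒜 x n) < Real.exp (c₁ * n)}) ∪
        ((S ∩ {x | hmnc (𝒜 x n) < Real.exp (c₁ * n)}) \ O) := by
      rintro x ⟨hx, hx'⟩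
      by_cases hxn : x ∈ {x | hmnc (𝒜 x n) < Real.exp (c₁ * n)}
      · exact Or.inr ⟨⟨hx, hxn⟩, hx'⟩
      · exact Or.inl ⟨hx, hxn⟩
    have h2 := (measureReal_mono h1 (measure_ne_top μ _)).trans (measureReal_union_le _ _)
    have h3 := (ENNReal.lt_ofReal_iff_toReal_lt (measure_ne_top _ _)).1 hn
    have h4 := (ENNReal.lt_ofReal_iff_toReal_lt (measure_ne_top _ _)).1 hN
    simp only [Measure.real] at h2 h3 h4 ⊢
    linarith
  -- choose the exterior power
  obtain ⟨k, hk⟩ := exists_nat_ge (4 * Real.log N / δ)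
  obtain ⟨k, hk, hk0⟩ : ∃ k : ℕ, 4 * Real.log N / δ ≤ k ∧ k ≠ 0 :=
    ⟨k + 1, hk.trans (by push_cast; linarith), k.succ_ne_zero⟩
  have hk1 : (0 : ℝ) < k := by exact_mod_cast Nat.pos_of_ne_zero hk0
  have hNk : (N : ℝ) ≤ Real.exp (k * (δ / 4)) := by
    have hN1 : (0 : ℝ) < N := by exact_mod_cast hN0
    rw [← Real.log_le_iff_le_exp hN1]
    rw [div_le_iff₀ hδ0] at hk
    linarith
  -- choose the number of blocks
  have hD : ∀ K, MeasurableSet {x | Real.exp (k * e * (K * n : ℕ)) ≤ vol k (𝒜 x (K * n))} :=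
    fun K =>
    measurableSet_le measurable_const ((h.isSubmul_vol k).meas _)
  have hKn : Tendsto (fun K : ℕ => K * n) atTop atTop :=
    tendsto_id.atTop_mul_const' (Nat.pos_of_ne_zero hn0)
  have hvolev := eventually_measure_diff_lt hS hD (μ := μ) (by
    filter_upwards [(h.isSubmul_vol k).tendsto_ae hT (one_le_pow₀ hM)] with x hx hxS
    exact hKn.eventually (eventually_exp_le (fun n => vol_nonneg _ _) hx.1 (hvol x hxS k hk0)))
    (ENNReal.ofReal_pos.2 (show 0 < μ.real S / 4 by positivity))
  have hbig : ∀ᶠ K : ℕ in atTop, (4 * k : ℝ) ^ k < Real.exp (k * (δ / 4) * K) :=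
    (Real.tendsto_exp_atTop.comp (tendsto_natCast_atTop_atTop.const_mul_atTop
      (show 0 < k * (δ / 4) by positivity))).eventually_gt_atTop _
  obtain ⟨K, ⟨hK, hKbig⟩, hK0⟩ := ((hvolev.and hbig).and (eventually_gt_atTop 0)).exists
  have hK1 : (0 : ℝ) < K := by exact_mod_cast hK0
  set f : X → ℝ := fun x => ∑ i ∈ Finset.range K, bad.indicator (fun _ => (1 : ℝ)) (T^[i * n] x)
    with hf
  have hpre : ∀ i, (fun x => bad.indicator (fun _ => (1 : ℝ)) (T^[i] x)) =
      (T^[i] ⁻¹' bad).indicator fun _ => 1 := fun i => by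
    ext x
    rfl
  have hprem : ∀ i, MeasurableSet (T^[i] ⁻¹' bad) := fun i => (hT.iterate i).measurable hbadm
  have hfint : ∫ x, f x ∂μ = K * μ.real bad := by
    rw [hf, integral_finsetSum]
    · have : ∀ i, ∫ x, bad.indicator (fun _ => (1 : ℝ)) (T^[i] x) ∂μ = μ.real bad := fun i => by
        rw [hpre, integral_indicator_const _ (hprem i), smul_eq_mul, mul_one, Measure.real,
          (hT.iterate i).measure_preimage hbadm.nullMeasurableSet, Measure.real]
      simp [this]
    · intro i _
      rw [hpre]
      exact (integrable_const _).indicator (hprem _)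
  have hfi : Integrable f μ := by
    refine integrable_finsetSum _ fun i _ => ?_
    rw [hpre]
    exact (integrable_const _).indicator (hprem _)
  have hmarkov := mul_meas_ge_le_integral_of_nonneg (μ := μ) (f := f)
    (Eventually.of_forall fun x => Finset.sum_nonneg fun i _ =>
      Set.indicator_nonneg (fun _ _ => zero_le_one) _) hfi (θ * K)
  rw [hfint] at hmarkov
  have hmarkov' : μ.real {x | θ * K ≤ f x} < μ.real S / 2 := by
    have h1 : θ * μ.real {x | θ * K ≤ f x} ≤ μ.real bad :=
      le_of_mul_le_mul_left (by linarith) hK1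
    have h2 : θ * μ.real {x | θ * K ≤ f x} < θ * (μ.real S / 2) := by linarith
    exact lt_of_mul_lt_mul_left h2 hθ0.le
  obtain ⟨x, hxinv, hxf, hxD⟩ : ∃ x, (∀ n, T^[n] x ∈ S) ∧ f x < θ * K ∧
      Real.exp (k * e * (K * n : ℕ)) ≤ vol k (𝒜 x (K * n)) := by
    by_contra! hcon
    have h1 : μ S ≤ μ ({x | θ * K ≤ f x} ∪
        (S \ {x | Real.exp (k * e * (K * n : ℕ)) ≤ vol k (𝒜 x (K * n))})) := by
      refine measure_mono_ae ?_
      filter_upwards [hinv'] with x hx hxS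
      rcases lt_or_ge (f x) (θ * K) with h1 | h1
      · exact Or.inr ⟨hxS, fun h2 => absurd h2 (not_le.2 (hcon x (hx hxS) h1))⟩
      · exact Or.inl h1
    have h2 : μ.real S ≤ _ := (ENNReal.toReal_mono (measure_ne_top _ _) h1).trans
      (measureReal_union_le _ _)
    have h3 : μ.real _ < _ := (ENNReal.lt_ofReal_iff_toReal_lt (measure_ne_top _ _)).1 hK
    linarith
  have hfin := hxD.trans (h.vol_le_of_count (n := n) (N := N) x hN0 hcL (hLn n hn0) bad K
    (fun i _ hi => by
      have h1 : T^[i * n] x ∈ O := by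
        by_contra h2
        exact hi ⟨hxinv _, h2⟩
      obtain ⟨ε, hε, h2⟩ := h1
      exact h2.mono le_rfl (by linarith)) hxf.le k)
  refine absurd hfin (not_le.2 ?_)
  have hKn1 : (K : ℝ) ≤ K * n := le_mul_of_one_le_right hK1.le hn1
  calc (4 * k : ℝ) ^ k * Real.exp (k * (c₁ + (L - c₁) * θ) * (K * n)) * N ^ K
      ≤ (4 * k : ℝ) ^ k * Real.exp (k * (c₁ + δ / 4) * (K * n)) * Real.exp (k * (δ / 4) * K) := by
        gcongr
        rw [mul_comm _ (K : ℝ), Real.exp_nat_mul]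
        exact pow_le_pow_left₀ N.cast_nonneg hNk K
    _ < Real.exp (k * (δ / 4) * K) * Real.exp (k * (c₁ + δ / 4) * (K * n)) *
        Real.exp (k * (δ / 4) * K) := by gcongr
    _ ≤ Real.exp (k * e * (K * n : ℕ)) := by
        rw [← Real.exp_add, ← Real.exp_add, Real.exp_le_exp]
        push_cast
        have h1 : k * (δ / 4) * K ≤ k * (δ / 4) * (K * n) :=
          mul_le_mul_of_nonneg_left hKn1 (by positivity)
        have h2 : 0 ≤ k * (δ / 4) * (K * n) := by positivity
        have h3 : e = c₁ + δ := by rw [hδ]; ring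
        rw [h3]
        linarith

/-- Where the asymptotic measure of noncompactness is smaller than the top exponent, that exponent
has finite multiplicity `d`. -/
theorem exists_multiplicity_ae [IsProbabilityMeasure μ] (hT : MeasurePreserving T μ μ)
    (h : IsCocycle T 𝒜 M) : ∀ᵐ x ∂μ,
      expRate (fun n x => hmnc (𝒜 x n)) x < expRate (fun n x => ‖𝒜 x n‖) x → ∃ d : ℕ, d ≠ 0 ∧
        (∃ e : ℝ, (e : EReal) < expRate (fun n x => ‖𝒜 x n‖) x ∧
          expRate (fun n x => vol (d + 1) (𝒜 x n)) x ≤ (((d + 1 : ℕ) * e : ℝ) : EReal)) ∧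
        ∀ e : ℝ, (e : EReal) < expRate (fun n x => ‖𝒜 x n‖) x →
          ((d * e : ℝ) : EReal) < expRate (fun n x => vol d (𝒜 x n)) x := by
  have hM := h.one_le
  have key : ∀ᵐ x ∂μ, ∀ p q : ℚ, p < q → expRate (fun n x => hmnc (𝒜 x n)) x < ((p : ℝ) : EReal) →
      ∃ k : ℕ, k ≠ 0 ∧ expRate (fun n x => vol k (𝒜 x n)) x ≤ ((k * (q : ℝ) : ℝ) : EReal) := by
    refine ae_all_iff.2 fun p => ae_all_iff.2 fun q => ?_
    rcases le_or_gt q p with hpq | hpq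
    · exact Eventually.of_forall fun x hx => absurd hx (not_lt.2 hpq)
    set S := {x | expRate (fun n x => hmnc (𝒜 x n)) x < ((p : ℝ) : EReal) ∧
      ∀ k : ℕ, k ≠ 0 → ((k * (q : ℝ) : ℝ) : EReal) < expRate (fun n x => vol k (𝒜 x n)) x} with hS
    have hSm : MeasurableSet S := by
      refine (measurableSet_lt h.isSubmul_hmnc.measurable_expRate measurable_const).inter ?_
      exact measurableSet_setOfPred.2 (Measurable.forall fun k => Measurable.forall fun _ =>
        measurableSet_setOfPred.1
          (measurableSet_lt measurable_const (h.isSubmul_vol k).measurable_expRate))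
    have hinv : ∀ᵐ x ∂μ, x ∈ S → T x ∈ S := by
      filter_upwards [h.isSubmul_hmnc.expRate_comp_ae hT hM, ae_all_iff.2 fun k =>
        (h.isSubmul_vol k).expRate_comp_ae hT (one_le_pow₀ hM)] with x h1 h2 hx
      refine ⟨?_, fun k hk => ?_⟩
      · rw [h1]; exact hx.1
      · rw [h2]; exact hx.2 k hk
    have h0 := h.measure_eq_zero_of_vol hT hSm hinv (c := p) (e := q) (by exact_mod_cast hpq)
      (fun x hx => hx.1) fun x hx => hx.2
    filter_upwards [measure_eq_zero_iff_ae_notMem.1 h0] with x hx _ hp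
    by_contra! hcon
    exact hx ⟨hp, hcon⟩
  filter_upwards [key] with x hx hlt
  obtain ⟨q, hq, hq'⟩ := EReal.exists_rat_btwn_of_lt hlt
  obtain ⟨p, hp, hp'⟩ := EReal.exists_rat_btwn_of_lt hq
  have hex : ∃ k : ℕ, k ≠ 0 ∧ ∃ e : ℝ, (e : EReal) < expRate (fun n x => ‖𝒜 x n‖) x ∧
      expRate (fun n x => vol k (𝒜 x n)) x ≤ ((k * e : ℝ) : EReal) := by
    obtain ⟨k, hk, hk'⟩ := hx p q (by exact_mod_cast EReal.coe_lt_coe_iff.1 hp') hp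
    exact ⟨k, hk, q, hq', hk'⟩
  classical
  obtain ⟨hk0, hk⟩ := Nat.find_spec hex
  obtain ⟨d, hd⟩ := Nat.exists_eq_succ_of_ne_zero hk0
  rw [hd] at hk
  have hone : expRate (fun n x => ‖𝒜 x n‖) x ≤ expRate (fun n x => vol 1 (𝒜 x n)) x :=
    expRate_mono fun n => ⟨norm_nonneg _, norm_le_vol_one _⟩
  have hd0 : d ≠ 0 := by
    rintro rfl
    obtain ⟨e, he, he'⟩ := hk
    rw [Nat.cast_one, one_mul] at he'
    exact absurd (hone.trans he') (not_le.2 he)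
  refine ⟨d, hd0, hk, fun e he => ?_⟩
  by_contra hcon
  exact Nat.find_min hex (show d < Nat.find hex by omega) ⟨hd0, e, he, not_lt.1 hcon⟩

end IsCocycle
end Cocycle

theorem eventually_mul_exp_le {a b : ℝ} (hab : a < b) (C : ℝ) :
    ∀ᶠ n : ℕ in atTop, C * Real.exp (a * n) ≤ Real.exp (b * n) := by
  have h : ∀ᶠ n : ℕ in atTop, C ≤ Real.exp ((b - a) * n) :=
    (Real.tendsto_exp_atTop.comp (tendsto_natCast_atTop_atTop.const_mul_atTop
      (sub_pos.2 hab))).eventually_ge_atTop C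
  filter_upwards [h] with n hn
  calc C * Real.exp (a * n) ≤ Real.exp ((b - a) * n) * Real.exp (a * n) := by gcongr
    _ = Real.exp (b * n) := by rw [← Real.exp_add]; ring_nf

theorem sum_Ico_exp_le {c : ℝ} (hc : 0 < c) (m n : ℕ) :
    ∑ j ∈ Finset.Ico m n, Real.exp (-c * j) ≤ Real.exp (-c * m) / (1 - Real.exp (-c)) := by
  have h : ∀ j : ℕ, Real.exp (-c * j) = Real.exp (-c) ^ j := fun j => by
    rw [mul_comm, Real.exp_nat_mul]
  simp only [h]
  exact geom_sum_Ico_le_of_lt_one (Real.exp_pos _).le (Real.exp_lt_one_iff.2 (by linarith))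

omit [CompleteSpace 𝕏] in
theorem IsSplitting.mono {A P Q : 𝕏 →L[ℝ] 𝕏} {d : ℕ} {κ τ s τ' s' : ℝ}
    (h : IsSplitting A P Q d κ τ s) (hτ : τ ≤ τ') (hs : s' ≤ s) : IsSplitting A P Q d κ τ' s' where
  idemP := h.idemP
  idemQ := h.idemQ
  comm := h.comm
  normP := h.normP
  normQ := h.normQ
  finite := h.finite
  rank := h.rank
  rangeQ := h.rangeQ
  tail w := (h.tail w).trans (mul_le_mul_of_nonneg_right hτ (norm_nonneg _))
  lower w := (mul_le_mul_of_nonneg_right hs (norm_nonneg _)).trans (h.lower w)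

theorem one_le_splitConst (d : ℕ) : 1 ≤ splitConst d := by
  have h1 : (1 : ℝ) ≤ (d + 1).factorial := by
    exact_mod_cast Nat.one_le_iff_ne_zero.2 (Nat.factorial_ne_zero _)
  have h2 : (0 : ℝ) ≤ d := d.cast_nonneg
  rw [splitConst]
  nlinarith

omit [CompleteSpace 𝕏] in
theorem lower_bound_of_vol {d : ℕ} (hd : d ≠ 0) {A : 𝕏 →L[ℝ] 𝕏} {l ε : ℝ} (hε : 0 ≤ ε) {j : ℕ}
    (h1 : ‖A‖ ≤ Real.exp ((l + ε) * j)) (h2 : Real.exp (d * l * j) ≤ vol d A) :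
    (splitConst d)⁻¹ * Real.exp ((l - d * ε) * j) ≤ vol d A / (splitConst d * ‖A‖ ^ (d - 1)) := by
  have hκ := one_le_splitConst d
  have hA : 0 < ‖A‖ := by
    rw [norm_pos_iff]
    rintro rfl
    have h3 := h2.trans (vol_le_norm_pow d (0 : 𝕏 →L[ℝ] 𝕏))
    rw [norm_zero, zero_pow hd] at h3
    exact absurd h3 (not_le.2 (Real.exp_pos _))
  have h3 : ‖A‖ ^ (d - 1) ≤ Real.exp ((d - 1) * ((l + ε) * j)) := by
    refine (pow_le_pow_left₀ hA.le h1 _).trans (le_of_eq ?_)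
    rw [← Real.exp_nat_mul, Nat.cast_pred (Nat.pos_of_ne_zero hd)]
  rw [mul_comm (splitConst d), ← div_div, div_eq_inv_mul _ (splitConst d)]
  refine mul_le_mul_of_nonneg_left ?_ (by positivity)
  rw [le_div_iff₀ (pow_pos hA _)]
  refine (mul_le_mul_of_nonneg_left h3 (Real.exp_pos _).le).trans (le_trans ?_ h2)
  rw [← Real.exp_add, Real.exp_le_exp]
  have : 0 ≤ ε * j := by positivity
  nlinarith

/-- Exponential bounds, valid from the index `n₀` on, on the norm and on the `d`- and
`(d + 1)`-dimensional volume growth of a sequence of operators. -/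
def IsTame (d : ℕ) (l ε γ : ℝ) (n₀ : ℕ) (B : ℕ → 𝕏 →L[ℝ] 𝕏) : Prop :=
  ∀ j ≥ n₀, ‖B j‖ ≤ Real.exp ((l + ε) * j) ∧ Real.exp (d * l * j) ≤ vol d (B j) ∧
    vol (d + 1) (B j) ≤ Real.exp (((d + 1) * l - γ) * j)

omit [CompleteSpace 𝕏] in
/-- The splittings of the members of tame sequences can be chosen to depend on the operator only. -/
theorem exists_isSplitting_of_isTame {d : ℕ} (hd : d ≠ 0) {l ε γ : ℝ} (hε : 0 ≤ ε) (n₀ : ℕ) :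
    ∃ P Q : (𝕏 →L[ℝ] 𝕏) → (𝕏 →L[ℝ] 𝕏), ∀ B : ℕ → 𝕏 →L[ℝ] 𝕏, IsTame d l ε γ n₀ B → ∀ j ≥ n₀,
      IsSplitting (B j) (P (B j)) (Q (B j)) d (splitConst d)
        (splitConst d * Real.exp ((l - γ) * j))
        ((splitConst d)⁻¹ * Real.exp ((l - d * ε) * j)) := by
  choose! P Q hPQ using fun (A : 𝕏 →L[ℝ] 𝕏) (hA : 0 < vol d A) => exists_isSplitting hd hA
  refine ⟨P, Q, fun B hB j hj => ?_⟩
  obtain ⟨h1, h2, h3⟩ := hB j hj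
  have h0 : 0 < vol d (B j) := (Real.exp_pos _).trans_le h2
  refine (hPQ (B j) h0).mono ?_ (lower_bound_of_vol hd hε h1 h2)
  refine mul_le_mul_of_nonneg_left ?_ (zero_le_one.trans (one_le_splitConst d))
  rw [div_le_iff₀ h0]
  refine h3.trans (le_trans ?_ (mul_le_mul_of_nonneg_left h2 (Real.exp_pos _).le))
  rw [← Real.exp_add, Real.exp_le_exp]
  linarith

section

variable {X : Type*} [TopologicalSpace X] {T S : X → X} {𝒜 : X → ℕ → (𝕏 →L[ℝ] 𝕏)} {M : ℝ}

omit [CompleteSpace 𝕏] in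
theorem IsCocycle.frequently_le_specRad (h : IsCocycle T 𝒜 M) (hS : Continuous S)
    (hTS : Function.LeftInverse T S) (hST : Function.LeftInverse S T) {d n₀ : ℕ} (hd : d ≠ 0)
    {l ε γ : ℝ} (hε : 0 < ε) (hγ : (3 * d + 3) * ε ≤ γ) {x : X} (hx : IsTame d l ε γ n₀ (𝒜 x))
    (hx' : IsTame d l ε γ n₀ fun j => 𝒜 (S^[j] x) j)
    (hmid : ∃ᶠ m : ℕ in atTop, Real.exp (d * l * (2 * m : ℕ)) ≤ vol d (𝒜 (S^[m] x) (2 * m)))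
    (hrec : ∀ U ∈ 𝓝 x, ∃ᶠ n in atTop, T^[n] x ∈ U ∧
      IsTame d l ε γ n₀ fun j => 𝒜 (S^[j] (T^[n] x)) j) :
    ∃ᶠ n : ℕ in atTop, Real.exp ((l - (d + 1) * ε) * n) ≤ specRad (𝒜 x n) := by
  obtain ⟨P, Q, hPQ⟩ := exists_isSplitting_of_isTame (𝕏 := 𝕏) hd (l := l) (γ := γ) hε.le n₀
  have hκ := one_le_splitConst d
  set κ := splitConst d with hκdef
  have hκ0 : 0 < κ := by linarith
  have hdε : 0 < d * ε := mul_pos (by exact_mod_cast Nat.pos_of_ne_zero hd) hε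
  have hM0 : 0 < M := by linarith [h.one_le]
  set c := γ - d * ε with hc
  have hc0 : 0 < c := by rw [hc]; nlinarith
  set D := 2 * (κ ^ 3 * M * Real.exp (-(l - d * ε))) / (1 - Real.exp (-c)) with hD
  have hTS' : ∀ j y, T^[j] (S^[j] y) = y := fun j y => (hTS.iterate j) y
  have hST' : ∀ j y, S^[j] (T^[j] y) = y := fun j y => (hST.iterate j) y
  have ev1 : ∀ᶠ m : ℕ in atTop, 4 * κ ^ 2 * (D * Real.exp (-c * m)) ≤ 1 := by
    filter_upwards [eventually_mul_exp_le (show -c < 0 by linarith) (4 * κ ^ 2 * D)] with m hm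
    rw [zero_mul, Real.exp_zero] at hm
    linarith
  have ev2 : ∀ᶠ m : ℕ in atTop, 4 * κ ^ 2 * (1 + κ) * Real.exp ((2 * l - γ + ε) * m) ≤
      Real.exp ((2 * l - 2 * d * ε) * m) := eventually_mul_exp_le (by nlinarith) _
  have ev3 : ∀ᶠ m : ℕ in atTop, 160 * κ ^ 5 * D * Real.exp ((l + ε - c) * m) ≤
      Real.exp ((l - (2 * d + 1) * ε) * m) := eventually_mul_exp_le (by nlinarith) _
  obtain ⟨m, hmF, hmn, hm1, hm2, hm3⟩ := (hmid.and_eventually ((eventually_ge_atTop n₀).and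
    (ev1.and (ev2.and ev3)))).exists
  set b := Real.exp ((l + ε) * m) with hb
  set σ := κ⁻¹ * Real.exp ((l - d * ε) * (2 * m : ℕ)) / 2 with hσ
  set t := Real.exp ((l - (2 * d + 1) * ε) * m) / (4 * κ) with ht
  set r := t / (8 * κ ^ 2 * b) with hr
  have hb0 : 0 < b := Real.exp_pos _
  have hσ0 : 0 < σ := by positivity
  have ht0 : 0 < t := by positivity
  have hr0 : 0 < r := by positivity
  set F := 𝒜 x m * 𝒜 (S^[m] x) m with hF
  have hFA : 𝒜 (S^[m] x) (2 * m) = F := by rw [two_mul, h.add, hTS']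
  rw [hFA] at hmF
  have hFn : ‖F‖ ≤ Real.exp ((l + ε) * (2 * m : ℕ)) := by
    refine (norm_mul_le _ _).trans ((mul_le_mul (hx m hmn).1 (hx' m hmn).1 (norm_nonneg _)
      hb0.le).trans (le_of_eq ?_))
    rw [← Real.exp_add]
    push_cast
    ring_nf
  obtain ⟨PF, QF, hPF⟩ := exists_isSplitting hd ((Real.exp_pos _).trans_le hmF)
  have hFlow : ∀ u ∈ LinearMap.range (PF : 𝕏 →ₗ[ℝ] 𝕏), 2 * σ * ‖u‖ ≤ ‖F u‖ := by
    rintro _ ⟨w, rfl⟩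
    refine (mul_le_mul_of_nonneg_right ?_ (norm_nonneg _)).trans (hPF.lower w)
    refine le_trans (le_of_eq ?_) (lower_bound_of_vol hd hε.le hFn hmF)
    rw [hσ]
    ring
  have hU : {y | ‖𝒜 x m * 𝒜 (S^[m] y) m - F‖ < σ} ∈ 𝓝 x := by
    have h2 : Tendsto (fun y => ‖𝒜 x m * 𝒜 (S^[m] y) m - F‖) (𝓝 x)
        (𝓝 ‖𝒜 x m * 𝒜 (S^[m] x) m - F‖) :=
      ((continuous_const.mul ((h.cont m).comp (hS.iterate m))).sub continuous_const).norm.tendsto x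
    rw [← hF, sub_self, norm_zero] at h2
    exact h2.eventually_lt_const hσ0
  have ev4 : ∀ᶠ n : ℕ in atTop, 8 * κ ^ 4 * (1 + κ) / r ^ 2 * Real.exp ((2 * l + ε - γ) * n) ≤
      Real.exp ((2 * l - 2 * d * ε) * n) := eventually_mul_exp_le (by nlinarith) _
  have ev5 : ∀ᶠ n : ℕ in atTop, 2 * κ / r * Real.exp ((l - (d + 1) * ε) * n) ≤
      Real.exp ((l - d * ε) * n) := eventually_mul_exp_le (by nlinarith) _
  refine ((hrec _ hU).and_eventually ((eventually_ge_atTop m).and (ev4.and ev5))).mono ?_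
  rintro n ⟨⟨hyU, hy⟩, hnm, hn4, hn5⟩
  set y := T^[n] x with hydef
  have hBC : 𝒜 x n = 𝒜 (S^[n] y) n := by rw [hydef, hST']
  have hfin : FiniteDimensional ℝ (LinearMap.range (PF : 𝕏 →ₗ[ℝ] 𝕏)) := hPF.finite
  have hmain := le_specRad_of_drift (M := M) (m := m) (n := n) (d := d) (κ := κ)
    (B := 𝒜 x) (C := fun j => 𝒜 (S^[j] y) j)
    (S := fun j => 𝒜 (T^[j] x) 1) (S' := fun j => 𝒜 (S^[j + 1] y) 1)
    (P := fun j => P (𝒜 x j)) (Q := fun j => Q (𝒜 x j))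
    (P' := fun j => P (𝒜 (S^[j] y) j)) (Q' := fun j => Q (𝒜 (S^[j] y) j))
    (τ := fun j => κ * Real.exp ((l - γ) * j)) (s := fun j => κ⁻¹ * Real.exp ((l - d * ε) * j))
    (η := D * Real.exp (-c * m)) (b := b) (σ := σ) (t := t)
    (fun j => by rw [add_comm, h.add]) (fun j => by
      have h1 : T^[1] (S^[j + 1] y) = S^[j] y := by
        rw [Function.iterate_one, Function.iterate_succ_apply', hTS]
      have h2 := h.add (S^[j + 1] y) j 1
      rwa [h1] at h2)
    (fun j => by simpa using h.norm_le (T^[j] x) 1)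
    (fun j => by simpa using h.norm_le (S^[j + 1] y) 1)
    (fun j hj => hPQ _ hx j (hmn.trans hj)) (fun j hj => hPQ _ hy j (hmn.trans hj)) hd hκ
    (fun j _ => by positivity) (fun j _ => by positivity) (fun n => ?_) hm1 hb0 (hx m hmn).1
    (hy m hmn).1 (LinearMap.range (PF : 𝕏 →ₗ[ℝ] 𝕏)) hPF.rank (fun u hu => ?_) ht0 ?_ ?_ hnm
    (by rw [← hBC]) ?_
  · refine le_trans ?_ hmain
    rw [← hr]
    rw [div_mul_eq_mul_div, div_le_iff₀ hr0] at hn5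
    have : Real.exp ((l - (d + 1) * ε) * n) ≤ Real.exp ((l - d * ε) * n) * r / (2 * κ) := by
      rw [le_div_iff₀ (by positivity)]
      linarith
    refine this.trans (le_of_eq ?_)
    field_simp
  · have h1 : ∀ j : ℕ, κ * M * (κ * Real.exp ((l - γ) * j)) /
        (κ⁻¹ * Real.exp ((l - d * ε) * (j + 1 : ℕ))) =
        κ ^ 3 * M * Real.exp (-(l - d * ε)) * Real.exp (-c * j) := fun j => by
      rw [div_eq_iff (by positivity)]
      have : Real.exp ((l - γ) * j) = Real.exp (-(l - d * ε)) * Real.exp (-c * j) *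
          Real.exp ((l - d * ε) * (j + 1 : ℕ)) := by
        rw [← Real.exp_add, ← Real.exp_add, hc]
        push_cast
        ring_nf
      rw [this]
      field_simp
    simp only [h1]
    rw [← Finset.mul_sum]
    refine (mul_le_mul_of_nonneg_left (mul_le_mul_of_nonneg_left (sum_Ico_exp_le hc0 m n)
      (by positivity)) zero_le_two).trans (le_of_eq ?_)
    rw [hD]
    ring
  · have h1 := hFlow u hu
    have h2 : ‖(𝒜 x m * 𝒜 (S^[m] y) m - F) u‖ ≤ σ * ‖u‖ :=
      (ContinuousLinearMap.le_opNorm _ _).trans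
        (mul_le_mul_of_nonneg_right (le_of_lt hyU) (norm_nonneg _))
    have h3 : F u = (𝒜 x m) ((𝒜 (S^[m] y) m) u) - (𝒜 x m * 𝒜 (S^[m] y) m - F) u := by
      rw [sub_apply]
      exact (sub_sub_cancel _ _).symm
    rw [h3] at h1
    have h4 := h1.trans (norm_sub_le _ _)
    linarith
  · have h1 : b * t = σ / 2 := by
      rw [hb, ht, hσ, mul_div_assoc', ← Real.exp_add]
      have : (l + ε) * m + (l - (2 * d + 1) * ε) * m = (l - d * ε) * (2 * m : ℕ) := by
        push_cast; ring
      rw [this]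
      field_simp
      ring
    have h2 : b * (κ * Real.exp ((l - γ) * m)) = κ * Real.exp ((2 * l - γ + ε) * m) := by
      rw [hb, mul_left_comm, ← Real.exp_add]
      ring_nf
    have h3 : σ = Real.exp ((2 * l - 2 * d * ε) * m) / (2 * κ) := by
      rw [hσ, inv_mul_eq_div, div_div, mul_comm κ]
      push_cast
      ring_nf
    have h4 : κ * (1 + κ) * Real.exp ((2 * l - γ + ε) * m) ≤ σ / 2 := by
      rw [h3, div_div, le_div_iff₀ (by positivity)]
      linarith
    rw [h1, h2, mul_assoc κ, mul_comm _ b, h2]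
    linarith
  · rw [ht, le_div_iff₀ (by positivity)]
    refine le_trans (le_of_eq ?_) hm3
    rw [show (l + ε - c) * m = (l + ε) * m + -c * m by ring, Real.exp_add]
    ring
  · have h1 := mul_le_mul_of_nonneg_right (hx n (hmn.trans hnm)).1
      (show 0 ≤ κ * Real.exp ((l - γ) * n) by positivity)
    have h2 : Real.exp ((l + ε) * n) * (κ * Real.exp ((l - γ) * n)) =
        κ * Real.exp ((2 * l + ε - γ) * n) := by
      rw [mul_left_comm, ← Real.exp_add]
      ring_nf
    have h3 : Real.exp ((2 * l - 2 * d * ε) * n) = Real.exp ((l - d * ε) * n) ^ 2 := by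
      rw [← Real.exp_nat_mul]
      push_cast
      ring_nf
    rw [h2] at h1
    rw [h3, div_mul_eq_mul_div, div_le_iff₀ (by positivity)] at hn4
    calc 8 * κ * (1 + κ) * ‖𝒜 x n‖ * (κ * Real.exp ((l - γ) * n))
        ≤ 8 * κ * (1 + κ) * (κ * Real.exp ((2 * l + ε - γ) * n)) := by
          rw [mul_assoc (8 * κ * (1 + κ))]
          exact mul_le_mul_of_nonneg_left h1 (by positivity)
      _ ≤ κ⁻¹ ^ 2 * (Real.exp ((l - d * ε) * n) ^ 2 * r ^ 2) := by
          rw [inv_pow, inv_mul_eq_div, le_div_iff₀ (by positivity)]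
          linarith
      _ = _ := by
          rw [← hr]
          ring

end

theorem ae_frequently_mem_inter_of_mem_nhds {X : Type*} [TopologicalSpace X]
    [SecondCountableTopology X] [MeasurableSpace X] [OpensMeasurableSpace X] {μ : Measure X}
    {T : X → X} (hT : Conservative T μ) {G : Set X} (hG : MeasurableSet G) :
    ∀ᵐ x ∂μ, x ∈ G → ∀ U ∈ 𝓝 x, ∃ᶠ n in atTop, T^[n] x ∈ U ∩ G := by
  have h : ∀ s ∈ TopologicalSpace.countableBasis X, ∀ᵐ x ∂μ, x ∈ s ∩ G →
      ∃ᶠ n in atTop, T^[n] x ∈ s ∩ G := fun s hs =>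
    hT.ae_mem_imp_frequently_image_mem
      ((TopologicalSpace.isOpen_of_mem_countableBasis hs).measurableSet.inter hG).nullMeasurableSet
  filter_upwards [(ae_ball_iff (TopologicalSpace.countable_countableBasis X)).2 h]
    with x hx hxG U hU
  obtain ⟨s, hs, hxs, hsU⟩ := (TopologicalSpace.isBasis_countableBasis X).mem_nhds_iff.1 hU
  exact (hx s hs ⟨hxs, hxG⟩).mono fun n hn => ⟨hsU hn.1, hn.2⟩

theorem le_mul_elog_of_exp_le {c a : ℝ} {n : ℕ} (hn : n ≠ 0) (h : Real.exp (c * n) ≤ a) :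
    (c : EReal) ≤ (((n : ℝ)⁻¹ : ℝ) : EReal) * elog a := by
  have hn' : (0 : ℝ) < n := by exact_mod_cast Nat.pos_of_ne_zero hn
  have ha : 0 < a := (Real.exp_pos _).trans_le h
  rw [elog, if_neg ha.ne', ← EReal.coe_mul, EReal.coe_le_coe_iff, le_inv_mul_iff₀ hn', mul_comm,
    Real.le_log_iff_exp_le ha]
  exact h

section

variable {X : Type*} [TopologicalSpace X] [SecondCountableTopology X] [MeasurableSpace X]
  [BorelSpace X] {μ : Measure X} [IsProbabilityMeasure μ] {T S : X → X}
  {𝒜 : X → ℕ → (𝕏 →L[ℝ] 𝕏)} {M : ℝ}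

namespace IsCocycle

omit [CompleteSpace 𝕏] [SecondCountableTopology X] in
theorem measurableSet_isTame (h : IsCocycle T 𝒜 M) {f : ℕ → X → X} (hf : ∀ j, Measurable (f j))
    (d n₀ : ℕ) (l ε γ : ℝ) : MeasurableSet {x | IsTame d l ε γ n₀ fun j => 𝒜 (f j x) j} := by
  refine measurableSet_setOfPred.2 (Measurable.forall fun j => Measurable.forall fun _ => ?_)
  refine measurableSet_setOfPred.1 (MeasurableSet.inter ?_ (MeasurableSet.inter ?_ ?_))
  · exact measurableSet_le ((h.isSubmul_norm.meas j).comp (hf j)) measurable_const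
  · exact measurableSet_le measurable_const (((h.isSubmul_vol d).meas j).comp (hf j))
  · exact measurableSet_le (((h.isSubmul_vol (d + 1)).meas j).comp (hf j)) measurable_const

omit [CompleteSpace 𝕏] in
theorem frequently_le_specRad_ae (hT : MeasurePreserving T μ μ) (hS : MeasurePreserving S μ μ)
    (hTS : Function.LeftInverse T S) (hST : Function.LeftInverse S T) (hSc : Continuous S)
    (h : IsCocycle T 𝒜 M) {d : ℕ} (hd : d ≠ 0) {l ε γ : ℝ} (hε : 0 < ε)
    (hγ : (3 * d + 3) * ε ≤ γ) :
    ∀ᵐ x ∂μ, expRate (fun n x => ‖𝒜 x n‖) x < ((l + ε : ℝ) : EReal) →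
      ((d * l : ℝ) : EReal) < expRate (fun n x => vol d (𝒜 x n)) x →
      expRate (fun n x => vol (d + 1) (𝒜 x n)) x < (((d + 1) * l - γ : ℝ) : EReal) →
      ∃ᶠ n : ℕ in atTop, Real.exp ((l - (d + 1) * ε) * n) ≤ specRad (𝒜 x n) := by
  have hM := h.one_le
  set G : ℕ → Set X := fun n₀ => {x | IsTame d l ε γ n₀ fun j => 𝒜 x j} ∩
    {x | IsTame d l ε γ n₀ fun j => 𝒜 (S^[j] x) j} with hG
  have hGm : ∀ n₀, MeasurableSet (G n₀) := fun n₀ =>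
    (h.measurableSet_isTame (fun _ => measurable_id) d n₀ l ε γ).inter
      (h.measurableSet_isTame (fun j => (hS.iterate j).measurable) d n₀ l ε γ)
  filter_upwards [h.isSubmul_norm.tendsto_ae hT hM,
    (h.isSubmul_vol d).tendsto_ae hT (one_le_pow₀ hM),
    (h.isSubmul_vol (d + 1)).tendsto_ae hT (one_le_pow₀ hM),
    h.isSubmul_norm.tendsto_reverse_ae hT hS hTS hM,
    (h.isSubmul_vol d).tendsto_reverse_ae hT hS hTS (one_le_pow₀ hM),
    (h.isSubmul_vol (d + 1)).tendsto_reverse_ae hT hS hTS (one_le_pow₀ hM),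
    (h.isSubmul_vol d).frequently_centred_ae hT hS hTS (one_le_pow₀ hM),
    ae_all_iff.2 fun n₀ => ae_frequently_mem_inter_of_mem_nhds hT.conservative (hGm n₀)]
    with x a1 a2 a3 b1 b2 b3 hmid hrec h1 h2 h3
  obtain ⟨n₀, hn₀⟩ := eventually_atTop.1
    ((eventually_le_exp (fun n => norm_nonneg _) a1.1 h1).and
    ((eventually_exp_le (fun n => vol_nonneg _ _) a2.1 h2).and
    ((eventually_le_exp (fun n => vol_nonneg _ _) a3.1 h3).and
    ((eventually_le_exp (fun n => norm_nonneg _) b1 h1).and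
    ((eventually_exp_le (fun n => vol_nonneg _ _) b2 h2).and
    (eventually_le_exp (fun n => vol_nonneg _ _) b3 h3))))))
  have hxG : x ∈ G n₀ :=
    ⟨fun j hj => ⟨(hn₀ j hj).1, (hn₀ j hj).2.1, (hn₀ j hj).2.2.1⟩, fun j hj => (hn₀ j hj).2.2.2⟩
  exact h.frequently_le_specRad hSc hTS hST hd hε hγ hxG.1 hxG.2 (hmid _ h2)
    fun U hU => (hrec n₀ hxG U hU).mono fun n hn => ⟨hn.1, hn.2.2⟩

omit [CompleteSpace 𝕏] in
/-- The spectral radii of the cocycle grow at the top exponent along a subsequence, wherever the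
asymptotic measure of noncompactness is smaller than that exponent. -/
theorem le_limsup_specRad_ae (hT : MeasurePreserving T μ μ) (hS : MeasurePreserving S μ μ)
    (hTS : Function.LeftInverse T S) (hST : Function.LeftInverse S T) (hSc : Continuous S)
    (h : IsCocycle T 𝒜 M) :
    ∀ᵐ x ∂μ, expRate (fun n x => hmnc (𝒜 x n)) x < expRate (fun n x => ‖𝒜 x n‖) x →
      expRate (fun n x => ‖𝒜 x n‖) x ≤
        atTop.limsup fun n : ℕ => (((n : ℝ)⁻¹ : ℝ) : EReal) * elog (specRad (𝒜 x n)) := by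
  have key : ∀ᵐ x ∂μ, ∀ (d : ℕ) (l ε γ : ℚ), d ≠ 0 → 0 < (ε : ℝ) → (3 * d + 3) * (ε : ℝ) ≤ γ →
      expRate (fun n x => ‖𝒜 x n‖) x < ((l + ε : ℝ) : EReal) →
      ((d * l : ℝ) : EReal) < expRate (fun n x => vol d (𝒜 x n)) x →
      expRate (fun n x => vol (d + 1) (𝒜 x n)) x < (((d + 1) * l - γ : ℝ) : EReal) →
      ∃ᶠ n : ℕ in atTop, Real.exp ((l - (d + 1) * ε) * n) ≤ specRad (𝒜 x n) := by
    refine ae_all_iff.2 fun d => ae_all_iff.2 fun l => ae_all_iff.2 fun ε =>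
      ae_all_iff.2 fun γ => ?_
    by_cases hd : d ≠ 0
    swap
    · exact Eventually.of_forall fun x h1 => absurd h1 hd
    by_cases hε : 0 < (ε : ℝ)
    swap
    · exact Eventually.of_forall fun x _ h1 => absurd h1 hε
    by_cases hγ : (3 * d + 3) * (ε : ℝ) ≤ γ
    swap
    · exact Eventually.of_forall fun x _ _ h1 => absurd h1 hγ
    filter_upwards [h.frequently_le_specRad_ae hT hS hTS hST hSc hd (l := l) hε hγ]
      with x hx _ _ _ using hx
  filter_upwards [key, h.exists_multiplicity_ae hT] with x hx hmul hlt
  obtain ⟨d, hd, ⟨e, he, hvol⟩, hvol'⟩ := hmul hlt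
  generalize hΛ : expRate (fun n x => ‖𝒜 x n‖) x = Λ at *
  have hΛ1 : Λ ≠ ⊤ := hΛ ▸ h.isSubmul_norm.expRate_ne_top h.one_le x
  lift Λ to ℝ using ⟨hΛ1, fun h0 => not_lt_bot (h0 ▸ he)⟩
  rw [EReal.coe_lt_coe_iff] at he
  have hd1 : (1 : ℝ) ≤ d := by exact_mod_cast Nat.one_le_iff_ne_zero.2 hd
  refine EReal.ge_of_forall_gt_iff_ge.1 fun z hz => ?_
  rw [EReal.coe_lt_coe_iff] at hz
  obtain ⟨γ, hγ, hγ'⟩ := exists_rat_btwn (show (0 : ℝ) < (Λ - e) / 2 by linarith)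
  obtain ⟨ε, hε, hε'⟩ := exists_rat_btwn
    (show (0 : ℝ) < min ((γ : ℝ) / (3 * d + 3)) (min ((Λ - e) / 2) ((Λ - z) / (d + 2))) from
      lt_min (by positivity) (lt_min (by linarith) (div_pos (by linarith) (by positivity))))
  obtain ⟨hε1, hε2, hε3⟩ := lt_min_iff.1 hε' |>.imp_right lt_min_iff.1
  rw [lt_div_iff₀ (by positivity)] at hε1 hε3
  obtain ⟨l, hl, hl'⟩ := exists_rat_btwn (show Λ - ε < Λ by linarith)
  refine le_limsup_of_frequently_le' (((hx d l ε γ hd (by exact_mod_cast hε) (by linarith)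
    (EReal.coe_lt_coe_iff.2 (by linarith)) (hvol' l (EReal.coe_lt_coe_iff.2 hl'))
    (hvol.trans_lt (EReal.coe_lt_coe_iff.2 ?_))).and_eventually (eventually_ne_atTop 0)).mono ?_)
  · push_cast
    nlinarith
  · rintro n ⟨h1, h2⟩
    refine le_trans (EReal.coe_le_coe_iff.2 ?_) (le_mul_elog_of_exp_le h2 h1)
    nlinarith

end IsCocycle

end

omit [CompleteSpace 𝕏] in
/-- A cocycle of injective operators over a compact space grows at most exponentially. -/
theorem exists_isCocycle {X : Type*} [TopologicalSpace X] [CompactSpace X] {T : X → X}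
    {𝒜 : X → ℕ → (𝕏 →L[ℝ] 𝕏)} (hcoc : ∀ x n m, 𝒜 x (n + m) = 𝒜 (T^[m] x) n * 𝒜 x m)
    (hcont : ∀ k, Continuous fun x => 𝒜 x k) (hinj : ∀ x n, Function.Injective (𝒜 x n)) :
    ∃ M, IsCocycle T 𝒜 M := by
  obtain ⟨C, hC⟩ := (isCompact_range (hcont 1)).exists_bound_of_continuousOn continuousOn_id
  refine ⟨max C 1, hcoc, hcont, fun x n => ?_, le_max_right _ _⟩
  induction n with
  | zero =>
    have h1 : 𝒜 x 0 = 1 := by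
      ext w
      have h2 := congrArg (fun A => A w) (hcoc x 0 0)
      exact (hinj x 0 h2).symm
    rw [h1, pow_zero]
    exact ContinuousLinearMap.norm_id_le
  | succ n ih =>
    rw [add_comm, hcoc, pow_add, pow_one]
    exact (norm_mul_le _ _).trans (mul_le_mul ((hC _ ⟨_, rfl⟩).trans (le_max_left _ _)) ih
      (norm_nonneg _) (zero_le_one.trans (le_max_right _ _)))

/-- For a continuous injective linear cocycle `𝒜` over a homeomorphism `T` of a compact metric
space preserving a Borel probability measure `μ`, for `μ`-a.e. `x` the limits
`λ(x) = lim (1/n) log ‖𝒜(x,n)‖` and `χ(x) = lim (1/n) log ‖𝒜(x,n)‖_χ` exist in `ℝ ∪ {-∞}`,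
and if `χ(x) < λ(x)` then `limsup (1/n) log ρ(𝒜(x,n)) = λ(x)`. -/
theorem spectral_radius_rate {X : Type*} [MetricSpace X] [CompactSpace X]
    [MeasurableSpace X] [BorelSpace X] (T : X ≃ₜ X)
    (μ : Measure X) [IsProbabilityMeasure μ] (hT : MeasurePreserving T μ μ)
    (𝒜 : X → ℕ → (𝕏 →L[ℝ] 𝕏))
    (hcoc : ∀ x n m, 𝒜 x (n + m) = 𝒜 ((⇑T)^[m] x) n * 𝒜 x m)
    (hcont : ∀ k, Continuous fun x => 𝒜 x k)
    (hinj : ∀ x n, Function.Injective (𝒜 x n)) :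
    ∀ᵐ x ∂μ, ∃ lam χ : EReal, lam ≠ ⊤ ∧ χ ≠ ⊤ ∧
      Tendsto (fun n : ℕ => (((n : ℝ)⁻¹ : ℝ) : EReal) * elog ‖𝒜 x n‖)
        atTop (nhds lam) ∧
      Tendsto (fun n : ℕ => (((n : ℝ)⁻¹ : ℝ) : EReal) * elog (hmnc (𝒜 x n)))
        atTop (nhds χ) ∧
      (χ < lam →
        Filter.atTop.limsup
          (fun n : ℕ => (((n : ℝ)⁻¹ : ℝ) : EReal) * elog (specRad (𝒜 x n))) = lam) := by
  obtain ⟨M, h⟩ := exists_isCocycle hcoc hcont hinj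
  have hM := h.one_le
  have hS : MeasurePreserving T.symm μ μ := MeasurePreserving.symm T.toMeasurableEquiv hT
  filter_upwards [h.isSubmul_norm.tendsto_ae hT hM, h.isSubmul_hmnc.tendsto_ae hT hM,
    h.le_limsup_specRad_ae hT hS T.apply_symm_apply T.symm_apply_apply T.symm.continuous]
    with x h1 h2 h3
  refine ⟨_, _, h.isSubmul_norm.expRate_ne_top hM x, h.isSubmul_hmnc.expRate_ne_top hM x,
    h1.1, h2.1, fun hlt => le_antisymm ?_ (h3 hlt)⟩
  refine limsup_le_limsup (Eventually.of_forall fun n => ?_)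
  exact mul_le_mul_of_nonneg_left (elog_mono (specRad_nonneg _) (specRad_le_norm _))
    (EReal.coe_nonneg.2 (inv_nonneg.2 n.cast_nonneg))
end
end

section
/- Let 𝔛 be a Banach space and 𝖠 ⊆ B(𝔛) compact and nonempty. Let X := 𝖠^ℤ with the product topology, let T : X → X be the shift homeomorphism T((A_i)_{i∈ℤ}) := (A_{i+1})_{i∈ℤ}, and define the continuous cocycle 𝒜(x, n) := A_n ⋯ A_1 for x = (A_i)_{i∈ℤ} ∈ X and n ∈ ℕ. Then log ρ̂(𝖠) = sup_{μ ∈ M_T} inf_{n≥1} (1/n) ∫ log ‖𝒜(x,n)‖ dμ(x), where M_T denotes the set of T-invariant Borel probability measures on X and both sides take values in [−∞, ∞). -/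
open Filter Topology MeasureTheory

noncomputable section

variable {𝕏 : Type*} [NormedAddCommGroup 𝕏] [NormedSpace ℝ 𝕏] [CompleteSpace 𝕏]

/-- Truncation of an extended real to `ℝ≥0∞` (the positive part). -/
def erealToENNReal (x : EReal) : ENNReal := if x = ⊤ then ⊤ else ENNReal.ofReal x.toReal

/-- Integral of an `EReal`-valued function: the difference of the integrals of the positive
and negative parts; for functions bounded above on a probability space it takes values in
`[-∞, ∞)`. -/
def integralEReal {X : Type*} [MeasurableSpace X] (μ : Measure X) (f : X → EReal) : EReal :=
  ((∫⁻ x, erealToENNReal (f x) ∂μ : ENNReal) : EReal)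
    - ((∫⁻ x, erealToENNReal (-(f x)) ∂μ : ENNReal) : EReal)

/-- The shift homeomorphism on `X = 𝖠^ℤ`, `(T x)_i = x_{i+1}`. -/
def shiftT (A : Set (𝕏 →L[ℝ] 𝕏)) : (ℤ → ↥A) → (ℤ → ↥A) := fun x i => x (i + 1)

/-- The continuous cocycle `𝒜(x, n) = A_n ⋯ A_1` over the shift on `𝖠^ℤ`,
where `x = (A_i)_{i ∈ ℤ}`. -/
def shiftCocycle (A : Set (𝕏 →L[ℝ] 𝕏)) (x : ℤ → ↥A) (n : ℕ) : 𝕏 →L[ℝ] 𝕏 :=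
  (List.ofFn fun i : Fin n => ((x ((n : ℤ) - (i : ℕ))) : 𝕏 →L[ℝ] 𝕏)).prod

lemma exists_empirical_measure {E : Type*} [MeasurableSpace E] (T : E → E) (x : E) (n : ℕ) :
    ∃ μ : ProbabilityMeasure E, ∀ φ : E → ℝ, Measurable φ →
      ∫ y, φ y ∂(μ : Measure E) = birkhoffAverage ℝ T φ (n + 1) x := by
  refine ⟨⟨((n + 1 : ℕ) : ENNReal)⁻¹ • ∑ k ∈ Finset.range (n + 1), Measure.dirac (T^[k] x),
    ⟨?_⟩⟩, fun φ hφ => ?_⟩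
  · simp only [Measure.smul_apply, Measure.coe_finsetSum, Finset.sum_apply, measure_univ,
      Finset.sum_const, Finset.card_range, smul_eq_mul, nsmul_eq_mul, mul_one]
    exact ENNReal.inv_mul_cancel (by simp) (by simp)
  · simp only [ProbabilityMeasure.coe_mk, integral_smul_measure, birkhoffAverage, birkhoffSum]
    rw [integral_finsetSum_measure]
    · congr 1
      · rw [ENNReal.toReal_inv, ENNReal.toReal_natCast]
      · exact Finset.sum_congr rfl fun k _ => integral_dirac' _ _ hφ.stronglyMeasurable
    · intro k _
      exact integrable_dirac' hφ.stronglyMeasurable (by simp)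

/-- **Krylov-Bogolyubov**: empirical measures along orbits accumulate at an invariant measure. -/
lemma exists_invariant_tendsto_birkhoffAverage {E : Type*} [TopologicalSpace E]
    [CompactSpace E] [TopologicalSpace.MetrizableSpace E] [MeasurableSpace E] [BorelSpace E]
    {T : E → E} (hT : Continuous T) (x : ℕ → E) :
    ∃ μ : Measure E, IsProbabilityMeasure μ ∧ MeasurePreserving T μ μ ∧
      ∃ U : Ultrafilter ℕ, (U : Filter ℕ) ≤ atTop ∧ ∀ φ : E → ℝ, Continuous φ →
        Tendsto (fun n => birkhoffAverage ℝ T φ (n + 1) (x n)) U (𝓝 (∫ y, φ y ∂μ)) := by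
  choose ν hν using fun n => exists_empirical_measure T (x n) n
  let U : Ultrafilter ℕ := Ultrafilter.of atTop
  have hU : (U : Filter ℕ) ≤ atTop := Ultrafilter.of_le _
  obtain ⟨μ, -, hμ⟩ := isCompact_univ.ultrafilter_le_nhds (U.map ν) (by simp)
  have hlim : ∀ φ : E → ℝ, Continuous φ →
      Tendsto (fun n => birkhoffAverage ℝ T φ (n + 1) (x n)) U
        (𝓝 (∫ y, φ y ∂(μ : Measure E))) := by
    intro φ hφ
    have h := ProbabilityMeasure.tendsto_iff_forall_integral_tendsto.1
      (show Tendsto ν U (𝓝 μ) from hμ) (BoundedContinuousFunction.mkOfCompact ⟨φ, hφ⟩)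
    simpa [hν _ φ hφ.measurable] using h
  refine ⟨μ, inferInstance, ⟨hT.measurable, ?_⟩, U, hU, hlim⟩
  have := Measure.isProbabilityMeasure_map (μ := (μ : Measure E)) hT.aemeasurable
  refine ext_of_forall_integral_eq_of_IsFiniteMeasure fun f => ?_
  rw [integral_map hT.aemeasurable f.continuous.aestronglyMeasurable]
  refine eq_of_sub_eq_zero (tendsto_nhds_unique
    ((hlim _ (f.continuous.comp hT)).sub (hlim _ f.continuous)) ?_)
  have h0 : Tendsto (fun n : ℕ => 2 * ‖f‖ * (1 / ((n : ℝ) + 1))) U (𝓝 0) := by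
    simpa using (tendsto_one_div_add_atTop_nhds_zero_nat.mono_left hU).const_mul (2 * ‖f‖)
  refine squeeze_zero_norm (fun n => ?_) h0
  have hcomm : birkhoffAverage ℝ T (f ∘ T) (n + 1) (x n) =
      birkhoffAverage ℝ T f (n + 1) (T (x n)) := by
    simp only [birkhoffAverage, birkhoffSum, Function.comp_apply, ← Function.iterate_succ_apply,
      ← Function.iterate_succ_apply']
  rw [hcomm, birkhoffAverage_apply_sub_birkhoffAverage, norm_smul, mul_comm]
  have h1 : ‖f (T^[n + 1] (x n)) - f (x n)‖ ≤ 2 * ‖f‖ := by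
    rw [← dist_eq_norm]; exact f.dist_le_two_norm _ _
  have h2 : ‖(((n + 1 : ℕ) : ℝ))⁻¹‖ = 1 / ((n : ℝ) + 1) := by
    rw [Real.norm_of_nonneg (by positivity)]; simp
  rw [h2]
  gcongr

lemma integralEReal_le_of_le {X : Type*} [MeasurableSpace X] {μ : Measure X}
    [IsProbabilityMeasure μ] {f : X → EReal} {c : ℝ} (h : ∀ x, f x ≤ c) :
    integralEReal μ f ≤ c := by
  have hpos : ∫⁻ x, erealToENNReal (f x) ∂μ ≤ ENNReal.ofReal c := by
    refine (lintegral_mono (g := fun _ => ENNReal.ofReal c) fun x => ?_).trans_eq (by simp)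
    have hx := h x
    induction hfx : f x with
    | bot => simp [erealToENNReal]
    | top => simp [hfx] at hx
    | coe r =>
      rw [hfx, EReal.coe_le_coe_iff] at hx
      simpa [erealToENNReal] using ENNReal.ofReal_le_ofReal hx
  have hneg : ENNReal.ofReal (-c) ≤ ∫⁻ x, erealToENNReal (-f x) ∂μ := by
    refine Eq.trans_le (by simp) (lintegral_mono (μ := μ) (f := fun _ => ENNReal.ofReal (-c))
      fun x => ?_)
    have hx := h x
    induction hfx : f x with
    | bot => simp [erealToENNReal]
    | top => simp [hfx] at hx
    | coe r =>
      rw [hfx, EReal.coe_le_coe_iff] at hx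
      have : erealToENNReal (-(r : EReal)) = ENNReal.ofReal (-r) := by
        rw [← EReal.coe_neg, erealToENNReal, if_neg (EReal.coe_ne_top _), EReal.toReal_coe]
      rw [this]
      exact ENNReal.ofReal_le_ofReal (neg_le_neg hx)
  refine (EReal.sub_le_sub (EReal.coe_ennreal_le_coe_ennreal_iff.2 hpos)
    (EReal.coe_ennreal_le_coe_ennreal_iff.2 hneg)).trans ?_
  rw [EReal.coe_ennreal_ofReal, EReal.coe_ennreal_ofReal, ← EReal.coe_sub,
    EReal.coe_le_coe_iff]
  rcases le_total c 0 with hc | hc <;> simp [hc]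

lemma erealToENNReal_elog {t ε : ℝ} (ht : 0 ≤ t) (hε : 0 < ε) (hε1 : ε ≤ 1) :
    erealToENNReal (elog t) = ENNReal.ofReal (Real.log (max t ε)) := by
  rcases ht.eq_or_lt with rfl | ht
  · simp [elog, erealToENNReal, max_eq_right hε.le, Real.log_nonpos hε.le hε1]
  · simp only [elog, ht.ne', if_false, erealToENNReal, EReal.coe_ne_top, EReal.toReal_coe]
    rcases le_total t ε with h | h
    · rw [max_eq_right h, ENNReal.ofReal_of_nonpos (Real.log_nonpos hε.le hε1),
        ENNReal.ofReal_of_nonpos (Real.log_nonpos ht.le (h.trans hε1))]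
    · rw [max_eq_left h]

lemma erealToENNReal_neg_elog {t : ℝ} (ht : 0 ≤ t) :
    erealToENNReal (-elog t) =
      ⨆ j : ℕ, ENNReal.ofReal (-Real.log (max t (Real.exp (-(j : ℝ))))) := by
  rcases ht.eq_or_lt with rfl | ht
  · have h (j : ℕ) : -Real.log (max 0 (Real.exp (-(j : ℝ)))) = j := by
      rw [max_eq_right (Real.exp_pos _).le, Real.log_exp, neg_neg]
    simp [elog, erealToENNReal, h, ENNReal.iSup_natCast]
  · have h : erealToENNReal (-elog t) = ENNReal.ofReal (-Real.log t) := by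
      rw [elog, if_neg ht.ne', ← EReal.coe_neg, erealToENNReal, if_neg (EReal.coe_ne_top _),
        EReal.toReal_coe]
    rw [h]
    apply le_antisymm
    · obtain ⟨j, hj⟩ := exists_nat_ge (-Real.log t)
      refine le_iSup_of_le j ?_
      rw [max_eq_left]
      rw [← Real.le_log_iff_exp_le ht]
      linarith
    · refine iSup_le fun j => ENNReal.ofReal_le_ofReal (neg_le_neg ?_)
      exact Real.log_le_log ht (le_max_left _ _)

lemma le_integralEReal_elog {X : Type*} [MeasurableSpace X] {μ : Measure X}
    [IsProbabilityMeasure μ] {N : X → ℝ} (hN : Measurable N) (hN0 : ∀ x, 0 ≤ N x)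
    {C : ℝ} (hC : ∀ x, N x ≤ C) {a : ℝ}
    (h : ∀ ε : ℝ, 0 < ε → ε ≤ 1 → a ≤ ∫ x, Real.log (max (N x) ε) ∂μ) :
    (a : EReal) ≤ integralEReal μ fun x => elog (N x) := by
  let g : ℕ → X → ℝ := fun j x => Real.log (max (N x) (Real.exp (-(j : ℝ))))
  have hg (j : ℕ) : Measurable (g j) := Real.measurable_log.comp (hN.max measurable_const)
  have hexp (j : ℕ) : Real.exp (-(j : ℝ)) ≤ 1 := by simp
  have hgi (j : ℕ) : Integrable (g j) μ := by
    refine Integrable.of_mem_Icc (-(j : ℝ)) (Real.log (max C 1)) (hg j).aemeasurable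
      (ae_of_all _ fun x => ⟨?_, ?_⟩)
    · rw [Real.le_log_iff_exp_le (by positivity)]
      exact le_max_right _ _
    · exact Real.log_le_log (by positivity) (max_le_max (hC x) (hexp j))
  set P := ∫⁻ x, erealToENNReal (elog (N x)) ∂μ with hP
  have hPj (j : ℕ) : P = ∫⁻ x, ENNReal.ofReal (g j x) ∂μ :=
    lintegral_congr fun x => erealToENNReal_elog (hN0 x) (Real.exp_pos _) (hexp j)
  have hPtop : P ≠ ⊤ := by
    rw [hPj 0]; exact (hgi 0).lintegral_lt_top.ne
  have hM : ∫⁻ x, erealToENNReal (-elog (N x)) ∂μ ≤ ENNReal.ofReal (P.toReal - a) := by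
    have : ∀ x, erealToENNReal (-elog (N x)) = ⨆ j, ENNReal.ofReal (-g j x) :=
      fun x => erealToENNReal_neg_elog (hN0 x)
    simp_rw [this]
    rw [lintegral_iSup (f := fun j x => ENNReal.ofReal (-g j x))
      (fun j => (hg j).neg.ennreal_ofReal)]
    · refine iSup_le fun j => ?_
      have h1 := integral_eq_lintegral_pos_part_sub_lintegral_neg_part (hgi j)
      rw [← hPj j] at h1
      have h2 := h _ (Real.exp_pos (-(j : ℝ))) (hexp j)
      have htop : ∫⁻ x, ENNReal.ofReal (-g j x) ∂μ ≠ ⊤ := (hgi j).neg.lintegral_lt_top.ne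
      rw [ENNReal.le_ofReal_iff_toReal_le htop]
      · linarith
      · have := ENNReal.toReal_nonneg (a := ∫⁻ x, ENNReal.ofReal (-g j x) ∂μ)
        linarith
    · intro i j hij x
      refine ENNReal.ofReal_le_ofReal (neg_le_neg (Real.log_le_log (by positivity) ?_))
      gcongr
  have haP : 0 ≤ P.toReal - a := by
    have h1 := integral_eq_lintegral_pos_part_sub_lintegral_neg_part (hgi 0)
    rw [← hPj 0] at h1
    have h2 := h _ (Real.exp_pos (-((0 : ℕ) : ℝ))) (hexp 0)
    have := ENNReal.toReal_nonneg (a := ∫⁻ x, ENNReal.ofReal (-g 0 x) ∂μ)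
    linarith
  rw [integralEReal, ← hP]
  refine le_trans ?_ (EReal.sub_le_sub le_rfl (EReal.coe_ennreal_le_coe_ennreal_iff.2 hM))
  have hPr : (P : EReal) = (P.toReal : EReal) := by
    conv_lhs => rw [← ENNReal.ofReal_toReal hPtop]
    rw [EReal.coe_ennreal_ofReal, max_eq_left ENNReal.toReal_nonneg]
  rw [EReal.coe_ennreal_ofReal, max_eq_left haP, hPr, ← EReal.coe_sub, sub_sub_cancel]

section Subadditive

variable {E : Type*} {T : E → E} {N : ℕ → E → ℝ} {C : ℝ}

/-- Telescoping for a submultiplicative cocycle: a block of shifted norms is bounded by the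
Birkhoff product of `N (p + 1)`. -/
lemma prod_shifted_le_mul_prod (hN0 : ∀ n x, 0 ≤ N n x)
    (hmul : ∀ m n x, N (n + m) x ≤ N n (T^[m] x) * N m x) (hNC : ∀ n x, N n x ≤ C ^ n)
    (hC : 1 ≤ C) (p n : ℕ) (x : E) :
    ∏ j ∈ Finset.range (p + 1), N (n + (p - j)) (T^[j] x) ≤
      C ^ (p * (p + 1)) * ∏ k ∈ Finset.range n, N (p + 1) (T^[k] x) := by
  induction n generalizing x with
  | zero =>
    simp only [zero_add, Finset.range_zero, Finset.prod_empty, mul_one]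
    calc ∏ j ∈ Finset.range (p + 1), N (p - j) (T^[j] x)
        ≤ ∏ _j ∈ Finset.range (p + 1), C ^ p :=
          Finset.prod_le_prod (fun j _ => hN0 _ _) fun j _ =>
            (hNC _ _).trans (pow_le_pow_right₀ hC (Nat.sub_le _ _))
      _ = C ^ (p * (p + 1)) := by simp [pow_mul]
  | succ n ih =>
    have hshift : ∏ j ∈ Finset.range p, N (n + 1 + (p - (j + 1))) (T^[j + 1] x) =
        ∏ j ∈ Finset.range p, N (n + (p - j)) (T^[j] (T x)) := by
      refine Finset.prod_congr rfl fun j hj => ?_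
      have := Finset.mem_range.1 hj
      rw [Function.iterate_succ_apply, show n + 1 + (p - (j + 1)) = n + (p - j) by omega]
    have hih := ih (T x)
    rw [Finset.prod_range_succ] at hih
    rw [Finset.prod_range_succ', hshift, Finset.prod_range_succ']
    simp only [Nat.sub_self, add_zero, tsub_zero, Function.iterate_zero, id,
      Function.iterate_succ_apply] at hih ⊢
    set Q := ∏ j ∈ Finset.range p, N (n + (p - j)) (T^[j] (T x)) with hQ
    have hQ0 : 0 ≤ Q := Finset.prod_nonneg fun _ _ => hN0 _ _
    have h1 := hmul (p + 1) n x
    rw [Function.iterate_succ_apply] at h1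
    calc Q * N (n + 1 + p) x = Q * N (n + (p + 1)) x := by rw [show n + 1 + p = n + (p + 1) by ring]
      _ ≤ Q * (N n (T^[p] (T x)) * N (p + 1) x) := by gcongr
      _ = (Q * N n (T^[p] (T x))) * N (p + 1) x := by ring
      _ ≤ (C ^ (p * (p + 1)) * ∏ k ∈ Finset.range n, N (p + 1) (T^[k] (T x))) * N (p + 1) x :=
          mul_le_mul_of_nonneg_right hih (hN0 _ _)
      _ = _ := by ring

lemma pow_mul_pow_le_prod_max (hN0 : ∀ n x, 0 ≤ N n x)
    (hmul : ∀ m n x, N (n + m) x ≤ N n (T^[m] x) * N m x) (hNC : ∀ n x, N n x ≤ C ^ n)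
    (hC : 1 ≤ C) {ε : ℝ} (hε : 0 < ε) (p n : ℕ) (x : E) :
    N (n + p) x ^ (p + 1) * ε ^ p ≤ C ^ (2 * (p * (p + 1))) *
      ∏ k ∈ Finset.range (n + p), max (N (p + 1) (T^[k] x)) ε := by
  have hC0 : 0 ≤ C := by linarith
  have h1 : N (n + p) x ^ (p + 1) ≤
      C ^ (p * (p + 1)) * ∏ j ∈ Finset.range (p + 1), N (n + (p - j)) (T^[j] x) := by
    calc N (n + p) x ^ (p + 1) = ∏ _j ∈ Finset.range (p + 1), N (n + p) x := by simp
      _ ≤ ∏ j ∈ Finset.range (p + 1), (C ^ p * N (n + (p - j)) (T^[j] x)) := by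
          refine Finset.prod_le_prod (fun _ _ => hN0 _ _) fun j hj => ?_
          have hj' : j ≤ p := Nat.lt_succ_iff.1 (Finset.mem_range.1 hj)
          have := hmul j (n + (p - j)) x
          rw [show n + (p - j) + j = n + p by omega] at this
          refine this.trans ?_
          rw [mul_comm]
          exact mul_le_mul_of_nonneg_right
            ((hNC _ _).trans (pow_le_pow_right₀ hC hj')) (hN0 _ _)
      _ = _ := by rw [Finset.prod_mul_distrib]; simp [pow_mul]
  have h2 : ∏ k ∈ Finset.range n, N (p + 1) (T^[k] x) ≤
      ∏ k ∈ Finset.range n, max (N (p + 1) (T^[k] x)) ε :=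
    Finset.prod_le_prod (fun _ _ => hN0 _ _) fun _ _ => le_max_left _ _
  have h3 : ε ^ p ≤ ∏ k ∈ Finset.range p, max (N (p + 1) (T^[n + k] x)) ε := by
    calc ε ^ p = ∏ _k ∈ Finset.range p, ε := by simp
      _ ≤ _ := Finset.prod_le_prod (fun _ _ => hε.le) fun _ _ => le_max_right _ _
  have h4 := prod_shifted_le_mul_prod hN0 hmul hNC hC p n x
  have hnn : 0 ≤ ∏ k ∈ Finset.range n, max (N (p + 1) (T^[k] x)) ε :=
    Finset.prod_nonneg fun _ _ => (hN0 _ _).trans (le_max_left _ _)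
  rw [Finset.prod_range_add, two_mul, pow_add C]
  calc N (n + p) x ^ (p + 1) * ε ^ p
      ≤ (C ^ (p * (p + 1)) * (C ^ (p * (p + 1)) *
          ∏ k ∈ Finset.range n, max (N (p + 1) (T^[k] x)) ε)) * ε ^ p := by
        gcongr
        exact h1.trans (mul_le_mul_of_nonneg_left
          (h4.trans (mul_le_mul_of_nonneg_left h2 (by positivity))) (by positivity))
    _ ≤ (C ^ (p * (p + 1)) * (C ^ (p * (p + 1)) *
          ∏ k ∈ Finset.range n, max (N (p + 1) (T^[k] x)) ε)) *
          ∏ k ∈ Finset.range p, max (N (p + 1) (T^[n + k] x)) ε := by gcongr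
    _ = _ := by ring

lemma log_le_birkhoffAverage (hN0 : ∀ n x, 0 ≤ N n x)
    (hmul : ∀ m n x, N (n + m) x ≤ N n (T^[m] x) * N m x) (hNC : ∀ n x, N n x ≤ C ^ n)
    (hC : 1 ≤ C) {ε : ℝ} (hε : 0 < ε) {p n : ℕ} (hpn : p ≤ n + 1) {r : ℝ} (hr : 0 < r) {x : E}
    (hx : r ^ (n + 1) ≤ N (n + 1) x) :
    ((p : ℝ) + 1) * Real.log r + (p * Real.log ε - Real.log (C ^ (2 * (p * (p + 1))))) *
      (1 / ((n : ℝ) + 1)) ≤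
      birkhoffAverage ℝ T (fun y => Real.log (max (N (p + 1) y) ε)) (n + 1) x := by
  obtain ⟨l, hl⟩ := Nat.exists_eq_add_of_le' hpn
  have h := pow_mul_pow_le_prod_max hN0 hmul hNC hC hε p l x
  rw [← hl] at h
  have hmax (k : ℕ) : max (N (p + 1) (T^[k] x)) ε ≠ 0 := (hε.trans_le (le_max_right _ _)).ne'
  have hlog := Real.log_le_log (by positivity)
    ((mul_le_mul_of_nonneg_right (pow_le_pow_left₀ (by positivity) hx (p + 1))
      (by positivity)).trans h)
  rw [Real.log_mul (by positivity) (by positivity), Real.log_mul (by positivity)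
    (Finset.prod_ne_zero_iff.2 fun k _ => hmax k), Real.log_prod fun k _ => hmax k,
    Real.log_pow, Real.log_pow, Real.log_pow] at hlog
  rw [birkhoffAverage, birkhoffSum, smul_eq_mul, ← div_eq_inv_mul, Nat.cast_succ,
    le_div_iff₀ (by positivity), add_mul, mul_assoc _ (1 / _), one_div_mul_cancel (by positivity)]
  push_cast at hlog
  linarith

end Subadditive

section Cocycle

variable {E : Type*} [NormedAddCommGroup E] [NormedSpace ℝ E] {A : Set (E →L[ℝ] E)}

lemma shiftT_iterate (k : ℕ) (x : ℤ → ↥A) (i : ℤ) : (shiftT A)^[k] x i = x (i + k) := by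
  induction k generalizing x with
  | zero => simp
  | succ k ih =>
    rw [Function.iterate_succ_apply, ih, shiftT]
    push_cast
    ring_nf

lemma shiftCocycle_zero (x : ℤ → ↥A) : shiftCocycle A x 0 = 1 := by
  simp [shiftCocycle]

lemma shiftCocycle_succ (x : ℤ → ↥A) (n : ℕ) :
    shiftCocycle A x (n + 1) = (x (n + 1) : E →L[ℝ] E) * shiftCocycle A x n := by
  simp only [shiftCocycle, List.ofFn_succ, List.prod_cons]
  simp

lemma shiftCocycle_add (x : ℤ → ↥A) (m n : ℕ) :
    shiftCocycle A x (n + m) = shiftCocycle A ((shiftT A)^[m] x) n * shiftCocycle A x m := by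
  induction n with
  | zero => simp [shiftCocycle_zero]
  | succ n ih =>
    rw [show n + 1 + m = (n + m) + 1 by ring, shiftCocycle_succ, shiftCocycle_succ, ih,
      shiftT_iterate, mul_assoc]
    push_cast
    ring_nf

lemma norm_shiftCocycle_le {C : ℝ} (hC : ∀ a ∈ A, ‖a‖ ≤ C) (n : ℕ) (x : ℤ → ↥A) :
    ‖shiftCocycle A x n‖ ≤ C ^ n := by
  induction n with
  | zero => rw [shiftCocycle_zero, pow_zero]; exact ContinuousLinearMap.norm_id_le
  | succ n ih =>
    rw [shiftCocycle_succ, pow_succ']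
    have := hC _ (x (n + 1)).2
    exact (norm_mul_le _ _).trans
      (mul_le_mul this ih (norm_nonneg _) ((norm_nonneg _).trans this))

lemma continuous_shiftCocycle (n : ℕ) : Continuous fun x : ℤ → ↥A => shiftCocycle A x n := by
  induction n with
  | zero => simpa [shiftCocycle_zero] using continuous_const
  | succ n ih =>
    simp only [shiftCocycle_succ]
    exact (continuous_subtype_val.comp (continuous_apply _)).mul ih

lemma continuous_shiftT : Continuous (shiftT A) :=
  continuous_pi fun _ => continuous_apply _

lemma prods_eq_range_shiftCocycle (hne : A.Nonempty) (n : ℕ) :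
    prods A n = Set.range fun x : ℤ → ↥A => shiftCocycle A x n := by
  ext P
  constructor
  · rintro ⟨f, hf, rfl⟩
    obtain ⟨a, ha⟩ := hne
    refine ⟨fun z => if h : ((n : ℤ) - z).toNat < n then ⟨f ⟨_, h⟩, hf _⟩ else ⟨a, ha⟩, ?_⟩
    simp [shiftCocycle]
  · rintro ⟨x, rfl⟩
    exact ⟨_, fun i => (x _).2, rfl⟩

end Cocycle

/-- **Variational characterization of the joint spectral radius:** for a compact nonempty set
`𝖠 ⊆ B(𝔛)`, `log ρ̂(𝖠) = sup_{μ ∈ M_T} inf_{n ≥ 1} (1/n) ∫ log ‖𝒜(x,n)‖ dμ(x)`, where `M_T`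
is the set of shift-invariant Borel probability measures on `𝖠^ℤ`.  The limit defining
`ρ̂(𝖠)` (which exists by submultiplicativity) is supplied as hypothesis `hr`. -/
theorem jsr_variational_principle [MeasurableSpace (𝕏 →L[ℝ] 𝕏)] [BorelSpace (𝕏 →L[ℝ] 𝕏)]
    (A : Set (𝕏 →L[ℝ] 𝕏)) (hA : IsCompact A) (hne : A.Nonempty) (ρhat : ℝ)
    (hr : Tendsto (fun n : ℕ => sSup ((fun P => ‖P‖ ^ (1 / (n : ℝ))) '' prods A n))
      atTop (nhds ρhat)) :
    elog ρhat =
      ⨆ μ : {μ : Measure (ℤ → ↥A) //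
          IsProbabilityMeasure μ ∧ MeasurePreserving (shiftT A) μ μ},
        ⨅ n : ℕ, ((((n : ℝ) + 1)⁻¹ : ℝ) : EReal) *
          integralEReal μ.1 (fun x => elog ‖shiftCocycle A x (n + 1)‖) := by
  have := isCompact_iff_compactSpace.1 hA
  have : Nonempty ↥A := hne.to_subtype
  obtain ⟨C₀, hC₀⟩ := hA.isBounded.exists_norm_le
  obtain ⟨C, hC1, hC⟩ : ∃ C : ℝ, 1 ≤ C ∧ ∀ a ∈ A, ‖a‖ ≤ C :=
    ⟨max 1 C₀, le_max_left _ _, fun a ha => (hC₀ a ha).trans (le_max_right _ _)⟩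
  let N : ℕ → (ℤ → ↥A) → ℝ := fun n x => ‖shiftCocycle A x n‖
  have hN0 : ∀ n x, 0 ≤ N n x := fun n x => norm_nonneg _
  have hNC : ∀ n x, N n x ≤ C ^ n := norm_shiftCocycle_le hC
  have hmul : ∀ m n x, N (n + m) x ≤ N n ((shiftT A)^[m] x) * N m x := fun m n x => by
    simpa only [N, shiftCocycle_add] using norm_mul_le _ _
  have hNcont : ∀ n, Continuous (N n) := fun n => (continuous_shiftCocycle n).norm
  let s : ℕ → ℝ := fun n => ⨆ x : ℤ → ↥A, N n x ^ (1 / (n : ℝ))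
  have hs : Tendsto s atTop (𝓝 ρhat) := by
    refine hr.congr fun n => ?_
    rw [prods_eq_range_shiftCocycle hne, ← Set.range_comp]
    rfl
  have hs1 : Tendsto (fun n => s (n + 1)) atTop (𝓝 ρhat) := (tendsto_add_atTop_iff_nat 1).2 hs
  have hbdd (n : ℕ) : BddAbove (Set.range fun x : ℤ → ↥A => N n x ^ (1 / (n : ℝ))) := by
    refine ⟨(C ^ n) ^ (1 / (n : ℝ)), ?_⟩
    rintro _ ⟨x, rfl⟩
    exact Real.rpow_le_rpow (hN0 _ _) (hNC n x) (by positivity)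
  have hroot (n : ℕ) (x : ℤ → ↥A) : (N (n + 1) x ^ (1 / ((n + 1 : ℕ) : ℝ))) ^ (n + 1) =
      N (n + 1) x := by
    rw [one_div, Real.rpow_inv_natCast_pow (hN0 _ _) n.succ_ne_zero]
  have hρ0 : 0 ≤ ρhat :=
    ge_of_tendsto' hs fun n => Real.iSup_nonneg fun x => Real.rpow_nonneg (hN0 _ _) _
  apply le_antisymm
  · rcases hρ0.eq_or_lt with hρ | hρ
    · simp [elog, ← hρ]
    have hex (n : ℕ) : ∃ x : ℤ → ↥A,
        s (n + 1) - 1 / ((n : ℝ) + 1) < N (n + 1) x ^ (1 / ((n + 1 : ℕ) : ℝ)) :=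
      exists_lt_of_lt_ciSup (sub_lt_self _ (by positivity))
    choose x hx using hex
    obtain ⟨μ, hμ, hμT, U, hU, hlim⟩ :=
      exists_invariant_tendsto_birkhoffAverage (continuous_shiftT (A := A)) x
    refine le_iSup_of_le ⟨μ, hμ, hμT⟩ (le_iInf fun p => ?_)
    have hr' : Tendsto (fun n : ℕ => s (n + 1) - 1 / ((n : ℝ) + 1)) atTop (𝓝 ρhat) := by
      simpa using hs1.sub tendsto_one_div_add_atTop_nhds_zero_nat
    have key : (((((p : ℝ) + 1) * Real.log ρhat : ℝ)) : EReal) ≤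
        integralEReal μ fun y => elog (N (p + 1) y) := by
      refine le_integralEReal_elog (hNcont _).measurable (hN0 _) (hNC _) fun ε hε _ => ?_
      have hφ : Continuous fun y => Real.log (max (N (p + 1) y) ε) :=
        ((hNcont _).max continuous_const).log fun y => (hε.trans_le (le_max_right _ _)).ne'
      have hlow : Tendsto (fun n : ℕ => ((p : ℝ) + 1) * Real.log (s (n + 1) - 1 / ((n : ℝ) + 1)) +
          (p * Real.log ε - Real.log (C ^ (2 * (p * (p + 1))))) * (1 / ((n : ℝ) + 1))) atTop
          (𝓝 (((p : ℝ) + 1) * Real.log ρhat)) := by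
        simpa using ((hr'.log hρ.ne').const_mul ((p : ℝ) + 1)).add
          (tendsto_one_div_add_atTop_nhds_zero_nat.const_mul
            (p * Real.log ε - Real.log (C ^ (2 * (p * (p + 1))))))
      refine le_of_tendsto_of_tendsto (hlow.mono_left hU) (hlim _ hφ) (hU ?_)
      filter_upwards [hr'.eventually_const_lt hρ, eventually_ge_atTop p] with n hn hpn
      refine log_le_birkhoffAverage hN0 hmul hNC hC1 hε (by omega) hn ?_
      rw [← hroot]
      exact pow_le_pow_left₀ hn.le (hx n).le _
    calc elog ρhat = ((((p : ℝ) + 1)⁻¹ : ℝ) : EReal) *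
          ((((p : ℝ) + 1) * Real.log ρhat : ℝ) : EReal) := by
          rw [elog, if_neg hρ.ne', ← EReal.coe_mul, inv_mul_cancel_left₀ (by positivity)]
      _ ≤ _ := mul_le_mul_of_nonneg_left key (EReal.coe_nonneg.2 (by positivity))
  · refine iSup_le fun ⟨μ, hμ, _⟩ => EReal.le_of_forall_lt_iff_le.1 fun c hc => ?_
    have hρc : ρhat < Real.exp c := by
      rcases hρ0.eq_or_lt with hρ | hρ
      · rw [← hρ]; exact Real.exp_pos c
      · rw [elog, if_neg hρ.ne', EReal.coe_lt_coe_iff] at hc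
        exact (Real.log_lt_iff_lt_exp hρ).1 hc
    obtain ⟨n, hn⟩ := (hs1.eventually_lt_const hρc).exists
    refine iInf_le_of_le n ?_
    have key : integralEReal μ (fun y => elog (N (n + 1) y)) ≤
        (((((n : ℝ) + 1) * c : ℝ)) : EReal) := by
      refine integralEReal_le_of_le fun y => ?_
      rcases (hN0 (n + 1) y).eq_or_lt with h0 | h0
      · simp [elog, ← h0]
      rw [elog, if_neg h0.ne', EReal.coe_le_coe_iff, Real.log_le_iff_le_exp h0, ← hroot]
      have hexp : Real.exp (((n : ℝ) + 1) * c) = Real.exp c ^ (n + 1) := by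
        rw [← Real.exp_nat_mul]; push_cast; rfl
      rw [hexp]
      exact pow_le_pow_left₀ (Real.rpow_nonneg (hN0 _ _) _)
        ((le_ciSup (hbdd (n + 1)) y).trans hn.le) _
    calc _ ≤ ((((n : ℝ) + 1)⁻¹ : ℝ) : EReal) * ((((n : ℝ) + 1) * c : ℝ) : EReal) :=
          mul_le_mul_of_nonneg_left key (EReal.coe_nonneg.2 (by positivity))
      _ = c := by rw [← EReal.coe_mul, inv_mul_cancel_left₀ (by positivity)]
end
end
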